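/- Let d ≥ 2 and let β_1, β_2, …, β_d, β_{d+2}, …, β_{2d} be fixed positive numbers. There exists ε ∈ (0,1), depending on these numbers, such that if 0 < β_{1+d} ≤ ε and the full parameter vector satisfies Σ_{i=1}^{2d} β_i − sup_{1≤i≤d}(β_i + β_{i+d}) > 1, then the random walk in the i.i.d. Dirichlet environment with parameters (β_1, …, β_{2d}) is ballistic in direction e_1, i.e. liminf_{n→∞} X_n·e_1/n > 0, P_0-almost surely. -/

import Mathlib

open MeasureTheory Filter Topology
open scoped ENNReal NNReal Classical BigOperators

namespace RWRE

/-- Sites of the lattice `ℤ^d`. -/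
abbrev V (d : ℕ) := Fin d → ℤ

/-- The `2d` canonical unit vectors: `dir d i = e_{i+1}` for `i < d`, and
`dir d i = -e_{i-d+1}` for `d ≤ i < 2d`. -/
def dir (d : ℕ) (i : Fin (2 * d)) : V d :=
  fun j => if (j : ℕ) = (i : ℕ) ∨ (j : ℕ) + d = (i : ℕ) then (if (i : ℕ) < d then 1 else -1) else 0

/-- The index of the direction opposite to direction `i`. -/
def opp {d : ℕ} (i : Fin (2 * d)) : Fin (2 * d) :=
  ⟨if (i : ℕ) < d then (i : ℕ) + d else (i : ℕ) - d, by have := i.isLt; split <;> omega⟩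

/-- The set `𝒫` of probability vectors on the `2d` directions. -/
abbrev Simplex (d : ℕ) := {p : Fin (2 * d) → ℝ // (∀ i, 0 ≤ p i) ∧ ∑ i, p i = 1}

/-- The environment space `Ω = 𝒫^{ℤ^d}`. -/
abbrev Env (d : ℕ) := V d → Simplex d

/-- The space of trajectories of the walk. -/
abbrev Traj (d : ℕ) := ℕ → V d

/-- Transition probability of the walk from `y` to `z` in environment `ω`. -/
noncomputable def trans (d : ℕ) (ω : Env d) (y z : V d) : ℝ :=
  ∑ i : Fin (2 * d), if z = y + dir d i then (ω y).1 i else 0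

/-- `Pq` is the family of quenched laws: `Pq ω x` is a probability measure on trajectories,
starting at `x`, whose cylinder probabilities are given by the products of the transition
probabilities of the environment `ω`. -/
def IsQuenchedLaw (d : ℕ) (Pq : Env d → V d → Measure (Traj d)) : Prop :=
  (∀ ω x, IsProbabilityMeasure (Pq ω x)) ∧
  ∀ (ω : Env d) (x : V d) (n : ℕ) (σ : ℕ → V d),
    (Pq ω x {f | ∀ k ≤ n, f k = σ k}).toReal =
      (if σ 0 = x then 1 else 0) * ∏ k ∈ Finset.range n, trans d ω (σ k) (σ (k + 1))

/-- The annealed (averaged) law `P_x = ∫ P_{x,ω} dℙ`. -/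
noncomputable def annealed (d : ℕ) (ℙ : Measure (Env d)) (Pq : Env d → V d → Measure (Traj d))
    (x : V d) : Measure (Traj d) :=
  ℙ.bind (fun ω => Pq ω x)

/-- `{ω(x) : x ∈ ℤ^d}` are i.i.d. under `ℙ`, with one-site marginal `μ`. -/
def IsIIDWith (d : ℕ) (ℙ : Measure (Env d)) (μ : Measure (Simplex d)) : Prop :=
  IsProbabilityMeasure ℙ ∧ IsProbabilityMeasure μ ∧
  ∀ (s : Finset (V d)) (A : V d → Set (Simplex d)), (∀ x, MeasurableSet (A x)) →
    ℙ {ω | ∀ x ∈ s, ω x ∈ A x} = ∏ x ∈ s, μ (A x)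

/-- `{ω(x) : x ∈ ℤ^d}` are i.i.d. under `ℙ`. -/
def IsIID (d : ℕ) (ℙ : Measure (Env d)) : Prop :=
  ∃ μ : Measure (Simplex d), IsIIDWith d ℙ μ

/-- `ℙ` is elliptic. -/
def IsElliptic (d : ℕ) (ℙ : Measure (Env d)) : Prop :=
  ∀ (x : V d) (i : Fin (2 * d)), ℙ {ω | 0 < (ω x).1 i} = 1

/-- First exit time from a set `A` (with value `0` by convention if the walk never leaves `A`). -/
noncomputable def exitTime (d : ℕ) (A : Set (V d)) (f : Traj d) : ℕ :=
  sInf {n | f n ∉ A}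

/-- The coordinates of a site, as a real vector. -/
def toR (d : ℕ) (x : V d) : Fin d → ℝ := fun j => (x j : ℝ)

/-- Euclidean inner product of a site with a real vector `l`. -/
noncomputable def dotl (d : ℕ) (l : Fin d → ℝ) (x : V d) : ℝ :=
  ∑ j, (x j : ℝ) * l j

/-- The first canonical basis vector `e_1` of `ℝ^d`. -/
def e1 (d : ℕ) : Fin d → ℝ := fun j => if (j : ℕ) = 0 then 1 else 0

/-- `R` is a rotation of `ℝ^d`: a linear automorphism preserving the Euclidean inner
product, with determinant one. -/
def IsRotation (d : ℕ) (R : (Fin d → ℝ) ≃ₗ[ℝ] (Fin d → ℝ)) : Prop :=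
  (∀ u v : Fin d → ℝ, ∑ j, R u j * R v j = ∑ j, u j * v j) ∧
    LinearMap.det (R : (Fin d → ℝ) →ₗ[ℝ] (Fin d → ℝ)) = 1

/-- The box `B_{l,L,L̃} = R((-L,L) × (-L̃,L̃)^{d-1}) ∩ ℤ^d`, where `R` is a rotation
with `R e_1 = l`. -/
def box (d : ℕ) (R : (Fin d → ℝ) ≃ₗ[ℝ] (Fin d → ℝ)) (L Lt : ℝ) : Set (V d) :=
  {x | ∀ j : Fin d,
    if (j : ℕ) = 0 then -L < R.symm (toR d x) j ∧ R.symm (toR d x) j < L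
    else -Lt < R.symm (toR d x) j ∧ R.symm (toR d x) j < Lt}

/-- The polynomial condition `(P)_M` in direction `l` on a box of size `L`. -/
def PolyCond (d : ℕ) (ℙ : Measure (Env d)) (Pq : Env d → V d → Measure (Traj d))
    (l : Fin d → ℝ) (M L : ℝ) : Prop :=
  ∃ Lt : ℝ, 0 < Lt ∧ Lt ≤ 70 * L ^ 3 ∧
  ∃ R : (Fin d → ℝ) ≃ₗ[ℝ] (Fin d → ℝ), IsRotation d R ∧ R (e1 d) = l ∧
    ((annealed d ℙ Pq 0) {f | dotl d l (f (exitTime d (box d R L Lt) f)) < L}).toReal ≤ 1 / L ^ M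

/-- The quantity `η_α = max_{e ∈ U} 𝔼[ω(0,e)^{-α}]`. -/
noncomputable def eta (d : ℕ) (ℙ : Measure (Env d)) (α : ℝ) : ℝ≥0∞ :=
  ⨆ i : Fin (2 * d), ∫⁻ ω, ENNReal.ofReal ((ω 0).1 i ^ (-α)) ∂ℙ

/-- `ᾱ = sup{α ≥ 0 : η_α < ∞}`. -/
noncomputable def alphaBar (d : ℕ) (ℙ : Measure (Env d)) : ℝ :=
  sSup {α : ℝ | 0 ≤ α ∧ eta d ℙ α < ⊤}

/-- The constant `c_0 = (2/3)·3^{120d⁴ + 3000d(log η_{ᾱ/2})²}`. -/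
noncomputable def c0 (d : ℕ) (ℙ : Measure (Env d)) : ℝ :=
  (2 / 3) * (3 : ℝ) ^ (120 * (d : ℝ) ^ 4 +
    3000 * (d : ℝ) * (Real.log (eta d ℙ (alphaBar d ℙ / 2)).toReal) ^ 2)

/-- The ellipticity condition `(E')_β`. -/
def CondE (d : ℕ) (ℙ : Measure (Env d)) (β : ℝ) : Prop :=
  ∃ α : Fin (2 * d) → ℝ, (∀ i, 0 < α i) ∧
    (∀ i, 2 * (∑ j, α j) - (α i + α (opp i)) > β) ∧
    ∀ i : Fin (2 * d),
      ∫⁻ ω, ∏ j ∈ Finset.univ.erase i, ENNReal.ofReal ((ω 0).1 j ^ (-(α j))) ∂ℙ < ⊤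


/-- First `n` with `P n`, as an extended natural number (`⊤` if there is none). -/
noncomputable def firstTime (P : ℕ → Prop) : ℕ∞ :=
  if ∃ n, P n then ((sInf {n | P n} : ℕ) : ℕ∞) else ⊤

/-- The triple `(S_k, R_k, M_k)` of the regeneration construction in direction `l`
with parameter `a`. -/
noncomputable def SR (d : ℕ) (l : Fin d → ℝ) (a : ℝ) (f : Traj d) : ℕ → ℕ∞ × ℕ∞ × ℝ
  | 0 => (0, 0, dotl d l (f 0))
  | (k + 1) =>
      let M := (SR d l a f k).2.2
      let S : ℕ∞ := firstTime fun n => M + a ≤ dotl d l (f n)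
      let s : ℕ := S.toNat
      let R : ℕ∞ := if S = ⊤ then ⊤ else
        S + firstTime fun n => dotl d l (f (s + n)) < dotl d l (f s)
      let M' : ℝ := sSup {r : ℝ | ∃ n : ℕ, (n : ℕ∞) ≤ R ∧ r = dotl d l (f n)}
      (S, R, M')

/-- The first regeneration time `τ_1` in direction `l` with parameter `a`. -/
noncomputable def tau1 (d : ℕ) (l : Fin d → ℝ) (a : ℝ) (f : Traj d) : ℕ∞ :=
  if _h : ∃ k : ℕ, 1 ≤ k ∧ (SR d l a f k).1 ≠ ⊤ ∧ (SR d l a f k).2.1 = ⊤ then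
    (SR d l a f (sInf {k : ℕ | 1 ≤ k ∧ (SR d l a f k).1 ≠ ⊤ ∧ (SR d l a f k).2.1 = ⊤})).1
  else ⊤

/-- The event `τ_1 > u` for a real threshold `u`. -/
def tau1Gt (d : ℕ) (l : Fin d → ℝ) (a : ℝ) (u : ℝ) : Set (Traj d) :=
  {f | ∀ k : ℕ, tau1 d l a f = (k : ℕ∞) → u < (k : ℝ)}

/-- `v` is the asymptotic direction of the walk under the law `P0`:
`X_n/|X_n|₂ → v` almost surely. -/
def HasAsympDir (d : ℕ) (P0 : Measure (Traj d)) (v : Fin d → ℝ) : Prop :=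
  ∀ᵐ f ∂P0, Tendsto
    (fun n => fun j : Fin d => (f n j : ℝ) / Real.sqrt (∑ j', ((f n j' : ℝ)) ^ 2))
    atTop (𝓝 v)

/-- `γ` is the centered Gaussian measure on `ι → ℝ` with covariance matrix `C`:
every linear functional pushes it forward to a one-dimensional centered Gaussian with
the corresponding variance. -/
def IsCenteredGaussian {ι : Type*} [Fintype ι] (γ : Measure (ι → ℝ)) (C : ι → ι → ℝ) : Prop :=
  ∀ u : ι → ℝ, γ.map (fun x => ∑ i, u i * x i) =
    ProbabilityTheory.gaussianReal 0 (Real.toNNReal (∑ i, ∑ j, u i * C i j * u j))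

/-- `ε^{1/2}(X_{⌊ε⁻¹n⌋} - ⌊ε⁻¹n⌋ v)` converges in law under `P0`, as `ε → 0`, to a Brownian
motion with non-degenerate covariance matrix `C`: the finite-dimensional distributions at any
times `t : Fin k → ℕ` converge weakly to the centered Gaussian with covariance
`min(t_p, t_q)·C`. -/
def CLTtoBM (d : ℕ) (P0 : Measure (Traj d)) (v : Fin d → ℝ)
    (Cmat : Matrix (Fin d) (Fin d) ℝ) : Prop :=
  ∀ (k : ℕ) (t : Fin k → ℕ),
    ∃ γ : Measure (Fin k × Fin d → ℝ), IsProbabilityMeasure γ ∧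
      IsCenteredGaussian γ (fun p q => (min (t p.1) (t q.1) : ℝ) * Cmat p.2 q.2) ∧
      ∀ g : BoundedContinuousFunction ((Fin k × Fin d) → ℝ) ℝ,
        Tendsto (fun ε : ℝ =>
            ∫ f : Traj d, g (fun p =>
              Real.sqrt ε * ((f (⌊(t p.1 : ℝ) / ε⌋₊) p.2 : ℝ) - (⌊(t p.1 : ℝ) / ε⌋₊ : ℝ) * v p.2))
              ∂P0)
          (𝓝[>] (0 : ℝ)) (𝓝 (∫ x, g x ∂γ))

/-- `μ` is the Dirichlet distribution with parameters `β` on the simplex, characterized by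
its (joint polynomial) moments. -/
def IsDirichlet (d : ℕ) (μ : Measure (Simplex d)) (β : Fin (2 * d) → ℝ) : Prop :=
  IsProbabilityMeasure μ ∧
  ∀ k : Fin (2 * d) → ℕ,
    ∫ p, ∏ i, (p.1 i) ^ (k i) ∂μ =
      (Real.Gamma (∑ i, β i) / Real.Gamma ((∑ i, β i) + (∑ i, (k i : ℝ)))) *
        ∏ i, (Real.Gamma (β i + k i) / Real.Gamma (β i))

/-! ### Directed graph structure on `ℤ^d` and flows -/

/-- Directed nearest-neighbour edges of `ℤ^d`: the pair `(z, i)` represents the edge from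
`z` to `z + dir d i`. -/
abbrev Edge (d : ℕ) := V d × Fin (2 * d)

def tail (d : ℕ) (e : Edge d) : V d := e.1

def head (d : ℕ) (e : Edge d) : V d := e.1 + dir d e.2

/-- Divergence of an edge function at a vertex. -/
noncomputable def divg (d : ℕ) (θ : Edge d → ℝ) (v : V d) : ℝ :=
  (∑ᶠ e ∈ {e : Edge d | tail d e = v}, θ e) - ∑ᶠ e ∈ {e : Edge d | head d e = v}, θ e

/-- `θ` is a flow from `A` to `Z` on the directed graph `(ℤ^d, E_{ℤ^d})`. -/
def IsFlow (d : ℕ) (θ : Edge d → ℝ) (A Z : Set (V d)) : Prop :=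
  (∀ e, 0 ≤ θ e) ∧ (∀ v, v ∉ A ∪ Z → divg d θ v = 0) ∧
    (∀ v ∈ A, 0 ≤ divg d θ v) ∧ (∀ v ∈ Z, divg d θ v ≤ 0)

/-- `θ` is a unit flow from `A` to `Z`. -/
def IsUnitFlow (d : ℕ) (θ : Edge d → ℝ) (A Z : Set (V d)) : Prop :=
  IsFlow d θ A Z ∧ ∑ᶠ v ∈ A, divg d θ v = 1



/-! ## Part 1: moments of the environment -/

/-- transition weight -/
abbrev w {d : ℕ} (ω : Env d) (y : V d) (f : Fin (2 * d)) : ℝ := (ω y).1 f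

/-- monomial in the environment -/
noncomputable def mon {d : ℕ} (M : Multiset (Edge d)) (ω : Env d) : ℝ :=
  (M.map (fun e => w ω e.1 e.2)).prod

/-- number of edges of `M` at `y` -/
noncomputable def cntAt {d : ℕ} (y : V d) (M : Multiset (Edge d)) : ℕ :=
  M.countP (fun e => e.1 = y)

lemma w_nonneg {d : ℕ} (ω : Env d) (y : V d) (f : Fin (2 * d)) : 0 ≤ w ω y f := (ω y).2.1 f

lemma w_sum {d : ℕ} (ω : Env d) (y : V d) : ∑ f, w ω y f = 1 := (ω y).2.2

lemma w_le_one {d : ℕ} (ω : Env d) (y : V d) (f : Fin (2 * d)) : w ω y f ≤ 1 := by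
  rw [← w_sum ω y]
  exact Finset.single_le_sum (fun i _ => w_nonneg ω y i) (Finset.mem_univ f)

lemma measurable_w {d : ℕ} (y : V d) (f : Fin (2 * d)) : Measurable (fun ω : Env d => w ω y f) := by
  have h1 : Measurable (fun ω : Env d => ω y) := measurable_pi_apply y
  have h2 : Measurable (fun ω : Env d => (ω y).1) := measurable_subtype_coe.comp h1
  exact (measurable_pi_apply f).comp h2

@[simp] lemma mon_zero {d : ℕ} (ω : Env d) : mon (0 : Multiset (Edge d)) ω = 1 := by simp [mon]
lemma mon_cons {d : ℕ} (e : Edge d) (M : Multiset (Edge d)) (ω : Env d) :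
    mon (e ::ₘ M) ω = w ω e.1 e.2 * mon M ω := by simp [mon]
lemma mon_add {d : ℕ} (M N : Multiset (Edge d)) (ω : Env d) :
    mon (M + N) ω = mon M ω * mon N ω := by simp [mon]

lemma mon_nonneg {d : ℕ} (M : Multiset (Edge d)) (ω : Env d) : 0 ≤ mon M ω := by
  induction M using Multiset.induction with
  | empty => simp
  | cons e M ih => rw [mon_cons]; exact mul_nonneg (w_nonneg _ _ _) ih

lemma mon_le_one {d : ℕ} (M : Multiset (Edge d)) (ω : Env d) : mon M ω ≤ 1 := by
  induction M using Multiset.induction with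
  | empty => simp
  | cons e M ih => rw [mon_cons]; exact mul_le_one₀ (w_le_one _ _ _) (mon_nonneg _ _) ih

lemma measurable_mon {d : ℕ} (M : Multiset (Edge d)) : Measurable (fun ω : Env d => mon M ω) := by
  induction M using Multiset.induction with
  | empty => simp
  | cons e M ih => simp only [mon_cons]; exact (measurable_w _ _).mul ih

lemma mon_eq_prod {d : ℕ} (M : Multiset (Edge d)) (S : Finset (V d)) (hS : ∀ e ∈ M, e.1 ∈ S)
    (ω : Env d) : mon M ω = ∏ y ∈ S, ∏ f, (w ω y f) ^ (M.count (y, f)) := by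
  induction M using Multiset.induction with
  | empty => simp
  | cons e M ih =>
    rw [mon_cons, ih (fun e' he' => hS e' (Multiset.mem_cons_of_mem he'))]
    have he := hS e (Multiset.mem_cons_self _ _)
    have key : ∀ y f, (w ω y f) ^ ((e ::ₘ M).count (y, f)) =
        (if y = e.1 then (if f = e.2 then w ω y f else 1) else 1) * (w ω y f) ^ (M.count (y, f)) := by
      intro y f
      rw [Multiset.count_cons]
      by_cases h1 : y = e.1
      · by_cases h2 : f = e.2
        · have : (y, f) = e := by ext <;> simp [h1, h2]
          simp [h1, h2, pow_succ, mul_comm]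
        · have : ¬ (y, f) = e := by rintro rfl; exact h2 rfl
          simp [h1, h2, show ¬ (e.1, f) = e by rwa [h1] at this]
      · have : ¬ (y, f) = e := by rintro rfl; exact h1 rfl
        simp [h1, this]
    simp only [key, Finset.prod_mul_distrib]
    congr 1
    rw [Finset.prod_eq_single e.1]
    · simp
    · intro b _ hb; simp [hb]
    · intro h; exact absurd he h

/-- site moment -/
noncomputable def mm {d : ℕ} (μ : Measure (Simplex d)) (k : Fin (2 * d) → ℕ) : ℝ :=
  ∫ p, ∏ i, (p.1 i) ^ (k i) ∂μ

lemma iid_integral {d : ℕ} {ℙ : Measure (Env d)} {μ : Measure (Simplex d)} (h : IsIIDWith d ℙ μ)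
    (S : Finset (V d)) (g : V d → Simplex d → ℝ) (hg : ∀ y, Measurable (g y)) :
    ∫ ω, ∏ y ∈ S, g y (ω y) ∂ℙ = ∏ y ∈ S, ∫ p, g y p ∂μ := by
  obtain ⟨h1, h2, h3⟩ := h
  have hmeas : Measurable (fun (ω : Env d) (y : S) => ω y.1) :=
    measurable_pi_lambda _ (fun y => measurable_pi_apply _)
  have hmap : ℙ.map (fun (ω : Env d) (y : S) => ω y.1) = Measure.pi (fun _ : S => μ) := by
    symm
    apply Measure.pi_eq
    intro s hs
    rw [Measure.map_apply hmeas (MeasurableSet.univ_pi hs)]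
    have := h3 S (fun x => if hx : x ∈ S then s ⟨x, hx⟩ else Set.univ) (by
      intro x; by_cases hx : x ∈ S
      · simp only [hx, dite_true]; exact hs _
      · simp only [hx, dite_false]; exact MeasurableSet.univ)
    rw [← Finset.prod_attach] at this
    convert this using 1
    · congr 1
      ext ω
      simp only [Set.mem_preimage, Set.mem_univ_pi, Set.mem_setOf_eq]
      constructor
      · intro h x hx; simp only [hx, dite_true]; exact h ⟨x, hx⟩
      · intro h x; have := h x.1 x.2; simpa using this
    · simp
  have e1 : ∀ ω : Env d, ∏ y ∈ S, g y (ω y) = ∏ y : S, g y.1 ((fun (ω : Env d) (y : S) => ω y.1) ω y) := by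
    intro ω
    rw [← Finset.prod_attach]; rfl
  simp_rw [e1]
  have hm : AEStronglyMeasurable (fun η : S → Simplex d => ∏ y : S, g y.1 (η y))
      (ℙ.map (fun (ω : Env d) (y : S) => ω y.1)) := by
    apply Measurable.aestronglyMeasurable
    exact Finset.measurable_prod _ (fun y _ => (hg y.1).comp (measurable_pi_apply y))
  rw [← integral_map hmeas.aemeasurable hm, hmap,
    MeasureTheory.integral_fintype_prod_eq_prod (fun (y : S) p => g y.1 p)]
  rw [← Finset.prod_attach S]; rfl

lemma E_mon {d : ℕ} {ℙ : Measure (Env d)} {μ : Measure (Simplex d)} (h : IsIIDWith d ℙ μ)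
    (M : Multiset (Edge d)) (S : Finset (V d)) (hS : ∀ e ∈ M, e.1 ∈ S) :
    ∫ ω, mon M ω ∂ℙ = ∏ y ∈ S, mm μ (fun f => M.count (y, f)) := by
  simp_rw [mon_eq_prod M S hS]
  have := iid_integral h S (fun y p => ∏ f, (p.1 f) ^ (M.count (y, f))) (by
    intro y
    apply Finset.measurable_prod
    intro f _
    exact (((measurable_pi_apply f).comp measurable_subtype_coe)).pow_const _)
  exact this

lemma cntAt_eq {d : ℕ} (M : Multiset (Edge d)) (y : V d) :
    cntAt y M = ∑ f, M.count (y, f) := by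
  induction M using Multiset.induction with
  | empty => simp [cntAt]
  | cons e M ih =>
    simp only [cntAt] at ih ⊢
    rw [Multiset.countP_cons, ih]
    simp only [Multiset.count_cons, Finset.sum_add_distrib]
    congr 1
    by_cases h : e.1 = y
    · subst h
      simp only [if_true]
      rw [Finset.sum_eq_single e.2]
      · simp
      · intro b _ hb; rw [if_neg]; intro hh; apply hb; rw [← hh]
      · simp
    · rw [if_neg h]; symm
      apply Finset.sum_eq_zero
      intro f _; rw [if_neg]; rintro rfl; exact h rfl

lemma mm_zero {d : ℕ} {μ : Measure (Simplex d)} [IsProbabilityMeasure μ] :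
    mm μ (fun _ => 0) = 1 := by simp [mm]

lemma mm_succ {d : ℕ} {μ : Measure (Simplex d)} {β : Fin (2 * d) → ℝ} (h : IsDirichlet d μ β)
    (hβ : ∀ i, 0 < β i) (k : Fin (2 * d) → ℕ) (f : Fin (2 * d)) :
    (∑ i, β i + ∑ i, (k i : ℝ)) * mm μ (fun i => k i + if i = f then 1 else 0) =
      (β f + k f) * mm μ k := by
  obtain ⟨_, h⟩ := h
  unfold mm
  rw [h, h]
  have hpos : 0 < ∑ i, β i := Finset.sum_pos (fun i _ => hβ i) ⟨f, Finset.mem_univ f⟩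
  have hk : 0 ≤ ∑ i, (k i : ℝ) := Finset.sum_nonneg (fun i _ => Nat.cast_nonneg _)
  have hs : ∑ i, ((k i + if i = f then 1 else 0 : ℕ) : ℝ) = ∑ i, (k i : ℝ) + 1 := by
    push_cast
    rw [Finset.sum_add_distrib]; simp
  rw [hs, ← add_assoc, Real.Gamma_add_one (by positivity)]
  have hp : ∏ i, (Real.Gamma (β i + ((k i + if i = f then 1 else 0 : ℕ) : ℝ)) / Real.Gamma (β i)) =
      (β f + k f) * ∏ i, (Real.Gamma (β i + k i) / Real.Gamma (β i)) := by
    have : ∀ i, (Real.Gamma (β i + ((k i + if i = f then 1 else 0 : ℕ) : ℝ)) / Real.Gamma (β i)) =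
      (if i = f then (β i + k i) else 1) * (Real.Gamma (β i + k i) / Real.Gamma (β i)) := by
      intro i
      by_cases hi : i = f
      · simp only [hi, if_true]; push_cast
        rw [← add_assoc, Real.Gamma_add_one (by have := hβ f; positivity)]; ring
      · simp [hi]
    simp_rw [this, Finset.prod_mul_distrib]
    simp
  rw [hp]
  have g1 : Real.Gamma (∑ i, β i + ∑ i, (k i : ℝ)) ≠ 0 := (Real.Gamma_pos_of_pos (by positivity)).ne'
  have g2 : (∑ i, β i + ∑ i, (k i : ℝ)) ≠ 0 := by positivity
  field_simp

/-- Summary of everything we use about the environment measure. -/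
structure Mom (d : ℕ) (β : Fin (2 * d) → ℝ) (ℙ : Measure (Env d)) : Prop where
  prob : IsProbabilityMeasure ℙ
  ibp : ∀ (M : Multiset (Edge d)) (y : V d) (f : Fin (2 * d)),
    (∑ i, β i + cntAt y M) * ∫ ω, w ω y f * mon M ω ∂ℙ =
      (β f + M.count (y, f)) * ∫ ω, mon M ω ∂ℙ
  mul : ∀ (M N : Multiset (Edge d)), (∀ e ∈ M, ∀ e' ∈ N, e.1 ≠ e'.1) →
    ∫ ω, mon M ω * mon N ω ∂ℙ = (∫ ω, mon M ω ∂ℙ) * ∫ ω, mon N ω ∂ℙ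
  shift : ∀ (M : Multiset (Edge d)) (v : V d),
    ∫ ω, mon (M.map (fun e => (e.1 + v, e.2))) ω ∂ℙ = ∫ ω, mon M ω ∂ℙ

lemma mom_of {d : ℕ} {ℙ : Measure (Env d)} {μ : Measure (Simplex d)} {β : Fin (2 * d) → ℝ}
    (h : IsIIDWith d ℙ μ) (hD : IsDirichlet d μ β) (hβ : ∀ i, 0 < β i) : Mom d β ℙ where
  prob := h.1
  ibp := by
    intro M y f
    have hS : ∀ e ∈ ((y, f) ::ₘ M), e.1 ∈ insert y (M.map Prod.fst).toFinset := by
      intro e he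
      rcases Multiset.mem_cons.1 he with rfl | he
      · simp
      · refine Finset.mem_insert_of_mem ?_
        simp only [Multiset.mem_toFinset, Multiset.mem_map]; exact ⟨e, he, rfl⟩
    have e1 : ∀ ω, w ω y f * mon M ω = mon ((y, f) ::ₘ M) ω := fun ω => by rw [mon_cons]
    simp_rw [e1]
    rw [E_mon h _ _ hS, E_mon h M _ (fun e he => hS e (Multiset.mem_cons_of_mem he))]
    set S := insert y (M.map Prod.fst).toFinset
    have hy : y ∈ S := Finset.mem_insert_self _ _
    rw [← Finset.mul_prod_erase S _ hy, ← Finset.mul_prod_erase S _ hy]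
    have e2 : ∏ x ∈ S.erase y, mm μ (fun f' => ((y, f) ::ₘ M).count (x, f')) =
        ∏ x ∈ S.erase y, mm μ (fun f' => M.count (x, f')) := by
      apply Finset.prod_congr rfl
      intro x hx
      congr 1; ext f'
      rw [Multiset.count_cons_of_ne]
      intro hh; exact (Finset.ne_of_mem_erase hx) (Prod.mk.inj hh).1
    rw [e2]
    have e3 : (fun f' => ((y, f) ::ₘ M).count (y, f')) =
        fun f' => M.count (y, f') + if f' = f then 1 else 0 := by
      ext f'; rw [Multiset.count_cons]; simp
    rw [e3, cntAt_eq]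
    have := mm_succ hD hβ (fun f' => M.count (y, f')) f
    push_cast at this ⊢
    rw [← mul_assoc, this, mul_assoc]
  mul := by
    intro M N hMN
    have hM : ∀ e ∈ M, e.1 ∈ (M.map Prod.fst).toFinset ∪ (N.map Prod.fst).toFinset := by
      intro e he; refine Finset.mem_union_left _ ?_
      simp only [Multiset.mem_toFinset, Multiset.mem_map]; exact ⟨e, he, rfl⟩
    have hN : ∀ e ∈ N, e.1 ∈ (M.map Prod.fst).toFinset ∪ (N.map Prod.fst).toFinset := by
      intro e he; refine Finset.mem_union_right _ ?_
      simp only [Multiset.mem_toFinset, Multiset.mem_map]; exact ⟨e, he, rfl⟩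
    simp_rw [← mon_add]
    rw [E_mon h _ _ hM, E_mon h _ _ hN, E_mon h (M + N) ((M.map Prod.fst).toFinset ∪ (N.map Prod.fst).toFinset) (by
      intro e he; rcases Multiset.mem_add.1 he with he | he
      · exact hM e he
      · exact hN e he), ← Finset.prod_mul_distrib]
    haveI := hD.1
    apply Finset.prod_congr rfl
    intro y _
    simp only [Multiset.count_add]
    by_cases hy : ∃ f, (y, f) ∈ M
    · obtain ⟨f, hf⟩ := hy
      have : ∀ f', N.count (y, f') = 0 := by
        intro f'; rw [Multiset.count_eq_zero]; intro hf'; exact hMN _ hf _ hf' rfl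
      simp only [this, add_zero, mm_zero, mul_one]
    · push Not at hy
      have : ∀ f', M.count (y, f') = 0 := fun f' => Multiset.count_eq_zero.2 (hy f')
      simp only [this, zero_add, mm_zero, one_mul]
  shift := by
    intro M v
    have hM : ∀ e ∈ M, e.1 ∈ (M.map Prod.fst).toFinset := by
      intro e he
      simp only [Multiset.mem_toFinset, Multiset.mem_map]; exact ⟨e, he, rfl⟩
    rw [E_mon h _ _ hM, E_mon h (M.map (fun e => (e.1 + v, e.2)))
      ((M.map Prod.fst).toFinset.image (· + v)) (by
        intro e he
        obtain ⟨e', he', rfl⟩ := Multiset.mem_map.1 he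
        exact Finset.mem_image_of_mem _ (hM e' he'))]
    rw [Finset.prod_image (by intro a _ b _ hab; simpa using hab)]
    apply Finset.prod_congr rfl
    intro y _
    congr 1; ext f
    have hinj : Function.Injective (fun e : Edge d => ((e.1 + v, e.2) : Edge d)) := by
      intro a b hab
      simp only [Prod.mk.injEq, add_left_inj] at hab
      exact Prod.ext hab.1 hab.2
    exact Multiset.count_map_eq_count' (fun e : Edge d => ((e.1 + v, e.2) : Edge d)) M hinj (y, f)



/-! ## Part 2: bounded measurable functions, Green functions, the integration by parts identity -/

/-- bounded measurable function of the environment -/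
def Bd {d : ℕ} (F : Env d → ℝ) : Prop := Measurable F ∧ ∃ C : ℝ, ∀ ω, |F ω| ≤ C

namespace Bd
variable {d : ℕ} {F G : Env d → ℝ}

lemma const (c : ℝ) : Bd (fun _ : Env d => c) := ⟨measurable_const, |c|, fun _ => le_rfl⟩

lemma add (hF : Bd F) (hG : Bd G) : Bd (fun ω => F ω + G ω) := by
  obtain ⟨m, C, h⟩ := hF; obtain ⟨m', C', h'⟩ := hG
  exact ⟨m.add m', C + C', fun ω => (abs_add_le _ _).trans (add_le_add (h ω) (h' ω))⟩

lemma sub (hF : Bd F) (hG : Bd G) : Bd (fun ω => F ω - G ω) := by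
  obtain ⟨m, C, h⟩ := hF; obtain ⟨m', C', h'⟩ := hG
  exact ⟨m.sub m', C + C', fun ω => (abs_sub _ _).trans (add_le_add (h ω) (h' ω))⟩

lemma mul (hF : Bd F) (hG : Bd G) : Bd (fun ω => F ω * G ω) := by
  obtain ⟨m, C, h⟩ := hF; obtain ⟨m', C', h'⟩ := hG
  refine ⟨m.mul m', C * C', fun ω => ?_⟩
  rw [abs_mul]
  exact mul_le_mul (h ω) (h' ω) (abs_nonneg _) ((abs_nonneg _).trans (h ω))

lemma cmul (c : ℝ) (hF : Bd F) : Bd (fun ω => c * F ω) := (const c).mul hF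

lemma sum {ι : Type*} (s : Finset ι) {F : ι → Env d → ℝ} (h : ∀ i ∈ s, Bd (F i)) :
    Bd (fun ω => ∑ i ∈ s, F i ω) := by
  induction s using Finset.induction with
  | empty => simpa using const 0
  | insert a s ha ih =>
    simp only [Finset.sum_insert ha]
    exact (h a (Finset.mem_insert_self _ _)).add (ih fun i hi => h i (Finset.mem_insert_of_mem hi))

lemma pow (hF : Bd F) (n : ℕ) : Bd (fun ω => F ω ^ n) := by
  induction n with
  | zero => simpa using const 1
  | succ n ih => simp only [pow_succ]; exact ih.mul hF

lemma of01 (hm : Measurable F) (h0 : ∀ ω, 0 ≤ F ω) (h1 : ∀ ω, F ω ≤ 1) : Bd F :=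
  ⟨hm, 1, fun ω => by rw [abs_of_nonneg (h0 ω)]; exact h1 ω⟩

lemma int (hF : Bd F) (ℙ : Measure (Env d)) [IsProbabilityMeasure ℙ] : Integrable F ℙ := by
  obtain ⟨m, C, h⟩ := hF
  exact Integrable.of_bound m.aestronglyMeasurable C (Filter.Eventually.of_forall h)

end Bd

lemma bd_w {d : ℕ} (y : V d) (f : Fin (2 * d)) : Bd (fun ω : Env d => w ω y f) :=
  Bd.of01 (measurable_w y f) (fun ω => w_nonneg ω y f) (fun ω => w_le_one ω y f)

lemma bd_mon {d : ℕ} (M : Multiset (Edge d)) : Bd (fun ω : Env d => mon M ω) :=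
  Bd.of01 (measurable_mon M) (fun ω => mon_nonneg M ω) (fun ω => mon_le_one M ω)

/-- `n`-step transition probabilities -/
noncomputable def p {d : ℕ} (ω : Env d) : ℕ → V d → V d → ℝ
  | 0, a, x => if a = x then 1 else 0
  | (n + 1), a, x => ∑ g, w ω a g * p ω n (a + dir d g) x

section pbasic
variable {d : ℕ} (ω : Env d)

lemma p_zero (a x : V d) : p ω 0 a x = if a = x then 1 else 0 := rfl
lemma p_succ (n : ℕ) (a x : V d) :
    p ω (n + 1) a x = ∑ g, w ω a g * p ω n (a + dir d g) x := rfl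

lemma p_nonneg (n : ℕ) (a x : V d) : 0 ≤ p ω n a x := by
  induction n generalizing a with
  | zero => rw [p_zero]; split <;> norm_num
  | succ n ih => exact Finset.sum_nonneg fun g _ => mul_nonneg (w_nonneg _ _ _) (ih _)

lemma p_le_one (n : ℕ) (a x : V d) : p ω n a x ≤ 1 := by
  induction n generalizing a with
  | zero => rw [p_zero]; split <;> norm_num
  | succ n ih =>
    rw [p_succ, ← w_sum ω a]
    exact Finset.sum_le_sum fun g _ => mul_le_of_le_one_right (w_nonneg _ _ _) (ih _)

lemma p_hasSum (n : ℕ) (a : V d) : HasSum (fun x => p ω n a x) 1 := by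
  induction n generalizing a with
  | zero =>
    simp only [p_zero]
    have := hasSum_ite_eq a (1 : ℝ)
    convert this using 3
    exact eq_comm
  | succ n ih =>
    simp only [p_succ]
    have := hasSum_sum (f := fun g x => w ω a g * p ω n (a + dir d g) x) (s := Finset.univ)
      (fun g _ => (ih (a + dir d g)).mul_left (w ω a g))
    simpa [w_sum] using this

lemma p_succ' (n : ℕ) (a x : V d) :
    p ω (n + 1) a x = ∑ f, p ω n a (x - dir d f) * w ω (x - dir d f) f := by
  induction n generalizing a with
  | zero =>
    rw [p_succ]
    apply Finset.sum_congr rfl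
    intro g _
    simp only [p_zero]
    by_cases h : a = x - dir d g
    · subst h; simp
    · have : ¬ a + dir d g = x := fun h' => h (by rw [← h']; simp)
      simp [h, this]
  | succ n ih =>
    rw [p_succ]
    simp_rw [ih, Finset.mul_sum]
    rw [Finset.sum_comm]
    apply Finset.sum_congr rfl
    intro f _
    rw [p_succ, Finset.sum_mul]
    apply Finset.sum_congr rfl
    intro g _
    ring
end pbasic

lemma measurable_p {d : ℕ} (n : ℕ) (a x : V d) : Measurable (fun ω : Env d => p ω n a x) := by
  induction n generalizing a with
  | zero => simp only [p_zero]; exact measurable_const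
  | succ n ih =>
    simp only [p_succ]
    exact Finset.measurable_sum _ (fun g _ => (measurable_w _ _).mul (ih _))

lemma bd_p {d : ℕ} (n : ℕ) (a x : V d) : Bd (fun ω : Env d => p ω n a x) :=
  Bd.of01 (measurable_p n a x) (fun ω => p_nonneg ω n a x) (fun ω => p_le_one ω n a x)

/-- convolution with source `u` at `y` -/
noncomputable def cv {d : ℕ} (ω : Env d) (y : V d) (u : ℕ → ℝ) : ℕ → V d → ℝ
  | 0, _ => 0
  | (n + 1), a => (if a = y then u n else 0) + ∑ g, w ω a g * cv ω y u n (a + dir d g)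

lemma cv_succ {d : ℕ} (ω : Env d) (y : V d) (u : ℕ → ℝ) (n : ℕ) (a : V d) :
    cv ω y u (n + 1) a = (if a = y then u n else 0) + ∑ g, w ω a g * cv ω y u n (a + dir d g) := rfl

lemma cv_eq {d : ℕ} (ω : Env d) (y : V d) (u : ℕ → ℝ) (n : ℕ) (a : V d) :
    cv ω y u (n + 1) a = ∑ ij ∈ Finset.HasAntidiagonal.antidiagonal n, p ω ij.1 a y * u ij.2 := by
  induction n generalizing a with
  | zero => simp [cv_succ, cv, p_zero]
  | succ n ih =>
    rw [cv_succ, Finset.Nat.sum_antidiagonal_succ]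
    congr 1
    · simp [p_zero]
    · simp_rw [ih, p_succ, Finset.mul_sum, Finset.sum_mul]
      rw [Finset.sum_comm]
      simp_rw [mul_assoc]

lemma bd_cv {d : ℕ} (y : V d) (u : Env d → ℕ → ℝ) (hu : ∀ n, Bd (fun ω => u ω n)) (n : ℕ) (a : V d) :
    Bd (fun ω : Env d => cv ω y (u ω) n a) := by
  induction n generalizing a with
  | zero => exact Bd.const 0
  | succ n ih =>
    simp only [cv_succ]
    refine Bd.add ?_ (Bd.sum _ fun g _ => (bd_w _ _).mul (ih _))
    by_cases h : a = y
    · simpa [h] using hu n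
    · simpa [h] using Bd.const 0

section ibp
variable {d : ℕ} {β : Fin (2 * d) → ℝ} {ℙ : Measure (Env d)}

lemma E_sum {ℙ : Measure (Env d)} [IsProbabilityMeasure ℙ] {ι : Type*} (s : Finset ι) {F : ι → Env d → ℝ}
    (h : ∀ i ∈ s, Bd (F i)) : ∫ ω, ∑ i ∈ s, F i ω ∂ℙ = ∑ i ∈ s, ∫ ω, F i ω ∂ℙ :=
  integral_finsetSum s fun i hi => (h i hi).int ℙ

lemma E_add {ℙ : Measure (Env d)} [IsProbabilityMeasure ℙ] {F G : Env d → ℝ} (hF : Bd F) (hG : Bd G) :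
    ∫ ω, F ω + G ω ∂ℙ = ∫ ω, F ω ∂ℙ + ∫ ω, G ω ∂ℙ := integral_add (hF.int ℙ) (hG.int ℙ)

lemma E_sub {ℙ : Measure (Env d)} [IsProbabilityMeasure ℙ] {F G : Env d → ℝ} (hF : Bd F) (hG : Bd G) :
    ∫ ω, F ω - G ω ∂ℙ = ∫ ω, F ω ∂ℙ - ∫ ω, G ω ∂ℙ := integral_sub (hF.int ℙ) (hG.int ℙ)

lemma E_cmul {ℙ : Measure (Env d)} (c : ℝ) (F : Env d → ℝ) :
    ∫ ω, c * F ω ∂ℙ = c * ∫ ω, F ω ∂ℙ := integral_const_mul c F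

lemma E_mono {ℙ : Measure (Env d)} [IsProbabilityMeasure ℙ] {F G : Env d → ℝ} (hF : Bd F) (hG : Bd G)
    (h : ∀ ω, F ω ≤ G ω) : ∫ ω, F ω ∂ℙ ≤ ∫ ω, G ω ∂ℙ := integral_mono (hF.int ℙ) (hG.int ℙ) h

lemma ibp_n (hM : Mom d β ℙ) (y x : V d) (f : Fin (2 * d)) (n : ℕ) (a : V d) (M : Multiset (Edge d)) :
    (∑ i, β i + cntAt y M) * ∫ ω, mon M ω * w ω y f * p ω n a x ∂ℙ +
      ∫ ω, mon M ω * w ω y f * cv ω y (fun m => p ω (m + 1) y x) n a ∂ℙ =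
    (β f + M.count (y, f)) * ∫ ω, mon M ω * p ω n a x ∂ℙ +
      ∫ ω, mon M ω * w ω y f * cv ω y (fun m => p ω m (y + dir d f) x) n a ∂ℙ := by
  have := hM.prob
  induction n generalizing a M with
  | zero =>
    simp only [p_zero, cv, mul_zero, integral_zero, add_zero]
    have h := hM.ibp M y f
    simp_rw [mul_comm (w _ y f)] at h
    rw [integral_mul_const, integral_mul_const, ← mul_assoc, h, mul_assoc]
  | succ n ih =>
    have bD : ∀ n a, Bd (fun ω : Env d => cv ω y (fun m => p ω (m + 1) y x) n a) :=
      fun n a => bd_cv y (fun ω m => p ω (m + 1) y x) (fun m => bd_p _ _ _) n a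
    have bR : ∀ n a, Bd (fun ω : Env d => cv ω y (fun m => p ω m (y + dir d f) x) n a) :=
      fun n a => bd_cv y (fun ω m => p ω m (y + dir d f) x) (fun m => bd_p _ _ _) n a
    have bF : Bd (fun ω : Env d => mon M ω * w ω y f) := (bd_mon M).mul (bd_w y f)
    -- expansions
    have x1 : ∫ ω, mon M ω * w ω y f * p ω (n+1) a x ∂ℙ =
        ∑ g, ∫ ω, mon ((a, g) ::ₘ M) ω * w ω y f * p ω n (a + dir d g) x ∂ℙ := by
      rw [← E_sum _ (fun g _ => ((bd_mon _).mul (bd_w y f)).mul (bd_p _ _ _))]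
      congr 1; ext ω
      rw [p_succ, Finset.mul_sum]
      refine Finset.sum_congr rfl fun g _ => ?_
      rw [mon_cons]; ring
    have x2 : ∫ ω, mon M ω * p ω (n+1) a x ∂ℙ =
        ∑ g, ∫ ω, mon ((a, g) ::ₘ M) ω * p ω n (a + dir d g) x ∂ℙ := by
      rw [← E_sum _ (fun g _ => (bd_mon _).mul (bd_p _ _ _))]
      congr 1; ext ω
      rw [p_succ, Finset.mul_sum]
      refine Finset.sum_congr rfl fun g _ => ?_
      rw [mon_cons]; ring
    have x3 : ∀ (u : Env d → ℕ → ℝ) (hu : ∀ n, Bd (fun ω => u ω n)),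
        ∫ ω, mon M ω * w ω y f * cv ω y (u ω) (n+1) a ∂ℙ =
        (if a = y then ∫ ω, mon M ω * w ω y f * u ω n ∂ℙ else 0) +
        ∑ g, ∫ ω, mon ((a, g) ::ₘ M) ω * w ω y f * cv ω y (u ω) n (a + dir d g) ∂ℙ := by
      intro u hu
      rw [← E_sum _ (fun g _ => ((bd_mon _).mul (bd_w y f)).mul (bd_cv y u hu _ _))]
      have : (if a = y then ∫ ω, mon M ω * w ω y f * u ω n ∂ℙ else 0) =
          ∫ ω, (if a = y then mon M ω * w ω y f * u ω n else 0) ∂ℙ := by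
        split <;> simp
      rw [this, ← E_add]
      · congr 1; ext ω
        rw [cv_succ, mul_add, Finset.mul_sum]
        congr 1
        · split <;> simp
        · refine Finset.sum_congr rfl fun g _ => ?_
          rw [mon_cons]; ring
      · by_cases h : a = y
        · simpa [h] using bF.mul (hu n)
        · simpa [h] using Bd.const 0
      · exact Bd.sum _ (fun g _ => ((bd_mon _).mul (bd_w y f)).mul (bd_cv y u hu _ _))
    rw [x1, x2, x3 (fun ω m => p ω (m + 1) y x) (fun m => bd_p _ _ _),
      x3 (fun ω m => p ω m (y + dir d f) x) (fun m => bd_p _ _ _)]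
    have IH := fun g => ih (a + dir d g) ((a, g) ::ₘ M)
    by_cases h : a = y
    · subst h
      simp only [if_true]
      have hs := Finset.sum_congr (s₁ := Finset.univ) rfl (fun g _ => IH g)
      simp only [Finset.sum_add_distrib] at hs
      have hc : ∀ g, cntAt a ((a, g) ::ₘ M) = cntAt a M + 1 := by
        intro g; simp [cntAt]
      have hn : ∀ g, ((a, g) ::ₘ M).count (a, f) = M.count (a, f) + if g = f then 1 else 0 := by
        intro g; rw [Multiset.count_cons]; simp [eq_comm]
      simp only [hc, hn] at hs
      push_cast at hs
      simp only [← add_assoc, add_mul, Finset.sum_add_distrib, one_mul, ite_mul, zero_mul,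
        Finset.sum_ite_eq', Finset.mem_univ, if_true] at hs
      rw [← x1] at hs
      have e1 : ∫ ω, mon ((a, f) ::ₘ M) ω * p ω n (a + dir d f) x ∂ℙ =
          ∫ ω, mon M ω * w ω a f * p ω n (a + dir d f) x ∂ℙ := by
        congr 1; ext ω; rw [mon_cons]; ring
      rw [e1] at hs
      rw [← x1]
      simp only [add_mul, Finset.mul_sum] at hs ⊢
      have e2 : ∀ c : ℝ, ∑ g, c * ∫ ω, mon ((a, g) ::ₘ M) ω * w ω a f * p ω n (a + dir d g) x ∂ℙ =
          c * ∫ ω, mon M ω * w ω a f * p ω (n+1) a x ∂ℙ := by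
        intro c; rw [← Finset.mul_sum, ← x1]
      rw [e2, e2] at hs
      simp only [Finset.sum_add_distrib]
      linarith
    · simp only [h, if_false, zero_add]
      have hc : ∀ g, cntAt y ((a, g) ::ₘ M) = cntAt y M := by
        intro g; simp [cntAt, h]
      have hn : ∀ g, ((a, g) ::ₘ M).count (y, f) = M.count (y, f) := by
        intro g; rw [Multiset.count_cons_of_ne]; intro hh; exact h (Prod.mk.inj hh).1.symm
      simp only [hc, hn] at IH
      rw [Finset.mul_sum, Finset.mul_sum, ← Finset.sum_add_distrib, ← Finset.sum_add_distrib]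
      exact Finset.sum_congr rfl fun g _ => IH g

end ibp



/-- discounted Green function -/
noncomputable def G {d : ℕ} (s : ℝ) (ω : Env d) (a x : V d) : ℝ := ∑' n, s ^ n * p ω n a x

section Gbasic
variable {d : ℕ} {s : ℝ} (h0 : 0 ≤ s) (h1 : s < 1) (ω : Env d)
include h0 h1

lemma summable_mul_pow {u : ℕ → ℝ} (hu0 : ∀ n, 0 ≤ u n) (hu1 : ∀ n, u n ≤ 1) :
    Summable (fun n => s ^ n * u n) :=
  Summable.of_nonneg_of_le (fun n => mul_nonneg (pow_nonneg h0 n) (hu0 n))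
    (fun n => mul_le_of_le_one_right (pow_nonneg h0 n) (hu1 n)) (summable_geometric_of_lt_one h0 h1)

lemma G_summable (a x : V d) : Summable (fun n => s ^ n * p ω n a x) :=
  summable_mul_pow h0 h1 (fun n => p_nonneg ω n a x) (fun n => p_le_one ω n a x)

lemma G_nonneg (a x : V d) : 0 ≤ G s ω a x :=
  tsum_nonneg fun n => mul_nonneg (pow_nonneg h0 n) (p_nonneg ω n a x)

lemma G_le (a x : V d) : G s ω a x ≤ 1 / (1 - s) := by
  rw [one_div, ← tsum_geometric_of_lt_one h0 h1]
  exact (G_summable h0 h1 ω a x).tsum_le_tsum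
    (fun n => mul_le_of_le_one_right (pow_nonneg h0 n) (p_le_one ω n a x))
    (summable_geometric_of_lt_one h0 h1)

lemma G_split (a x : V d) :
    G s ω a x = (if a = x then 1 else 0) + s * ∑' n, s ^ n * p ω (n + 1) a x := by
  unfold G
  rw [(G_summable h0 h1 ω a x).tsum_eq_zero_add, ← tsum_mul_left]
  simp only [pow_zero, one_mul, p_zero]
  congr 1
  apply tsum_congr; intro n; ring

lemma G_back (a x : V d) :
    G s ω a x = (if a = x then 1 else 0) + s * ∑ g, w ω a g * G s ω (a + dir d g) x := by
  rw [G_split h0 h1]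
  congr 2
  unfold G
  simp_rw [← tsum_mul_left]
  rw [← Summable.tsum_finsetSum (fun g _ => (G_summable h0 h1 ω _ x).mul_left _)]
  apply tsum_congr; intro n
  rw [p_succ, Finset.mul_sum]
  refine Finset.sum_congr rfl fun g _ => by ring

lemma G_fwd (a x : V d) :
    G s ω a x = (if a = x then 1 else 0) +
      s * ∑ f, G s ω a (x - dir d f) * w ω (x - dir d f) f := by
  rw [G_split h0 h1]
  congr 2
  unfold G
  simp_rw [← tsum_mul_right]
  rw [← Summable.tsum_finsetSum (fun g _ => (G_summable h0 h1 ω _ _).mul_right _)]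
  apply tsum_congr; intro n
  rw [p_succ', Finset.mul_sum]
  refine Finset.sum_congr rfl fun g _ => by ring

lemma G_cv (y : V d) (u : ℕ → ℝ) (hu0 : ∀ n, 0 ≤ u n) (hu1 : ∀ n, u n ≤ 1) (a : V d) :
    ∑' n, s ^ n * cv ω y u n a = G s ω a y * (s * ∑' n, s ^ n * u n) := by
  have hA := G_summable h0 h1 ω a y
  have hB := summable_mul_pow h0 h1 hu0 hu1
  have hA' : Summable (fun n => ‖s ^ n * p ω n a y‖) := hA.norm
  have hB' : Summable (fun n => ‖s ^ n * u n‖) := hB.norm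
  have e : ∀ n, s ^ (n + 1) * cv ω y u (n + 1) a =
      s * ∑ kl ∈ Finset.HasAntidiagonal.antidiagonal n, (s ^ kl.1 * p ω kl.1 a y) * (s ^ kl.2 * u kl.2) := by
    intro n
    rw [cv_eq, Finset.mul_sum, Finset.mul_sum]
    refine Finset.sum_congr rfl fun kl hkl => ?_
    rw [← Finset.HasAntidiagonal.mem_antidiagonal.1 hkl]; ring
  have hS : Summable (fun n => s ^ n * cv ω y u n a) := by
    rw [← summable_nat_add_iff 1]
    simp_rw [e]
    exact ((summable_norm_sum_mul_antidiagonal_of_summable_norm hA' hB').of_norm).mul_left s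
  rw [hS.tsum_eq_zero_add]
  simp_rw [e]
  rw [tsum_mul_left, ← tsum_mul_tsum_eq_tsum_sum_antidiagonal_of_summable_norm hA' hB']
  simp only [cv, G]; ring

omit h0 h1 in
lemma cv_nonneg (y : V d) (u : ℕ → ℝ) (hu0 : ∀ n, 0 ≤ u n) (n : ℕ) (a : V d) : 0 ≤ cv ω y u n a := by
  induction n generalizing a with
  | zero => simp [cv]
  | succ n ih =>
    rw [cv_succ]
    refine add_nonneg (by split <;> simp [hu0]) (Finset.sum_nonneg fun g _ => mul_nonneg (w_nonneg _ _ _) (ih _))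

omit h0 h1 in
lemma cv_le (y : V d) (u : ℕ → ℝ) (hu1 : ∀ n, u n ≤ 1) (n : ℕ) (a : V d) : cv ω y u n a ≤ n := by
  induction n generalizing a with
  | zero => simp [cv]
  | succ n ih =>
    rw [cv_succ]
    have h1 : (if a = y then u n else 0) ≤ 1 := by split <;> simp [hu1]
    have h2 : ∑ g, w ω a g * cv ω y u n (a + dir d g) ≤ n := by
      calc _ ≤ ∑ g, w ω a g * (n : ℝ) :=
            Finset.sum_le_sum fun g _ => mul_le_mul_of_nonneg_left (ih _) (w_nonneg _ _ _)
        _ = n := by rw [← Finset.sum_mul, w_sum, one_mul]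
    push_cast; linarith

end Gbasic

lemma bd_G {d : ℕ} {s : ℝ} (h0 : 0 ≤ s) (h1 : s < 1) (a x : V d) : Bd (fun ω : Env d => G s ω a x) := by
  refine ⟨?_, 1 / (1 - s), fun ω => ?_⟩
  · unfold G
    have : ∀ ω : Env d, ∑' n, s ^ n * p ω n a x = (∑' n, ENNReal.ofReal (s ^ n * p ω n a x)).toReal := by
      intro ω
      rw [ENNReal.tsum_toReal_eq (fun n => ENNReal.ofReal_ne_top)]
      apply tsum_congr; intro n
      rw [ENNReal.toReal_ofReal (mul_nonneg (pow_nonneg h0 n) (p_nonneg ω n a x))]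
    simp_rw [this]
    apply Measurable.ennreal_toReal
    apply Measurable.tsum
    intro n
    exact ((measurable_p n a x).const_mul _).ennreal_ofReal
  · rw [abs_of_nonneg (G_nonneg h0 h1 ω a x)]; exact G_le h0 h1 ω a x

lemma E_tsum {d : ℕ} {ℙ : Measure (Env d)} [IsProbabilityMeasure ℙ] {F : ℕ → Env d → ℝ} {c : ℕ → ℝ}
    (hF : ∀ n, Bd (F n)) (hc : ∀ n ω, |F n ω| ≤ c n) (hs : Summable c) :
    HasSum (fun n => ∫ ω, F n ω ∂ℙ) (∫ ω, ∑' n, F n ω ∂ℙ) := by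
  apply hasSum_integral_of_summable_integral_norm (fun n => (hF n).int ℙ)
  refine Summable.of_nonneg_of_le (fun n => integral_nonneg fun ω => norm_nonneg _) (fun n => ?_) hs
  calc ∫ ω, ‖F n ω‖ ∂ℙ ≤ ∫ ω, c n ∂ℙ :=
        integral_mono ((hF n).int ℙ).norm (integrable_const _) (fun ω => hc n ω)
    _ = c n := by simp

/-- The fundamental integration by parts identity (I). -/
lemma ibp_G {d : ℕ} {β : Fin (2 * d) → ℝ} {ℙ : Measure (Env d)} (hM : Mom d β ℙ)
    {s : ℝ} (h0 : 0 ≤ s) (h1 : s < 1) (a x y : V d) (f : Fin (2 * d)) (M : Multiset (Edge d)) :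
    (∑ i, β i + cntAt y M) * ∫ ω, mon M ω * w ω y f * G s ω a x ∂ℙ +
      ∫ ω, mon M ω * w ω y f * (G s ω a y * (G s ω y x - if y = x then 1 else 0)) ∂ℙ =
    (β f + M.count (y, f)) * ∫ ω, mon M ω * G s ω a x ∂ℙ +
      ∫ ω, mon M ω * w ω y f * (G s ω a y * (s * G s ω (y + dir d f) x)) ∂ℙ := by
  have := hM.prob
  have bF : Bd (fun ω : Env d => mon M ω * w ω y f) := (bd_mon M).mul (bd_w y f)
  have F01 : ∀ ω : Env d, 0 ≤ mon M ω * w ω y f := fun ω => mul_nonneg (mon_nonneg _ _) (w_nonneg _ _ _)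
  have F1 : ∀ ω : Env d, mon M ω * w ω y f ≤ 1 := fun ω =>
    mul_le_one₀ (mon_le_one _ _) (w_nonneg _ _ _) (w_le_one _ _ _)
  have key : ∀ (F : Env d → ℝ) (hF : Bd F) (hF0 : ∀ ω, 0 ≤ F ω) (hF1 : ∀ ω, F ω ≤ 1)
      (u : ℕ → Env d → ℝ) (hu : ∀ n, Bd (u n)) (hu0 : ∀ n ω, 0 ≤ u n ω) (hu1 : ∀ n ω, u n ω ≤ n + 1),
      HasSum (fun n => s ^ n * ∫ ω, F ω * u n ω ∂ℙ) (∫ ω, F ω * ∑' n, s ^ n * u n ω ∂ℙ) := by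
    intro F hF hF0 hF1 u hu hu0 hu1
    have := E_tsum (ℙ := ℙ) (F := fun n ω => s ^ n * (F ω * u n ω)) (c := fun n : ℕ => s ^ n * (n + 1))
      (fun n => (hF.mul (hu n)).cmul _) (by
        intro n ω
        rw [abs_of_nonneg (mul_nonneg (pow_nonneg h0 n) (mul_nonneg (hF0 ω) (hu0 n ω)))]
        refine mul_le_mul_of_nonneg_left ?_ (pow_nonneg h0 n)
        exact (mul_le_of_le_one_left (hu0 n ω) (hF1 ω)).trans (hu1 n ω)) (by
        have := (summable_pow_mul_geometric_of_norm_lt_one 1 (r := s) (by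
          rw [Real.norm_of_nonneg h0]; exact h1)).add (summable_geometric_of_lt_one h0 h1)
        refine this.congr fun n => ?_
        simp; ring)
    convert this using 1
    · ext n; rw [E_cmul]
    · congr 1; ext ω; rw [← tsum_mul_left]; apply tsum_congr; intro n; ring
  have k1 := key _ bF F01 F1 (fun n ω => p ω n a x) (fun n => bd_p _ _ _) (fun n ω => p_nonneg _ _ _ _)
    (fun n ω => (p_le_one _ _ _ _).trans (by simp))
  have k2 := key _ (bd_mon M) (mon_nonneg M) (mon_le_one M) (fun n ω => p ω n a x) (fun n => bd_p _ _ _)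
    (fun n ω => p_nonneg _ _ _ _) (fun n ω => (p_le_one _ _ _ _).trans (by simp))
  have k3 := key _ bF F01 F1 (fun n ω => cv ω y (fun m => p ω (m + 1) y x) n a)
    (fun n => bd_cv y (fun ω m => p ω (m + 1) y x) (fun m => bd_p _ _ _) n a)
    (fun n ω => cv_nonneg _ _ _ (fun m => p_nonneg _ _ _ _) _ _)
    (fun n ω => (cv_le _ _ _ (fun m => p_le_one _ _ _ _) _ _).trans (by linarith))
  have k4 := key _ bF F01 F1 (fun n ω => cv ω y (fun m => p ω m (y + dir d f) x) n a)
    (fun n => bd_cv y (fun ω m => p ω m (y + dir d f) x) (fun m => bd_p _ _ _) n a)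
    (fun n ω => cv_nonneg _ _ _ (fun m => p_nonneg _ _ _ _) _ _)
    (fun n ω => (cv_le _ _ _ (fun m => p_le_one _ _ _ _) _ _).trans (by linarith))
  have c3 : ∀ ω : Env d, ∑' n, s ^ n * cv ω y (fun m => p ω (m + 1) y x) n a =
      G s ω a y * (G s ω y x - if y = x then 1 else 0) := by
    intro ω
    rw [G_cv h0 h1 ω y _ (fun m => p_nonneg _ _ _ _) (fun m => p_le_one _ _ _ _), G_split h0 h1 ω y x]
    ring
  have c4 : ∀ ω : Env d, ∑' n, s ^ n * cv ω y (fun m => p ω m (y + dir d f) x) n a =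
      G s ω a y * (s * G s ω (y + dir d f) x) := by
    intro ω
    rw [G_cv h0 h1 ω y _ (fun m => p_nonneg _ _ _ _) (fun m => p_le_one _ _ _ _)]; rfl
  simp_rw [c3] at k3
  simp_rw [c4] at k4
  have L := (k1.mul_left (∑ i, β i + cntAt y M : ℝ)).add k3
  have R := (k2.mul_left (β f + M.count (y, f) : ℝ)).add k4
  refine L.unique (R.congr_fun ?_)
  intro n
  have := ibp_n hM y x f n a M
  linear_combination (s ^ n) * this



/-! ## Part 3: quenched potential theory -/

lemma dir_opp {d : ℕ} (f : Fin (2 * d)) : dir d (opp f) = - dir d f := by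
  ext j
  have hf := f.isLt
  have hj := j.isLt
  simp only [dir, opp, Pi.neg_apply]
  by_cases h : (f : ℕ) < d
  · simp only [h, if_true]
    have : ¬ ((f : ℕ) + d < d) := by omega
    simp only [this, if_false]
    by_cases h2 : (j : ℕ) = f
    · simp [h2]
    · have a1 : ¬ ((j : ℕ) = f + d ∨ (j : ℕ) + d = f + d) := by omega
      have a2 : ¬ ((j : ℕ) = f ∨ (j : ℕ) + d = f) := by omega
      simp only [a1, a2, if_false, neg_zero]
  · simp only [h, if_false]
    have : ((f : ℕ) - d < d) := by omega
    simp only [this, if_true]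
    by_cases h2 : (j : ℕ) + d = f
    · have : (j : ℕ) = f - d := by omega
      have h3 : (f : ℕ) - d + d = f := by omega
      simp [this, h3]
    · have a1 : ¬ ((j : ℕ) = f - d ∨ (j : ℕ) + d = f - d) := by omega
      have a2 : ¬ ((j : ℕ) = f ∨ (j : ℕ) + d = f) := by omega
      simp only [a1, a2, if_false, neg_zero]

lemma dir_ne {d : ℕ} (f : Fin (2 * d)) : dir d f ≠ 0 := by
  have hf := f.isLt
  intro h
  have := congrFun h ⟨if (f : ℕ) < d then f else f - d, by split <;> omega⟩
  simp only [dir, Pi.zero_apply] at this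
  by_cases h1 : (f : ℕ) < d
  · simp [h1] at this
  · have h2 : (f : ℕ) - d + d = f := by omega
    simp [h1, h2] at this

lemma maxp {d : ℕ} {s : ℝ} (h0 : 0 ≤ s) (h1 : s < 1) (ω : Env d) (u : V d → ℝ) (B : ℝ) (hB : ∀ z, u z ≤ B)
    (hu : ∀ z, u z ≤ 0 ∨ u z ≤ s * ∑ f, w ω z f * max (u (z + dir d f)) 0) : ∀ z, u z ≤ 0 := by
  have key : ∀ n : ℕ, ∀ z, u z ≤ s ^ n * max B 0 := by
    intro n
    induction n with
    | zero => intro z; simpa using Or.inl (hB z)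
    | succ n ih =>
      intro z
      have hn : 0 ≤ s ^ n * max B 0 := mul_nonneg (pow_nonneg h0 n) (le_max_right _ _)
      rcases hu z with h | h
      · exact h.trans (mul_nonneg (pow_nonneg h0 _) (le_max_right _ _))
      · refine h.trans ?_
        have : ∑ f, w ω z f * max (u (z + dir d f)) 0 ≤ s ^ n * max B 0 := by
          calc _ ≤ ∑ f, w ω z f * (s ^ n * max B 0) :=
                Finset.sum_le_sum fun f _ => mul_le_mul_of_nonneg_left (max_le (ih _) hn) (w_nonneg _ _ _)
            _ = _ := by rw [← Finset.sum_mul, w_sum, one_mul]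
        calc _ ≤ s * (s ^ n * max B 0) := mul_le_mul_of_nonneg_left this h0
          _ = _ := by ring
  intro z
  have ht : Tendsto (fun n : ℕ => s ^ n * max B 0) atTop (𝓝 (0 * max B 0)) :=
    (tendsto_pow_atTop_nhds_zero_of_lt_one h0 h1).mul_const _
  rw [zero_mul] at ht
  exact ge_of_tendsto' ht (fun n => key n z)

lemma maxp' {d : ℕ} {s : ℝ} (h0 : 0 ≤ s) (h1 : s < 1) (ω : Env d) (u : V d → ℝ) (B : ℝ) (hB : ∀ z, u z ≤ B)
    (hu : ∀ z, u z ≤ 0 ∨ u z ≤ s * ∑ f, w ω z f * u (z + dir d f)) : ∀ z, u z ≤ 0 := by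
  apply maxp h0 h1 ω u B hB
  intro z
  rcases hu z with h | h
  · exact Or.inl h
  · refine Or.inr (h.trans (mul_le_mul_of_nonneg_left ?_ h0))
    exact Finset.sum_le_sum fun f _ => mul_le_mul_of_nonneg_left (le_max_left _ _) (w_nonneg _ _ _)

/-- Green function killed at `x` -/
noncomputable def Gx {d : ℕ} (s : ℝ) (ω : Env d) (x z y : V d) : ℝ :=
  G s ω z y - G s ω z x / G s ω x x * G s ω x y

/-- the edge term -/
noncomputable def Bq {d : ℕ} (s : ℝ) (ω : Env d) (x z : V d) (f : Fin (2 * d)) : ℝ :=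
  w ω z f * (G s ω x x - s * G s ω (z + dir d f) x)

section quenched
variable {d : ℕ} {s : ℝ} (h0 : 0 ≤ s) (h1 : s < 1) (ω : Env d)
include h0 h1

lemma one_le_Gxx (x : V d) : 1 ≤ G s ω x x := by
  rw [G_back h0 h1]
  simp only [if_true, le_add_iff_nonneg_right]
  exact mul_nonneg h0 (Finset.sum_nonneg fun g _ => mul_nonneg (w_nonneg _ _ _) (G_nonneg h0 h1 _ _ _))

lemma Gxx_pos (x : V d) : 0 < G s ω x x := lt_of_lt_of_le one_pos (one_le_Gxx h0 h1 ω x)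

lemma G_le_diag (z x : V d) : G s ω z x ≤ G s ω x x := by
  have := maxp' h0 h1 ω (fun z => G s ω z x - G s ω x x) (1 / (1 - s))
    (fun z => by have := G_le h0 h1 ω z x; have := G_nonneg h0 h1 ω x x; linarith) (by
    intro z
    by_cases h : z = x
    · subst h; left; simp
    · right
      have e := G_back h0 h1 ω z x
      rw [if_neg h, zero_add] at e
      simp only [mul_sub, Finset.sum_sub_distrib, ← Finset.sum_mul, w_sum]
      rw [e]
      have := Gxx_pos h0 h1 ω x
      nlinarith) z
  simpa using this

lemma G_le_s_diag (z x : V d) (h : z ≠ x) : G s ω z x ≤ s * G s ω x x := by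
  rw [G_back h0 h1, if_neg h, zero_add]
  refine mul_le_mul_of_nonneg_left ?_ h0
  calc _ ≤ ∑ g, w ω z g * G s ω x x :=
        Finset.sum_le_sum fun g _ => mul_le_mul_of_nonneg_left (G_le_diag h0 h1 ω _ _) (w_nonneg _ _ _)
    _ = _ := by rw [← Finset.sum_mul, w_sum, one_mul]

lemma Bq_nonneg (x z : V d) (f : Fin (2 * d)) : 0 ≤ Bq s ω x z f := by
  refine mul_nonneg (w_nonneg _ _ _) ?_
  have := G_le_diag h0 h1 ω (z + dir d f) x
  have := G_nonneg h0 h1 ω (z + dir d f) x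
  nlinarith

lemma Bq_le (x z : V d) (f : Fin (2 * d)) : Bq s ω x z f ≤ w ω z f * G s ω x x := by
  refine mul_le_mul_of_nonneg_left ?_ (w_nonneg _ _ _)
  have := G_nonneg h0 h1 ω (z + dir d f) x
  nlinarith

lemma Bq_ge (x z : V d) (f : Fin (2 * d)) :
    s * w ω z f * (G s ω x x - G s ω (z + dir d f) x) ≤ Bq s ω x z f := by
  unfold Bq
  have := mul_nonneg (w_nonneg ω z f) (Gxx_pos h0 h1 ω x).le
  nlinarith

lemma Bq_sum (x z : V d) (h : z ≠ x) : ∑ f, Bq s ω x z f = G s ω x x - G s ω z x := by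
  unfold Bq
  simp only [mul_sub, Finset.sum_sub_distrib, ← Finset.sum_mul, w_sum]
  rw [G_back h0 h1 ω z x, if_neg h, Finset.mul_sum]
  simp only [one_mul, zero_add]
  congr 1
  refine Finset.sum_congr rfl fun f _ => by ring

lemma Bq_sum_self (x : V d) : ∑ f, Bq s ω x x f = 1 := by
  unfold Bq
  simp only [mul_sub, Finset.sum_sub_distrib, ← Finset.sum_mul, w_sum]
  have := G_back h0 h1 ω x x
  rw [if_pos rfl, Finset.mul_sum] at this
  have e : ∑ f, w ω x f * (s * G s ω (x + dir d f) x) = ∑ f, s * (w ω x f * G s ω (x + dir d f) x) :=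
    Finset.sum_congr rfl fun f _ => by ring
  rw [e]; linarith

lemma Gx_self (x y : V d) : Gx s ω x x y = 0 := by
  unfold Gx
  rw [div_self (Gxx_pos h0 h1 ω x).ne']; ring

lemma Gx_self' (x z : V d) : Gx s ω x z x = 0 := by
  unfold Gx
  rw [div_mul_cancel₀ _ (Gxx_pos h0 h1 ω x).ne']; ring

lemma Gx_back (x z y : V d) (h : z ≠ x) :
    Gx s ω x z y = (if z = y then 1 else 0) + s * ∑ f, w ω z f * Gx s ω x (z + dir d f) y := by
  unfold Gx
  rw [G_back h0 h1 ω z y, G_back h0 h1 ω z x, if_neg h]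
  simp only [mul_sub, Finset.sum_sub_distrib]
  have e : ∑ f, w ω z f * (G s ω (z + dir d f) x / G s ω x x * G s ω x y) =
      (∑ f, w ω z f * G s ω (z + dir d f) x) / G s ω x x * G s ω x y := by
    rw [Finset.sum_div, Finset.sum_mul]
    refine Finset.sum_congr rfl fun f _ => by ring
  rw [e]; ring

lemma Gx_root (x y : V d) :
    G s ω x y = G s ω x x * ((if x = y then 1 else 0) + s * ∑ f, w ω x f * Gx s ω x (x + dir d f) y) := by
  have hg := Gxx_pos h0 h1 ω x
  unfold Gx
  simp only [mul_sub, Finset.sum_sub_distrib]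
  have e : ∑ f, w ω x f * (G s ω (x + dir d f) x / G s ω x x * G s ω x y) =
      (∑ f, w ω x f * G s ω (x + dir d f) x) / G s ω x x * G s ω x y := by
    rw [Finset.sum_div, Finset.sum_mul]
    refine Finset.sum_congr rfl fun f _ => by ring
  rw [e]
  have e1 := G_back h0 h1 ω x x
  have e2 := G_back h0 h1 ω x y
  rw [if_pos rfl] at e1
  set A := ∑ f, w ω x f * G s ω (x + dir d f) x
  set B := ∑ f, w ω x f * G s ω (x + dir d f) y
  set g := G s ω x x
  set q := G s ω x y
  have : g * (s * (A / g * q)) = s * A * q := by field_simp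
  linear_combination g * e2 - q * e1 + this

lemma Gx_abs (x z y : V d) : |Gx s ω x z y| ≤ 1 / (1 - s) + 1 / (1 - s) := by
  unfold Gx
  refine (abs_sub _ _).trans (add_le_add ?_ ?_)
  · rw [abs_of_nonneg (G_nonneg h0 h1 _ _ _)]; exact G_le h0 h1 _ _ _
  · have hg := Gxx_pos h0 h1 ω x
    have := G_nonneg h0 h1 ω z x
    have := G_nonneg h0 h1 ω x y
    rw [abs_of_nonneg (by positivity)]
    calc _ ≤ 1 * G s ω x y := by
          gcongr
          rw [div_le_one hg]; exact G_le_diag h0 h1 _ _ _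
      _ ≤ _ := by rw [one_mul]; exact G_le h0 h1 _ _ _

lemma Gx_nonneg (x z y : V d) : 0 ≤ Gx s ω x z y := by
  have := maxp' h0 h1 ω (fun z => - Gx s ω x z y) (1 / (1 - s) + 1 / (1 - s))
    (fun z => (neg_le_abs _).trans (Gx_abs h0 h1 ω x z y)) (by
      intro z
      by_cases h : z = x
      · left; subst h; simp [Gx_self h0 h1]
      · right
        rw [Gx_back h0 h1 ω x z y h]
        simp only [mul_neg, Finset.sum_neg_distrib]
        have : (0 : ℝ) ≤ if z = y then 1 else 0 := by split <;> norm_num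
        linarith) z
  linarith

lemma Gx_fwd (x z y : V d) (f : Fin (2 * d)) (h : y + dir d f ≠ x) :
    s * w ω y f * Gx s ω x z y ≤ Gx s ω x z (y + dir d f) := by
  set v := y + dir d f with hv
  have e : Gx s ω x z v = (if z = v then 1 else 0) +
      s * ∑ f, Gx s ω x z (v - dir d f) * w ω (v - dir d f) f := by
    unfold Gx
    rw [G_fwd h0 h1 ω z v, G_fwd h0 h1 ω x v, if_neg (Ne.symm h)]
    simp only [sub_mul, Finset.sum_sub_distrib]
    have e : ∑ f, G s ω z x / G s ω x x * G s ω x (v - dir d f) * w ω (v - dir d f) f =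
        G s ω z x / G s ω x x * ∑ f, G s ω x (v - dir d f) * w ω (v - dir d f) f := by
      rw [Finset.mul_sum]
      refine Finset.sum_congr rfl fun f _ => by ring
    rw [e]; ring
  rw [e]
  have h2 : (0 : ℝ) ≤ if z = v then 1 else 0 := by split <;> norm_num
  have h3 : Gx s ω x z (v - dir d f) * w ω (v - dir d f) f ≤
      ∑ f, Gx s ω x z (v - dir d f) * w ω (v - dir d f) f :=
    Finset.single_le_sum (f := fun f => Gx s ω x z (v - dir d f) * w ω (v - dir d f) f)
      (fun i _ => mul_nonneg (Gx_nonneg h0 h1 ω _ _ _) (w_nonneg _ _ _)) (Finset.mem_univ f)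
  have h4 : v - dir d f = y := by rw [hv]; simp
  rw [h4] at h3
  have := mul_le_mul_of_nonneg_left h3 h0
  linarith

lemma Gx_fwd' (z y : V d) (f : Fin (2 * d)) :
    s * w ω y f * Gx s ω (y + dir d f) z y ≤ G s ω z (y + dir d f) / G s ω (y + dir d f) (y + dir d f) := by
  set x := y + dir d f with hv
  have hg := Gxx_pos h0 h1 ω x
  have e : G s ω z x / G s ω x x = (if z = x then 1 else 0) +
      s * ∑ f, Gx s ω x z (x - dir d f) * w ω (x - dir d f) f := by
    have e1 := G_fwd h0 h1 ω z x
    have e2 := G_fwd h0 h1 ω x x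
    rw [if_pos rfl] at e2
    unfold Gx
    simp only [sub_mul, Finset.sum_sub_distrib]
    have e : ∑ f, G s ω z x / G s ω x x * G s ω x (x - dir d f) * w ω (x - dir d f) f =
        G s ω z x / G s ω x x * ∑ f, G s ω x (x - dir d f) * w ω (x - dir d f) f := by
      rw [Finset.mul_sum]
      refine Finset.sum_congr rfl fun f _ => by ring
    rw [e]
    set A := ∑ f, G s ω x (x - dir d f) * w ω (x - dir d f) f
    set B := ∑ f, G s ω z (x - dir d f) * w ω (x - dir d f) f
    have e3 : G s ω z x / G s ω x x * G s ω x x = G s ω z x := div_mul_cancel₀ _ hg.ne'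
    linear_combination e1 + e3 - (G s ω z x / G s ω x x) * e2
  rw [e]
  have h2 : (0 : ℝ) ≤ if z = x then 1 else 0 := by split <;> norm_num
  have h3 : Gx s ω x z (x - dir d f) * w ω (x - dir d f) f ≤
      ∑ f, Gx s ω x z (x - dir d f) * w ω (x - dir d f) f :=
    Finset.single_le_sum (f := fun f => Gx s ω x z (x - dir d f) * w ω (x - dir d f) f)
      (fun i _ => mul_nonneg (Gx_nonneg h0 h1 ω _ _ _) (w_nonneg _ _ _)) (Finset.mem_univ f)
  have h4 : x - dir d f = y := by rw [hv]; simp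
  rw [h4] at h3
  have := mul_le_mul_of_nonneg_left h3 h0
  linarith

lemma G_fwd_le (a y : V d) (f : Fin (2 * d)) :
    s * w ω y f * G s ω a y ≤ G s ω a (y + dir d f) := by
  set x := y + dir d f with hv
  rw [G_fwd h0 h1 ω a x]
  have h2 : (0 : ℝ) ≤ if a = x then 1 else 0 := by split <;> norm_num
  have h3 : G s ω a (x - dir d f) * w ω (x - dir d f) f ≤
      ∑ f, G s ω a (x - dir d f) * w ω (x - dir d f) f :=
    Finset.single_le_sum (f := fun f => G s ω a (x - dir d f) * w ω (x - dir d f) f)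
      (fun i _ => mul_nonneg (G_nonneg h0 h1 ω _ _) (w_nonneg _ _ _)) (Finset.mem_univ f)
  have h4 : x - dir d f = y := by rw [hv]; simp
  rw [h4] at h3
  have := mul_le_mul_of_nonneg_left h3 h0
  linarith

end quenched

lemma sumE {d : ℕ} (E : Finset (Edge d)) (z : V d) (c : Edge d → ℝ) :
    ∑ e ∈ E, (if z = e.1 then c e else 0) = ∑ f, if (z, f) ∈ E then c (z, f) else 0 := by
  rw [← Finset.sum_filter, ← Finset.sum_filter]
  refine Finset.sum_bij' (fun e _ => e.2) (fun f _ => (z, f)) ?_ ?_ ?_ ?_ ?_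
  · intro e he; simp only [Finset.mem_filter, Finset.mem_univ, true_and] at he ⊢
    rw [he.2]; exact he.1
  · intro f hf; simpa using hf
  · intro e he; simp only [Finset.mem_filter] at he; rw [he.2]
  · intro f hf; rfl
  · intro e he; simp only [Finset.mem_filter] at he; rw [he.2]



lemma Q4 {d : ℕ} {s : ℝ} (h0 : 0 ≤ s) (h1 : s < 1) (ω : Env d) (a x : V d) (E : Finset (Edge d))
    (K C : ℝ) (hK0 : 0 ≤ K) (hK1 : K ≤ 1) (hC : 1 ≤ C)
    (hB : ∀ e ∈ E, K * Bq s ω x e.1 e.2 ≤ C)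
    (hG : ∀ e ∈ E, ∀ z, K * Gx s ω x z e.1 ≤ C * (G s ω z x / G s ω x x)) :
    K ^ 3 * ∑ e ∈ E, w ω e.1 e.2 * (G s ω a e.1 * (G s ω e.1 x - s * G s ω (e.1 + dir d e.2) x)) ≤
      G s ω a x * (K ^ 3 + (2 * E.card * C ^ 3 + C) * ∑ e ∈ E, w ω e.1 e.2) := by
  set g := G s ω x x with hgdef
  have hg : 0 < g := Gxx_pos h0 h1 ω x
  have hC0 : 0 ≤ C := by linarith
  set wE := ∑ e ∈ E, w ω e.1 e.2 with hwE
  have hwE0 : 0 ≤ wE := Finset.sum_nonneg fun e _ => w_nonneg _ _ _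
  set m : V d → ℝ := fun z => ∑ e ∈ E, Gx s ω x z e.1 * Bq s ω x e.1 e.2 with hm
  set r : V d → ℝ := fun z => ∑ e ∈ E, Gx s ω x z e.1 * (w ω e.1 e.2 * m (e.1 + dir d e.2)) with hr
  have hm0 : ∀ z, 0 ≤ m z := fun z => Finset.sum_nonneg fun e _ =>
    mul_nonneg (Gx_nonneg h0 h1 _ _ _ _) (Bq_nonneg h0 h1 _ _ _ _)
  have hr0 : ∀ z, 0 ≤ r z := fun z => Finset.sum_nonneg fun e _ =>
    mul_nonneg (Gx_nonneg h0 h1 _ _ _ _) (mul_nonneg (w_nonneg _ _ _) (hm0 _))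
  have hφ1 : ∀ z, G s ω z x / g ≤ 1 := fun z => by
    rw [div_le_one hg]; exact G_le_diag h0 h1 _ _ _
  have hφ0 : ∀ z, 0 ≤ G s ω z x / g := fun z => div_nonneg (G_nonneg h0 h1 _ _ _) hg.le
  -- generic expansion
  have hexp : ∀ (c : Edge d → ℝ) (z : V d), z ≠ x → ∑ e ∈ E, Gx s ω x z e.1 * c e =
      (∑ f, if (z, f) ∈ E then c (z, f) else 0) +
        s * ∑ f, w ω z f * ∑ e ∈ E, Gx s ω x (z + dir d f) e.1 * c e := by
    intro c z hz
    rw [← sumE]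
    have : ∀ e ∈ E, Gx s ω x z e.1 * c e = (if z = e.1 then c e else 0) +
        ∑ f, s * (w ω z f * (Gx s ω x (z + dir d f) e.1 * c e)) := by
      intro e _
      rw [Gx_back h0 h1 ω x z e.1 hz, add_mul]
      congr 1
      · split <;> simp
      · rw [Finset.mul_sum, Finset.sum_mul]
        refine Finset.sum_congr rfl fun f _ => by ring
    rw [Finset.sum_congr rfl this, Finset.sum_add_distrib, Finset.sum_comm]
    congr 1
    rw [Finset.mul_sum]
    refine Finset.sum_congr rfl fun f _ => ?_
    rw [Finset.mul_sum, Finset.mul_sum]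
  -- K-bounds
  have hGC : ∀ e ∈ E, ∀ z, K * Gx s ω x z e.1 ≤ C := fun e he z =>
    (hG e he z).trans (mul_le_of_le_one_right hC0 (hφ1 z))
  have hmK : ∀ z, K ^ 2 * m z ≤ E.card * C ^ 2 := by
    intro z
    rw [hm, Finset.mul_sum, ← nsmul_eq_mul]
    apply Finset.sum_le_card_nsmul
    intro e he
    calc K ^ 2 * (Gx s ω x z e.1 * Bq s ω x e.1 e.2) =
        (K * Gx s ω x z e.1) * (K * Bq s ω x e.1 e.2) := by ring
      _ ≤ C * C := mul_le_mul (hGC e he z) (hB e he) (mul_nonneg hK0 (Bq_nonneg h0 h1 _ _ _ _)) hC0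
      _ = C ^ 2 := by ring
  have hrK : ∀ z, K ^ 3 * r z ≤ E.card * C ^ 3 * wE := by
    intro z
    rw [hr, Finset.mul_sum, hwE, Finset.mul_sum]
    refine Finset.sum_le_sum fun e he => ?_
    calc K ^ 3 * (Gx s ω x z e.1 * (w ω e.1 e.2 * m (e.1 + dir d e.2)))
        = (K * Gx s ω x z e.1) * ((K ^ 2 * m (e.1 + dir d e.2)) * w ω e.1 e.2) := by ring
      _ ≤ C * ((E.card * C ^ 2) * w ω e.1 e.2) := by
          refine mul_le_mul (hGC e he z) ?_ ?_ hC0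
          · exact mul_le_mul_of_nonneg_right (hmK _) (w_nonneg _ _ _)
          · exact mul_nonneg (mul_nonneg (pow_nonneg hK0 _) (hm0 _)) (w_nonneg _ _ _)
      _ = _ := by ring
  -- local inequality
  have hloc : ∀ z, (∑ f, if (z, f) ∈ E then Bq s ω x z f else 0) - ∑ f, Bq s ω x z f +
      s * ∑ f, w ω z f * m (z + dir d f) ≤
      s * ∑ f, w ω z f * (if (z, f) ∈ E then m (z + dir d f) else
        m (z + dir d f) - (g - G s ω (z + dir d f) x)) := by
    intro z
    rw [Finset.mul_sum, Finset.mul_sum, ← Finset.sum_sub_distrib, ← Finset.sum_add_distrib]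
    refine Finset.sum_le_sum fun f _ => ?_
    by_cases hf : (z, f) ∈ E
    · simp [hf]
    · simp only [hf, if_false]
      have := Bq_ge h0 h1 ω x z f
      linarith
  -- domination d ≤ r
  have hdom : ∀ z, m z - (g - G s ω z x) - r z ≤ 0 := by
    obtain ⟨Bm, hBm⟩ : ∃ Bm, ∀ z, m z ≤ Bm := by
      refine ⟨∑ e ∈ E, (1 / (1 - s) + 1 / (1 - s)) * Bq s ω x e.1 e.2, fun z => ?_⟩
      refine Finset.sum_le_sum fun e _ => mul_le_mul_of_nonneg_right ?_ (Bq_nonneg h0 h1 _ _ _ _)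
      exact (le_abs_self _).trans (Gx_abs h0 h1 _ _ _ _)
    apply maxp h0 h1 ω _ Bm
    · intro z
      have := hr0 z; have := hBm z; have := G_le_diag h0 h1 ω z x
      linarith
    · intro z
      by_cases hz : z = x
      · left
        subst hz
        have : m z = 0 := Finset.sum_eq_zero fun e _ => by rw [Gx_self h0 h1]; simp
        have := hr0 z
        linarith
      · right
        have e1 := hexp (fun e => Bq s ω x e.1 e.2) z hz
        have e2 := hexp (fun e => w ω e.1 e.2 * m (e.1 + dir d e.2)) z hz
        have e3 := Bq_sum h0 h1 ω x z hz
        have e4 := hloc z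
        change m z = _ + s * ∑ f, w ω z f * m (z + dir d f) at e1
        change r z = _ + s * ∑ f, w ω z f * r (z + dir d f) at e2
        simp only at e1 e2
        have e5 : s * ∑ f, w ω z f * (if (z, f) ∈ E then m (z + dir d f) else
              m (z + dir d f) - (g - G s ω (z + dir d f) x)) ≤
            (∑ f, if (z, f) ∈ E then w ω z f * m (z + dir d f) else 0) +
            s * ∑ f, w ω z f * r (z + dir d f) +
            s * ∑ f, w ω z f * max (m (z + dir d f) - (g - G s ω (z + dir d f) x) - r (z + dir d f)) 0 := by
          rw [Finset.mul_sum, Finset.mul_sum, Finset.mul_sum, ← Finset.sum_add_distrib,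
            ← Finset.sum_add_distrib]
          refine Finset.sum_le_sum fun f _ => ?_
          have hwn := w_nonneg ω z f
          have hmm := le_max_right (m (z + dir d f) - (g - G s ω (z + dir d f) x) - r (z + dir d f)) 0
          have hmm' := le_max_left (m (z + dir d f) - (g - G s ω (z + dir d f) x) - r (z + dir d f)) 0
          by_cases hf : (z, f) ∈ E
          · simp only [hf, if_true]
            have q1 : 0 ≤ w ω z f * m (z + dir d f) := mul_nonneg hwn (hm0 _)
            have q2 : 0 ≤ w ω z f * r (z + dir d f) := mul_nonneg hwn (hr0 _)
            have q3 := mul_nonneg h0 (mul_nonneg hwn hmm)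
            have q4 := mul_nonneg h0 q2
            nlinarith
          · simp only [hf, if_false, zero_add]
            rw [← mul_add, ← mul_add]
            refine mul_le_mul_of_nonneg_left (mul_le_mul_of_nonneg_left ?_ hwn) h0
            linarith
        linarith
  -- root
  set Mx := ∑ e ∈ E, G s ω x e.1 * Bq s ω x e.1 e.2 with hMx
  have hMx1 : Mx = g * ((∑ f, if (x, f) ∈ E then Bq s ω x x f else 0) +
      s * ∑ f, w ω x f * m (x + dir d f)) := by
    have := sumE E x (fun e => Bq s ω x e.1 e.2)
    simp only at this
    rw [← this, hMx]
    have : ∀ e ∈ E, G s ω x e.1 * Bq s ω x e.1 e.2 = g * ((if x = e.1 then Bq s ω x e.1 e.2 else 0) +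
        ∑ f, s * (w ω x f * (Gx s ω x (x + dir d f) e.1 * Bq s ω x e.1 e.2))) := by
      intro e _
      rw [Gx_root h0 h1 ω x e.1, mul_assoc, add_mul]
      congr 2
      · split <;> simp
      · rw [Finset.mul_sum, Finset.sum_mul]
        refine Finset.sum_congr rfl fun f _ => by ring
    rw [Finset.sum_congr rfl this, ← Finset.mul_sum, Finset.sum_add_distrib, Finset.sum_comm]
    congr 2
    rw [Finset.mul_sum]
    refine Finset.sum_congr rfl fun f _ => ?_
    rw [hm, Finset.mul_sum, Finset.mul_sum]
  have hMx2 : Mx ≤ g * (1 + ∑ f, w ω x f * r (x + dir d f) +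
      ∑ f, if (x, f) ∈ E then w ω x f * m (x + dir d f) else 0) := by
    rw [hMx1]
    refine mul_le_mul_of_nonneg_left ?_ hg.le
    have e3 := Bq_sum_self h0 h1 ω x
    have e4 := hloc x
    have e5 : s * ∑ f, w ω x f * (if (x, f) ∈ E then m (x + dir d f) else
          m (x + dir d f) - (g - G s ω (x + dir d f) x)) ≤
        ∑ f, w ω x f * r (x + dir d f) + ∑ f, if (x, f) ∈ E then w ω x f * m (x + dir d f) else 0 := by
      rw [Finset.mul_sum, ← Finset.sum_add_distrib]
      refine Finset.sum_le_sum fun f _ => ?_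
      have hwn := w_nonneg ω x f
      have hrn := hr0 (x + dir d f)
      by_cases hf : (x, f) ∈ E
      · simp only [hf, if_true]
        have q1 : 0 ≤ w ω x f * m (x + dir d f) := mul_nonneg hwn (hm0 _)
        have q2 : 0 ≤ w ω x f * r (x + dir d f) := mul_nonneg hwn hrn
        nlinarith
      · simp only [hf, if_false, add_zero]
        have hd := hdom (x + dir d f)
        have q2 : 0 ≤ w ω x f * r (x + dir d f) := mul_nonneg hwn hrn
        have q3 : w ω x f * (m (x + dir d f) - (g - G s ω (x + dir d f) x)) ≤ w ω x f * r (x + dir d f) :=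
          mul_le_mul_of_nonneg_left (by linarith) hwn
        calc _ ≤ s * (w ω x f * r (x + dir d f)) := mul_le_mul_of_nonneg_left q3 h0
          _ ≤ _ := mul_le_of_le_one_left q2 h1.le
    linarith
  have hMxK : K ^ 3 * Mx ≤ g * (K ^ 3 + 2 * E.card * C ^ 3 * wE) := by
    have b1 : K ^ 3 * ∑ f, w ω x f * r (x + dir d f) ≤ E.card * C ^ 3 * wE := by
      calc _ = ∑ f, w ω x f * (K ^ 3 * r (x + dir d f)) := by
            rw [Finset.mul_sum]; refine Finset.sum_congr rfl fun f _ => by ring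
        _ ≤ ∑ f, w ω x f * (E.card * C ^ 3 * wE) :=
            Finset.sum_le_sum fun f _ => mul_le_mul_of_nonneg_left (hrK _) (w_nonneg _ _ _)
        _ = _ := by rw [← Finset.sum_mul, w_sum, one_mul]
    have b2 : K ^ 3 * (∑ f, if (x, f) ∈ E then w ω x f * m (x + dir d f) else 0) ≤ E.card * C ^ 3 * wE := by
      have c1 : K ^ 3 * (∑ f, if (x, f) ∈ E then w ω x f * m (x + dir d f) else 0) ≤
          (E.card * C ^ 3) * ∑ f, if (x, f) ∈ E then w ω x f else 0 := by
        rw [Finset.mul_sum, Finset.mul_sum]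
        refine Finset.sum_le_sum fun f _ => ?_
        split
        · have k1 : K ^ 3 * m (x + dir d f) ≤ E.card * C ^ 3 := by
            calc K ^ 3 * m (x + dir d f) = K * (K ^ 2 * m (x + dir d f)) := by ring
              _ ≤ 1 * (K ^ 2 * m (x + dir d f)) :=
                  mul_le_mul_of_nonneg_right hK1 (mul_nonneg (pow_nonneg hK0 _) (hm0 _))
              _ ≤ E.card * C ^ 2 := by rw [one_mul]; exact hmK _
              _ ≤ E.card * C ^ 3 := by gcongr; omega
          have := mul_le_mul_of_nonneg_right k1 (w_nonneg ω x f)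
          linarith
        · simp
      refine c1.trans (mul_le_mul_of_nonneg_left ?_ (by positivity))
      have := sumE E x (fun e => w ω e.1 e.2)
      simp only at this
      rw [← this]
      refine Finset.sum_le_sum fun e _ => ?_
      split
      · exact le_rfl
      · exact w_nonneg _ _ _
    calc K ^ 3 * Mx ≤ K ^ 3 * (g * (1 + ∑ f, w ω x f * r (x + dir d f) +
      ∑ f, if (x, f) ∈ E then w ω x f * m (x + dir d f) else 0)) :=
          mul_le_mul_of_nonneg_left hMx2 (pow_nonneg hK0 _)
      _ = g * (K ^ 3 + K ^ 3 * ∑ f, w ω x f * r (x + dir d f) +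
          K ^ 3 * ∑ f, if (x, f) ∈ E then w ω x f * m (x + dir d f) else 0) := by ring
      _ ≤ _ := mul_le_mul_of_nonneg_left (by linarith) hg.le
  -- first part
  have hfirst : K ^ 3 * ∑ e ∈ E, Gx s ω x a e.1 * Bq s ω x e.1 e.2 ≤ C * G s ω a x * wE := by
    rw [Finset.mul_sum, hwE, Finset.mul_sum]
    refine Finset.sum_le_sum fun e he => ?_
    have q0 : 0 ≤ Gx s ω x a e.1 * Bq s ω x e.1 e.2 :=
      mul_nonneg (Gx_nonneg h0 h1 _ _ _ _) (Bq_nonneg h0 h1 _ _ _ _)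
    have q1 : K ^ 3 ≤ K := by
      calc K ^ 3 ≤ K ^ 1 := pow_le_pow_of_le_one hK0 hK1 (by norm_num)
        _ = K := pow_one K
    calc _ ≤ K * (Gx s ω x a e.1 * Bq s ω x e.1 e.2) := mul_le_mul_of_nonneg_right q1 q0
      _ = (K * Gx s ω x a e.1) * Bq s ω x e.1 e.2 := by ring
      _ ≤ (C * (G s ω a x / g)) * (w ω e.1 e.2 * g) :=
          mul_le_mul (hG e he a) (Bq_le h0 h1 _ _ _ _) (Bq_nonneg h0 h1 _ _ _ _)
            (mul_nonneg hC0 (hφ0 _))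
      _ = C * (G s ω a x / g * g) * w ω e.1 e.2 := by ring
      _ = _ := by rw [div_mul_cancel₀ _ hg.ne']
  have hT : ∑ e ∈ E, w ω e.1 e.2 * (G s ω a e.1 * (G s ω e.1 x - s * G s ω (e.1 + dir d e.2) x)) ≤
      ∑ e ∈ E, Gx s ω x a e.1 * Bq s ω x e.1 e.2 + G s ω a x / g * Mx := by
    rw [hMx, Finset.mul_sum, ← Finset.sum_add_distrib]
    refine Finset.sum_le_sum fun e _ => ?_
    have : Gx s ω x a e.1 * Bq s ω x e.1 e.2 + G s ω a x / g * (G s ω x e.1 * Bq s ω x e.1 e.2) =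
        G s ω a e.1 * Bq s ω x e.1 e.2 := by
      unfold Gx; ring
    rw [this]
    unfold Bq
    have q1 := G_le_diag h0 h1 ω e.1 x
    have q2 := mul_nonneg (G_nonneg h0 h1 ω a e.1) (w_nonneg ω e.1 e.2)
    nlinarith
  calc _ ≤ K ^ 3 * (∑ e ∈ E, Gx s ω x a e.1 * Bq s ω x e.1 e.2 + G s ω a x / g * Mx) :=
        mul_le_mul_of_nonneg_left hT (pow_nonneg hK0 _)
    _ = K ^ 3 * ∑ e ∈ E, Gx s ω x a e.1 * Bq s ω x e.1 e.2 + G s ω a x / g * (K ^ 3 * Mx) := by ring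
    _ ≤ C * G s ω a x * wE + G s ω a x / g * (g * (K ^ 3 + 2 * E.card * C ^ 3 * wE)) :=
        add_le_add hfirst (mul_le_mul_of_nonneg_left hMxK (hφ0 _))
    _ = C * G s ω a x * wE + (G s ω a x / g * g) * (K ^ 3 + 2 * E.card * C ^ 3 * wE) := by ring
    _ = _ := by rw [div_mul_cancel₀ _ hg.ne']; ring



/-- lateral directions -/
def Lat {d : ℕ} (f : Fin (2 * d)) : Prop := (f : ℕ) ≠ 0 ∧ (f : ℕ) ≠ d

/-- growing clusters -/
inductive Cl {d : ℕ} (x : V d) : ℕ → Finset (V d) → Multiset (Edge d) → Prop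
  | base : Cl x 0 {x} 0
  | step (n : ℕ) (Y : Finset (V d)) (M : Multiset (Edge d)) (y : V d) (f : Fin (2 * d)) :
      Cl x n Y M → y ∈ Y → Lat f → y + dir d f ∉ Y →
      Cl x (n + 1) (insert (y + dir d f) Y) ((y, f) ::ₘ (y + dir d f, opp f) ::ₘ M)

lemma opp_add {d : ℕ} (y : V d) (f : Fin (2 * d)) : y + dir d f + dir d (opp f) = y := by
  rw [dir_opp]; simp

lemma Cl.edges {d : ℕ} {x : V d} {n Y M} (h : Cl x n Y M) :
    ∀ e ∈ M, e.1 ∈ Y ∧ e.1 + dir d e.2 ∈ Y := by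
  induction h with
  | base => simp
  | step n Y M y f _ hy hf hz ih =>
    intro e he
    rcases Multiset.mem_cons.1 he with rfl | he
    · simp [hy]
    rcases Multiset.mem_cons.1 he with rfl | he
    · simp only [opp_add]; simp [hy]
    · have := ih e he; simp [this]

lemma Cl.card_edges {d : ℕ} {x : V d} {n Y M} (h : Cl x n Y M) : M.card = 2 * n := by
  induction h with
  | base => simp
  | step n Y M y f _ hy hf hz ih => simp [ih]; ring

lemma Cl.card {d : ℕ} {x : V d} {n Y M} (h : Cl x n Y M) : Y.card = n + 1 := by
  induction h with
  | base => simp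
  | step n Y M y f _ hy hf hz ih => rw [Finset.card_insert_of_notMem hz, ih]

lemma Cl.root {d : ℕ} {x : V d} {n Y M} (h : Cl x n Y M) : x ∈ Y := by
  induction h with
  | base => simp
  | step n Y M y f _ hy hf hz ih => exact Finset.mem_insert_of_mem ih

/-- the properties kept along the growth of the cluster -/
structure Good {d : ℕ} (s : ℝ) (ω : Env d) (a x : V d) (Y : Finset (V d)) (K C : ℝ) : Prop where
  K0 : 0 ≤ K
  K1 : K ≤ 1
  C1 : 1 ≤ C
  A1 : ∀ y ∈ Y, K * G s ω a x ≤ C * G s ω a y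
  A2 : ∀ y ∈ Y, K * (G s ω x x - G s ω y x) ≤ C
  A3 : ∀ y ∈ Y, ∀ z, K * Gx s ω x z y ≤ C * (G s ω z x / G s ω x x)
  A4 : ∀ y ∈ Y, K * G s ω a y ≤ C * G s ω a x

lemma Cl.good {d : ℕ} {s : ℝ} (hs : 1 / 2 ≤ s) (h1 : s < 1) (ω : Env d) (a : V d)
    {x : V d} {n Y M} (h : Cl x n Y M) : Good s ω a x Y (mon M ω) (2 ^ n) := by
  have h0 : 0 ≤ s := by linarith
  have hφ : ∀ z, 0 ≤ G s ω z x / G s ω x x := fun z =>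
    div_nonneg (G_nonneg h0 h1 _ _ _) (G_nonneg h0 h1 _ _ _)
  induction h with
  | base =>
    refine ⟨by simp, by simp, by simp, ?_, ?_, ?_, ?_⟩
    · simp
    · simp
    · intro y hy z
      rw [Finset.mem_singleton] at hy; subst hy
      rw [Gx_self' h0 h1]; simpa using hφ z
    · simp
  | step n Y M y f hcl hy hf hz ih =>
    set K := mon M ω
    set z := y + dir d f with hzdef
    set C : ℝ := 2 ^ n
    have hK' : mon ((y, f) ::ₘ (z, opp f) ::ₘ M) ω = w ω y f * w ω z (opp f) * K := by
      rw [mon_cons, mon_cons, mul_assoc]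
    have hC' : (2 : ℝ) ^ (n + 1) = 2 * C := by rw [pow_succ]; ring
    rw [hK', hC']
    obtain ⟨K0, K1, C1, A1, A2, A3, A4⟩ := ih
    have C0 : 0 ≤ C := by linarith
    set u := w ω y f
    set v := w ω z (opp f)
    have u0 : 0 ≤ u := w_nonneg _ _ _
    have u1 : u ≤ 1 := w_le_one _ _ _
    have v0 : 0 ≤ v := w_nonneg _ _ _
    have v1 : v ≤ 1 := w_le_one _ _ _
    have uv1 : u * v ≤ 1 := mul_le_one₀ u1 v0 v1
    have kk : u * v * K ≤ K := mul_le_of_le_one_left K0 uv1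
    have ku : u * v * K ≤ u * K := by
      have := mul_nonneg u0 K0
      nlinarith
    have kv : u * v * K ≤ v * K := by
      have := mul_nonneg v0 K0
      nlinarith
    have hzx : z ≠ x := fun hh => hz (hh ▸ hcl.root)
    -- halving tool
    have tool : ∀ A B : ℝ, 0 ≤ A → s * A ≤ B → A ≤ 2 * B := by
      intro A B hA hAB; nlinarith
    refine ⟨by positivity, kk.trans K1, by linarith, ?_, ?_, ?_, ?_⟩
    · intro y' hy'
      have hx0 := G_nonneg h0 h1 ω a x
      rcases Finset.mem_insert.1 hy' with rfl | hy'
      · have t1 := G_fwd_le h0 h1 ω a y f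
        have t2 := tool (u * G s ω a y) (G s ω a z) (mul_nonneg u0 (G_nonneg h0 h1 _ _ _)) (by rw [← mul_assoc]; exact t1)
        have t3 := mul_le_mul_of_nonneg_left (A1 y hy) u0
        have t4 := mul_le_mul_of_nonneg_right ku hx0
        have t5 := mul_le_mul_of_nonneg_left t2 C0
        nlinarith
      · have := A1 y' hy'
        have t4 := mul_le_mul_of_nonneg_right kk hx0
        have t6 := mul_nonneg C0 (G_nonneg h0 h1 ω a y')
        nlinarith
    · intro y' hy'
      have hx0 : 0 ≤ G s ω x x - G s ω y' x := by have := G_le_diag h0 h1 ω y' x; linarith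
      rcases Finset.mem_insert.1 hy' with rfl | hy'
      · have t4 := mul_le_mul_of_nonneg_right ku hx0
        have q1 := Bq_ge h0 h1 ω x y f
        have q2 : Bq s ω x y f ≤ ∑ f, Bq s ω x y f :=
          Finset.single_le_sum (f := fun f => Bq s ω x y f) (fun i _ => Bq_nonneg h0 h1 ω x y i)
            (Finset.mem_univ f)
        have t2 := tool (u * (G s ω x x - G s ω z x)) (∑ f, Bq s ω x y f) (mul_nonneg u0 hx0)
          (by rw [← mul_assoc]; exact q1.trans q2)
        have t5 := mul_le_mul_of_nonneg_left t2 K0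
        by_cases hyx : y = x
        · have q3 : ∑ f, Bq s ω x y f = 1 := by rw [hyx]; exact Bq_sum_self h0 h1 ω x
          rw [q3] at t5
          nlinarith
        · rw [Bq_sum h0 h1 ω x y hyx] at t5
          have := A2 y hy
          nlinarith
      · have := A2 y' hy'
        have t4 := mul_le_mul_of_nonneg_right kk hx0
        nlinarith
    · intro y' hy' z'
      have hx0 := Gx_nonneg h0 h1 ω x z' y'
      rcases Finset.mem_insert.1 hy' with rfl | hy'
      · have t4 := mul_le_mul_of_nonneg_right kv hx0
        have hyo : z + dir d (opp f) = y := opp_add y f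
        by_cases hyx : y = x
        · have q1 := Gx_fwd' h0 h1 ω z' z (opp f)
          rw [hyo, hyx] at q1
          have t2 := tool (v * Gx s ω x z' z) (G s ω z' x / G s ω x x) (mul_nonneg v0 hx0) (by rw [← mul_assoc]; exact q1)
          have t5 := mul_le_mul_of_nonneg_left t2 K0
          have t6 := hφ z'
          have t7 : K * (G s ω z' x / G s ω x x) ≤ 1 * (G s ω z' x / G s ω x x) :=
            mul_le_mul_of_nonneg_right K1 t6
          have t8 : 1 * (G s ω z' x / G s ω x x) ≤ C * (G s ω z' x / G s ω x x) :=
            mul_le_mul_of_nonneg_right C1 t6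
          nlinarith
        · have q1 := Gx_fwd h0 h1 ω x z' z (opp f) (by rw [hyo]; exact hyx)
          rw [hyo] at q1
          have t2 := tool (v * Gx s ω x z' z) (Gx s ω x z' y) (mul_nonneg v0 hx0) (by rw [← mul_assoc]; exact q1)
          have t5 := mul_le_mul_of_nonneg_left t2 K0
          have := A3 y hy z'
          nlinarith
      · have := A3 y' hy' z'
        have t4 := mul_le_mul_of_nonneg_right kk hx0
        have t6 := mul_nonneg C0 (hφ z')
        nlinarith
    · intro y' hy'
      have hx0 := G_nonneg h0 h1 ω a y'
      rcases Finset.mem_insert.1 hy' with rfl | hy'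
      · have hyo : z + dir d (opp f) = y := opp_add y f
        have t4 := mul_le_mul_of_nonneg_right kv hx0
        have t1 := G_fwd_le h0 h1 ω a z (opp f)
        rw [hyo] at t1
        have t2 := tool (v * G s ω a z) (G s ω a y) (mul_nonneg v0 hx0) (by rw [← mul_assoc]; exact t1)
        have t5 := mul_le_mul_of_nonneg_left t2 K0
        have := A4 y hy
        nlinarith
      · have := A4 y' hy'
        have t4 := mul_le_mul_of_nonneg_right kk hx0
        have t6 := mul_nonneg C0 (G_nonneg h0 h1 ω a x)
        nlinarith

lemma Good.B {d : ℕ} {s : ℝ} (h0 : 0 ≤ s) (h1 : s < 1) {ω : Env d} {a x : V d} {Y K C}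
    (h : Good s ω a x Y K C) (y : V d) (hy : y ∈ Y) (f : Fin (2 * d)) : K * Bq s ω x y f ≤ C := by
  have q2 : Bq s ω x y f ≤ ∑ f, Bq s ω x y f :=
    Finset.single_le_sum (f := fun f => Bq s ω x y f) (fun i _ => Bq_nonneg h0 h1 ω x y i)
      (Finset.mem_univ f)
  have t := mul_le_mul_of_nonneg_left q2 h.K0
  by_cases hyx : y = x
  · have q3 : ∑ f, Bq s ω x y f = 1 := by rw [hyx]; exact Bq_sum_self h0 h1 ω x
    rw [q3] at t
    have := h.K1; have := h.C1; linarith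
  · rw [Bq_sum h0 h1 ω x y hyx] at t
    exact t.trans (h.A2 y hy)

lemma mon_nsmul {d : ℕ} (n : ℕ) (M : Multiset (Edge d)) (ω : Env d) :
    mon (n • M) ω = mon M ω ^ n := by
  induction n with
  | zero => simp
  | succ n ih => rw [succ_nsmul, mon_add, ih, pow_succ]

/-- The one-cluster exit estimate. -/
lemma exit_est {d : ℕ} {β : Fin (2 * d) → ℝ} {ℙ : Measure (Env d)} (hM : Mom d β ℙ) (hβ : ∀ i, 0 < β i)
    {s : ℝ} (hs : 1 / 2 ≤ s) (h1 : s < 1) (a x : V d) {n Y M} (hcl : Cl x n Y M)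
    (E : Finset (Edge d)) (hE : ∀ e ∈ E, e.1 ∈ Y ∧ e.1 + dir d e.2 ∉ Y) :
    (∑ e ∈ E, β e.2 - 1) * ∫ ω, mon M ω ^ 6 * G s ω a x ∂ℙ ≤
      (∑ i, β i + 12 * n + (2 * E.card * (2 ^ n) ^ 3 + 2 ^ n)) *
        ∑ e ∈ E, ∫ ω, mon M ω ^ 3 * w ω e.1 e.2 * G s ω a x ∂ℙ := by
  have := hM.prob
  have h0 : 0 ≤ s := by linarith
  set B := ∑ i, β i with hBdef
  have hB0 : 0 ≤ B := Finset.sum_nonneg fun i _ => (hβ i).le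
  set Kf : Env d → ℝ := fun ω => mon M ω with hKf
  have bK : Bd Kf := bd_mon M
  have K0 : ∀ ω, 0 ≤ Kf ω := mon_nonneg M
  have K1 : ∀ ω, Kf ω ≤ 1 := mon_le_one M
  set C2 : ℝ := 2 * E.card * (2 ^ n) ^ 3 + 2 ^ n with hC2
  -- each edge
  have hedge : ∀ e ∈ E, β e.2 * ∫ ω, Kf ω ^ 6 * G s ω a x ∂ℙ ≤
      (B + 12 * n) * ∫ ω, Kf ω ^ 3 * w ω e.1 e.2 * G s ω a x ∂ℙ +
      ∫ ω, Kf ω ^ 6 * (w ω e.1 e.2 * (G s ω a e.1 * (G s ω e.1 x - s * G s ω (e.1 + dir d e.2) x))) ∂ℙ := by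
    intro e he
    obtain ⟨y, f⟩ := e
    have I := ibp_G hM h0 h1 a x y f (6 • M)
    simp only [mon_nsmul] at I
    have hcount : (6 • M).count (y, f) = 0 := by
      rw [Multiset.count_nsmul, Multiset.count_eq_zero.2, mul_zero]
      intro hmem
      exact (hE _ he).2 (hcl.edges _ hmem).2
    rw [hcount] at I
    have hcnt : ((cntAt y (6 • M) : ℕ) : ℝ) ≤ 12 * n := by
      have : cntAt y (6 • M) ≤ 12 * n := by
        calc cntAt y (6 • M) ≤ (6 • M).card := Multiset.countP_le_card _ _
          _ = 12 * n := by rw [Multiset.card_nsmul, hcl.card_edges]; ring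
      exact_mod_cast this
    have bh : Bd (fun ω : Env d => G s ω a x) := bd_G h0 h1 a x
    have bK6w : Bd (fun ω => Kf ω ^ 6 * w ω y f) := (bK.pow 6).mul (bd_w y f)
    have bGy := bd_G h0 h1 a y
    have hcmp : ∫ ω, Kf ω ^ 6 * w ω y f * G s ω a x ∂ℙ ≤ ∫ ω, Kf ω ^ 3 * w ω y f * G s ω a x ∂ℙ := by
      apply E_mono (bK6w.mul bh) (((bK.pow 3).mul (bd_w y f)).mul bh)
      intro ω
      refine mul_le_mul_of_nonneg_right (mul_le_mul_of_nonneg_right ?_ (w_nonneg _ _ _)) (G_nonneg h0 h1 _ _ _)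
      exact pow_le_pow_of_le_one (K0 ω) (K1 ω) (by norm_num)
    have hn1 : 0 ≤ ∫ ω, Kf ω ^ 6 * w ω y f * G s ω a x ∂ℙ :=
      integral_nonneg fun ω => mul_nonneg (mul_nonneg (pow_nonneg (K0 ω) _) (w_nonneg _ _ _)) (G_nonneg h0 h1 _ _ _)
    have hcoef : (B + (cntAt y (6 • M) : ℕ)) * ∫ ω, Kf ω ^ 6 * w ω y f * G s ω a x ∂ℙ ≤
        (B + 12 * n) * ∫ ω, Kf ω ^ 3 * w ω y f * G s ω a x ∂ℙ := by
      apply mul_le_mul (by linarith) hcmp hn1 (by positivity)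
    have hfin : ∫ ω, Kf ω ^ 6 * w ω y f * (G s ω a y * (G s ω y x - if y = x then 1 else 0)) ∂ℙ -
        ∫ ω, Kf ω ^ 6 * w ω y f * (G s ω a y * (s * G s ω (y + dir d f) x)) ∂ℙ ≤
        ∫ ω, Kf ω ^ 6 * (w ω y f * (G s ω a y * (G s ω y x - s * G s ω (y + dir d f) x))) ∂ℙ := by
      have b1 := bK6w.mul (bGy.mul ((bd_G h0 h1 y x).sub (Bd.const (if y = x then 1 else 0))))
      have b2 := bK6w.mul (bGy.mul ((bd_G h0 h1 (y + dir d f) x).cmul s))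
      rw [← E_sub b1 b2]
      apply E_mono (b1.sub b2) ((bK.pow 6).mul ((bd_w y f).mul (bGy.mul ((bd_G h0 h1 y x).sub ((bd_G h0 h1 (y + dir d f) x).cmul s)))))
      intro ω
      have t0 : 0 ≤ Kf ω ^ 6 * w ω y f * G s ω a y :=
        mul_nonneg (mul_nonneg (pow_nonneg (K0 ω) _) (w_nonneg _ _ _)) (G_nonneg h0 h1 _ _ _)
      have t1 : (0 : ℝ) ≤ if y = x then 1 else 0 := by split <;> norm_num
      nlinarith [mul_nonneg t0 t1]
    have I' : (B + (cntAt y (6 • M) : ℕ)) * ∫ ω, Kf ω ^ 6 * w ω y f * G s ω a x ∂ℙ +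
      ∫ ω, Kf ω ^ 6 * w ω y f * (G s ω a y * (G s ω y x - if y = x then 1 else 0)) ∂ℙ =
      (β f + ((0 : ℕ) : ℝ)) * ∫ ω, Kf ω ^ 6 * G s ω a x ∂ℙ +
      ∫ ω, Kf ω ^ 6 * w ω y f * (G s ω a y * (s * G s ω (y + dir d f) x)) ∂ℙ := I
    simp only [Nat.cast_zero, add_zero] at I'
    simp only
    linarith
  have hsum := Finset.sum_le_sum hedge
  rw [← Finset.sum_mul, Finset.sum_add_distrib, ← Finset.mul_sum] at hsum
  have bT : ∀ e ∈ E, Bd (fun ω => Kf ω ^ 6 * (w ω e.1 e.2 * (G s ω a e.1 *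
      (G s ω e.1 x - s * G s ω (e.1 + dir d e.2) x)))) := fun e _ =>
    (bK.pow 6).mul ((bd_w _ _).mul ((bd_G h0 h1 _ _).mul ((bd_G h0 h1 _ x).sub ((bd_G h0 h1 _ x).cmul s))))
  rw [← E_sum E bT] at hsum
  have bW : ∀ e ∈ E, Bd (fun ω => Kf ω ^ 3 * w ω e.1 e.2 * G s ω a x) := fun e _ =>
    ((bK.pow 3).mul (bd_w _ _)).mul (bd_G h0 h1 _ _)
  have hQ : ∫ ω, ∑ e ∈ E, Kf ω ^ 6 * (w ω e.1 e.2 * (G s ω a e.1 *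
      (G s ω e.1 x - s * G s ω (e.1 + dir d e.2) x))) ∂ℙ ≤
      ∫ ω, Kf ω ^ 6 * G s ω a x + C2 * ∑ e ∈ E, Kf ω ^ 3 * w ω e.1 e.2 * G s ω a x ∂ℙ := by
    apply E_mono (Bd.sum E bT) (((bK.pow 6).mul (bd_G h0 h1 _ _)).add ((Bd.sum E bW).cmul C2))
    intro ω
    have gd := hcl.good hs h1 ω a
    have q := Q4 h0 h1 ω a x E (Kf ω) (2 ^ n) gd.K0 gd.K1 gd.C1
      (fun e he => gd.B h0 h1 e.1 (hE e he).1 e.2) (fun e he z => gd.A3 e.1 (hE e he).1 z)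
    have q' := mul_le_mul_of_nonneg_left q (pow_nonneg (K0 ω) 3)
    rw [← Finset.mul_sum]
    calc _ = Kf ω ^ 3 * (Kf ω ^ 3 * ∑ e ∈ E, w ω e.1 e.2 * (G s ω a e.1 *
      (G s ω e.1 x - s * G s ω (e.1 + dir d e.2) x))) := by ring
      _ ≤ _ := q'
      _ = _ := by
        have : ∑ e ∈ E, Kf ω ^ 3 * w ω e.1 e.2 * G s ω a x =
            Kf ω ^ 3 * (∑ e ∈ E, w ω e.1 e.2) * G s ω a x := by
          rw [Finset.mul_sum, Finset.sum_mul]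
        rw [this]; ring
  rw [E_add ((bK.pow 6).mul (bd_G h0 h1 _ _)) ((Bd.sum E bW).cmul C2), E_cmul, E_sum E bW] at hQ
  nlinarith



/-- height -/
def lev {d : ℕ} (x : V d) : ℤ := ∑ j : Fin d, if (j : ℕ) = 0 then x j else 0

lemma lev_add {d : ℕ} (x y : V d) : lev (x + y) = lev x + lev y := by
  unfold lev
  rw [← Finset.sum_add_distrib]
  refine Finset.sum_congr rfl fun j _ => ?_
  split <;> simp

lemma lev_zero {d : ℕ} : lev (0 : V d) = 0 := by simp [lev]

lemma lev_eq {d : ℕ} (hd : 0 < d) (x : V d) : lev x = x ⟨0, hd⟩ := by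
  unfold lev
  rw [Finset.sum_eq_single (⟨0, hd⟩ : Fin d)]
  · simp
  · intro b _ hb
    rw [if_neg]
    intro h; exact hb (Fin.ext h)
  · simp

lemma lev_dir {d : ℕ} (hd : 0 < d) (f : Fin (2 * d)) :
    lev (dir d f) = if (f : ℕ) = 0 then 1 else if (f : ℕ) = d then -1 else 0 := by
  rw [lev_eq hd]
  have := f.isLt
  simp only [dir]
  by_cases h0 : (f : ℕ) = 0
  · simp [h0, hd]
  · by_cases h1 : (f : ℕ) = d
    · simp [h1, hd.ne']
    · rw [if_neg (by omega), if_neg h0, if_neg h1]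

lemma lat_opp {d : ℕ} {f : Fin (2 * d)} (h : Lat f) : Lat (opp f) := by
  have := f.isLt
  obtain ⟨h0, h1⟩ := h
  refine ⟨?_, ?_⟩ <;> simp only [opp] <;> split <;> omega

/-- quantitative assumptions on the weights -/
structure Par {d : ℕ} (β : Fin (2 * d) → ℝ) (B βm lam : ℝ) : Prop where
  pos : ∀ i, 0 < β i
  sum : ∑ i, β i ≤ B
  min : ∀ i : Fin (2 * d), (i : ℕ) ≠ d → βm ≤ β i
  lat : 1 + lam ≤ ∑ i with Lat i, β i

lemma exists_exit {d : ℕ} (Y : Finset (V d)) (hY : Y.Nonempty) (f : Fin (2 * d)) :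
    ∃ y ∈ Y, y + dir d f ∉ Y := by
  obtain ⟨y, hy, hmax⟩ := Finset.exists_max_image Y (fun y => ∑ j, y j * dir d f j) hY
  refine ⟨y, hy, fun hz => ?_⟩
  have h := hmax _ hz
  simp only [Pi.add_apply, add_mul, Finset.sum_add_distrib] at h
  have hn : ∀ j ∈ Finset.univ, 0 ≤ dir d f j * dir d f j := fun j _ => mul_self_nonneg _
  have h' : ∑ j, dir d f j * dir d f j = 0 :=
    le_antisymm (by linarith) (Finset.sum_nonneg hn)
  rw [Finset.sum_eq_zero_iff_of_nonneg hn] at h'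
  apply dir_ne f
  ext j
  simpa using h' j (Finset.mem_univ j)

lemma six_pow (t c : ℝ) (ht : 0 ≤ t) (hc : 0 ≤ c) : 6 * c ^ 5 * t - 5 * c ^ 6 ≤ t ^ 6 := by
  have : 0 ≤ (t - c) ^ 2 * (t ^ 4 + 2 * c * t ^ 3 + 3 * c ^ 2 * t ^ 2 + 4 * c ^ 3 * t + 5 * c ^ 4) := by
    positivity
  nlinarith

lemma sixth {d : ℕ} {ℙ : Measure (Env d)} [IsProbabilityMeasure ℙ] {K h : Env d → ℝ} (bK : Bd K) (bh : Bd h)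
    (K0 : ∀ ω, 0 ≤ K ω) (hh : ∀ ω, 0 ≤ h ω) {c : ℝ} (hc : 0 ≤ c)
    (H : c * ∫ ω, h ω ∂ℙ ≤ ∫ ω, K ω * h ω ∂ℙ) : c ^ 6 * ∫ ω, h ω ∂ℙ ≤ ∫ ω, K ω ^ 6 * h ω ∂ℙ := by
  have t : ∫ ω, (6 * c ^ 5) * (K ω * h ω) - (5 * c ^ 6) * h ω ∂ℙ ≤ ∫ ω, K ω ^ 6 * h ω ∂ℙ := by
    apply E_mono (((bK.mul bh).cmul _).sub (bh.cmul _)) ((bK.pow 6).mul bh)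
    intro ω
    have := mul_le_mul_of_nonneg_right (six_pow (K ω) c (K0 ω) hc) (hh ω)
    nlinarith
  rw [E_sub ((bK.mul bh).cmul _) (bh.cmul _), E_cmul, E_cmul] at t
  have := mul_le_mul_of_nonneg_left H (show 0 ≤ 6 * c ^ 5 by positivity)
  nlinarith

lemma returnE {d : ℕ} {β : Fin (2 * d) → ℝ} {ℙ : Measure (Env d)} (hM : Mom d β ℙ)
    {s : ℝ} (hs : 1 / 2 ≤ s) (h1 : s < 1) (a x : V d) {n Y M} (hcl : Cl x n Y M)
    {B βm lam : ℝ} (hP : Par β B βm lam) (hβm : 0 < βm) (y : V d) (f : Fin (2 * d)) (hy : y ∈ Y) (hf : Lat f)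
    (hz : y + dir d f ∉ Y) :
    βm * ∫ ω, mon M ω ^ 3 * w ω y f * G s ω a x ∂ℙ ≤
      B * ((2 ^ n) ^ 2) * ∫ ω, mon ((y, f) ::ₘ (y + dir d f, opp f) ::ₘ M) ω * G s ω a x ∂ℙ := by
  have := hM.prob
  have h0 : 0 ≤ s := by linarith
  set z := y + dir d f with hzd
  have hzy : z ≠ y := fun h => hz (h ▸ hy)
  set M' : Multiset (Edge d) := (y, f) ::ₘ (2 • M) with hM'
  have hmem : ∀ e ∈ M', e.1 ∈ Y := by
    intro e he
    rcases Multiset.mem_cons.1 he with rfl | he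
    · exact hy
    · exact (hcl.edges e (Multiset.mem_of_mem_nsmul he)).1
  have I := ibp_G hM h0 h1 a y z (opp f) M'
  have c1 : cntAt z M' = 0 := by
    unfold cntAt
    rw [Multiset.countP_eq_zero]
    intro e he h
    exact hz (h ▸ hmem e he)
  rw [c1, if_neg hzy, opp_add] at I
  simp only [Nat.cast_zero, add_zero, sub_zero] at I
  have F0 : ∀ ω, 0 ≤ mon M' ω := mon_nonneg M'
  have bF := bd_mon M'
  have bv := bd_w (d := d) z (opp f)
  have bGy := bd_G h0 h1 a y
  have bGz := bd_G h0 h1 a z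
  have i1 : ∫ ω, mon M' ω * w ω z (opp f) * (G s ω a z * G s ω z y) ∂ℙ ≤
      ∫ ω, mon M' ω * w ω z (opp f) * (G s ω a z * (s * G s ω y y)) ∂ℙ := by
    apply E_mono ((bF.mul bv).mul (bGz.mul (bd_G h0 h1 z y))) ((bF.mul bv).mul (bGz.mul ((bd_G h0 h1 y y).cmul s)))
    intro ω
    refine mul_le_mul_of_nonneg_left ?_ (mul_nonneg (F0 ω) (w_nonneg _ _ _))
    exact mul_le_mul_of_nonneg_left (G_le_s_diag h0 h1 ω z y hzy) (G_nonneg h0 h1 _ _ _)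
  have hp1 : 0 ≤ ∫ ω, mon M' ω * G s ω a y ∂ℙ := integral_nonneg fun ω => mul_nonneg (F0 ω) (G_nonneg h0 h1 _ _ _)
  have hp2 : 0 ≤ ∫ ω, mon M' ω * w ω z (opp f) * G s ω a y ∂ℙ :=
    integral_nonneg fun ω => mul_nonneg (mul_nonneg (F0 ω) (w_nonneg _ _ _)) (G_nonneg h0 h1 _ _ _)
  have i2 : βm * ∫ ω, mon M' ω * G s ω a y ∂ℙ ≤ B * ∫ ω, mon M' ω * w ω z (opp f) * G s ω a y ∂ℙ := by
    have e1 : βm * ∫ ω, mon M' ω * G s ω a y ∂ℙ ≤ (β (opp f) + (M'.count (z, opp f) : ℕ)) * ∫ ω, mon M' ω * G s ω a y ∂ℙ := by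
      apply mul_le_mul_of_nonneg_right _ hp1
      have := hP.min (opp f) (lat_opp hf).2
      have : (0 : ℝ) ≤ (M'.count (z, opp f) : ℕ) := Nat.cast_nonneg _
      linarith
    have e2 := mul_le_mul_of_nonneg_right hP.sum hp2
    linarith
  have gd := fun ω => hcl.good hs h1 ω a
  have bh := bd_G h0 h1 a x
  have i3 : ∫ ω, mon M ω ^ 3 * w ω y f * G s ω a x ∂ℙ ≤ ∫ ω, (2 ^ n) * (mon M' ω * G s ω a y) ∂ℙ := by
    apply E_mono ((((bd_mon M).pow 3).mul (bd_w y f)).mul bh) ((bF.mul bGy).cmul _)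
    intro ω
    simp only [hM', mon_cons, mon_nsmul]
    have := mul_le_mul_of_nonneg_left ((gd ω).A1 y hy) (mul_nonneg (pow_nonneg (gd ω).K0 2) (w_nonneg ω y f))
    linarith
  have i4 : ∫ ω, mon M' ω * w ω z (opp f) * G s ω a y ∂ℙ ≤
      ∫ ω, (2 ^ n) * (mon ((y, f) ::ₘ (z, opp f) ::ₘ M) ω * G s ω a x) ∂ℙ := by
    apply E_mono ((bF.mul bv).mul bGy) (((bd_mon _).mul bh).cmul _)
    intro ω
    simp only [hM', mon_cons, mon_nsmul]
    have := mul_le_mul_of_nonneg_left ((gd ω).A4 y hy) (mul_nonneg (gd ω).K0 (mul_nonneg (w_nonneg ω y f) (w_nonneg ω z (opp f))))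
    linarith
  rw [E_cmul] at i3 i4
  have hB : 0 ≤ B := le_trans (Finset.sum_nonneg fun i _ => (hP.pos i).le) hP.sum
  have j3 := mul_le_mul_of_nonneg_left i3 hβm.le
  have j2 := mul_le_mul_of_nonneg_left i2 (show (0 : ℝ) ≤ 2 ^ n by positivity)
  have j4 := mul_le_mul_of_nonneg_left i4 (mul_nonneg hB (show (0 : ℝ) ≤ 2 ^ n by positivity))
  calc _ ≤ _ := j3
    _ = 2 ^ n * (βm * ∫ ω, mon M' ω * G s ω a y ∂ℙ) := by ring
    _ ≤ _ := j2
    _ = B * 2 ^ n * ∫ ω, mon M' ω * w ω z (opp f) * G s ω a y ∂ℙ := by ring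
    _ ≤ _ := j4
    _ = _ := by ring

lemma grow (d : ℕ) (hd : 0 < d) {B βm lam : ℝ} (hB : 0 < B) (hβm : 0 < βm) (hlam : 0 < lam) (n : ℕ) :
    ∃ c : ℝ, 0 < c ∧ ∀ (β : Fin (2 * d) → ℝ) (ℙ : Measure (Env d)), Mom d β ℙ → Par β B βm lam →
      ∀ s : ℝ, 1 / 2 ≤ s → s < 1 → ∀ a x : V d, ∃ Y M, Cl x n Y M ∧
        c * ∫ ω, G s ω a x ∂ℙ ≤ ∫ ω, mon M ω * G s ω a x ∂ℙ := by
  induction n with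
  | zero =>
    refine ⟨1, one_pos, fun β ℙ hM hP s hs h1 a x => ⟨_, _, Cl.base, ?_⟩⟩
    simp
  | succ n ih =>
    obtain ⟨c, hc, ih⟩ := ih
    have hd' : (0 : ℝ) < d := by exact_mod_cast hd
    set A0 : ℝ := B + 12 * n + (2 * (2 * d) * (2 ^ n) ^ 3 + 2 ^ n) with hA0
    have hA0p : 0 < A0 := by positivity
    set q : ℝ := lam * c ^ 6 / (A0 * (2 * d)) with hq
    have hqp : 0 < q := by positivity
    refine ⟨βm * q / (B * (2 ^ n) ^ 2), by positivity, fun β ℙ hM hP s hs h1 a x => ?_⟩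
    have := hM.prob
    have h0 : 0 ≤ s := by linarith
    obtain ⟨Y, M, hcl, H⟩ := ih β ℙ hM hP s hs h1 a x
    have bh := bd_G h0 h1 a x
    have hEh : 0 ≤ ∫ ω, G s ω a x ∂ℙ := integral_nonneg fun ω => G_nonneg h0 h1 _ _ _
    have H6 := sixth (bd_mon M) bh (mon_nonneg M) (fun ω => G_nonneg h0 h1 _ _ _) hc.le H
    choose yf hyf hyf' using exists_exit Y ⟨x, hcl.root⟩
    set E : Finset (Edge d) := (Finset.univ.filter (fun f : Fin (2 * d) => Lat f)).image (fun f => (yf f, f)) with hE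
    have hEsum : ∑ e ∈ E, β e.2 = ∑ i with Lat i, β i := by
      rw [hE, Finset.sum_image]
      intro f _ f' _ h
      exact congrArg Prod.snd h
    have hEcard : E.card ≤ 2 * d := by
      calc E.card ≤ _ := Finset.card_image_le
        _ ≤ _ := Finset.card_filter_le _ _
        _ = 2 * d := by simp
    have hEprop : ∀ e ∈ E, e.1 ∈ Y ∧ e.1 + dir d e.2 ∉ Y ∧ Lat e.2 := by
      intro e he
      rw [hE, Finset.mem_image] at he
      obtain ⟨f, hf, rfl⟩ := he
      exact ⟨hyf f, hyf' f, (Finset.mem_filter.1 hf).2⟩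
    have ex := exit_est hM hP.pos hs h1 a x hcl E (fun e he => ⟨(hEprop e he).1, (hEprop e he).2.1⟩)
    rw [hEsum] at ex
    have hterm : ∀ e ∈ E, 0 ≤ ∫ ω, mon M ω ^ 3 * w ω e.1 e.2 * G s ω a x ∂ℙ := fun e _ =>
      integral_nonneg fun ω => mul_nonneg (mul_nonneg (pow_nonneg (mon_nonneg _ _) _) (w_nonneg _ _ _)) (G_nonneg h0 h1 _ _ _)
    have hs0 := Finset.sum_nonneg hterm
    have hEne : E.Nonempty := by
      rw [Finset.nonempty_iff_ne_empty]
      intro h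
      have := hP.lat
      rw [← hEsum, h] at this
      simp at this; linarith
    have hA : (∑ i, β i + 12 * n + (2 * E.card * (2 ^ n) ^ 3 + 2 ^ n)) ≤ A0 := by
      have e1 : (E.card : ℝ) ≤ 2 * d := by exact_mod_cast hEcard
      have := hP.sum
      rw [hA0]; gcongr
    have ex1 := ex.trans (mul_le_mul_of_nonneg_right hA hs0)
    have ex2 : lam * (c ^ 6 * ∫ ω, G s ω a x ∂ℙ) ≤ (∑ i with Lat i, β i - 1) * ∫ ω, mon M ω ^ 6 * G s ω a x ∂ℙ := by
      apply mul_le_mul _ H6 (by positivity)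
      · have := hP.lat; linarith
      · have := hP.lat; linarith
    have ex3 := ex2.trans ex1
    have hconst : ∑ e ∈ E, q * ∫ ω, G s ω a x ∂ℙ ≤ ∑ e ∈ E, ∫ ω, mon M ω ^ 3 * w ω e.1 e.2 * G s ω a x ∂ℙ := by
      rw [Finset.sum_const, nsmul_eq_mul]
      have e1 : (E.card : ℝ) ≤ 2 * d := by exact_mod_cast hEcard
      have e2 : (E.card : ℝ) * (q * ∫ ω, G s ω a x ∂ℙ) ≤ 2 * d * (q * ∫ ω, G s ω a x ∂ℙ) :=
        mul_le_mul_of_nonneg_right e1 (mul_nonneg hqp.le hEh)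
      refine e2.trans ?_
      have e3 : 2 * d * (q * ∫ ω, G s ω a x ∂ℙ) = (lam * (c ^ 6 * ∫ ω, G s ω a x ∂ℙ)) / A0 := by
        rw [hq]; field_simp
      rw [e3, div_le_iff₀ hA0p]
      linarith
    obtain ⟨e, he, hge⟩ := Finset.exists_le_of_sum_le hEne hconst
    obtain ⟨p1, p2, p3⟩ := hEprop e he
    obtain ⟨y, f⟩ := e
    refine ⟨_, _, Cl.step n Y M y f hcl p1 p3 p2, ?_⟩
    have r := returnE hM hs h1 a x hcl hP hβm y f p1 p3 p2
    have r2 := (mul_le_mul_of_nonneg_left hge hβm.le).trans r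
    have hpos : 0 < B * (2 ^ n) ^ 2 := by positivity
    rw [div_mul_eq_mul_div, div_le_iff₀ hpos]
    linarith

/-- lateral balls -/
noncomputable def lball (d : ℕ) : ℕ → Finset (V d)
  | 0 => {0}
  | n + 1 => lball d n ∪ (lball d n ×ˢ (Finset.univ.filter (fun f : Fin (2 * d) => Lat f))).image
      (fun q => q.1 + dir d q.2)

lemma lball_lev {d : ℕ} (hd : 0 < d) (n : ℕ) : ∀ v ∈ lball d n, lev v = 0 := by
  induction n with
  | zero => simp [lball, lev_zero]
  | succ n ih =>
    intro v hv
    rw [lball, Finset.mem_union, Finset.mem_image] at hv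
    rcases hv with hv | ⟨⟨v', f⟩, hq, rfl⟩
    · exact ih v hv
    · rw [Finset.mem_product, Finset.mem_filter] at hq
      obtain ⟨h1, -, h2⟩ := hq
      rw [lev_add, ih _ h1, lev_dir hd, if_neg h2.1, if_neg h2.2]; rfl

lemma Cl.ball {d : ℕ} {x : V d} {n Y M} (h : Cl x n Y M) : ∀ y ∈ Y, y - x ∈ lball d n := by
  induction h with
  | base => simp [lball]
  | step n Y M y f _ hy hf hz ih =>
    intro y' hy'
    rw [lball, Finset.mem_union, Finset.mem_image]
    rcases Finset.mem_insert.1 hy' with rfl | hy'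
    · right
      refine ⟨(y - x, f), ?_, ?_⟩
      · rw [Finset.mem_product, Finset.mem_filter]
        exact ⟨ih y hy, Finset.mem_univ _, hf⟩
      · simp only; abel
    · exact Or.inl (ih _ hy')

lemma core (d : ℕ) (hd : 0 < d) {B βm lam : ℝ} (hB : 0 < B) (hβm : 0 < βm) (hlam : 0 < lam)
    (up : Fin (2 * d)) (hup : (up : ℕ) = 0) :
    ∃ C : ℝ, 0 < C ∧ ∃ S : Finset (V d), (∀ v ∈ S, lev v = 0) ∧
      ∀ (β : Fin (2 * d) → ℝ) (ℙ : Measure (Env d)), Mom d β ℙ → Par β B βm lam →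
      ∀ s : ℝ, 1 / 2 ≤ s → s < 1 → ∀ a x : V d,
        ∫ ω, G s ω a x ∂ℙ ≤ C * ∑ v ∈ S, ∫ ω, G s ω a (x + v) * w ω (x + v) up ∂ℙ := by
  obtain ⟨J, hJ⟩ := exists_nat_gt (2 / βm)
  obtain ⟨c, hc, H⟩ := grow d hd hB hβm hlam J
  set A0 : ℝ := B + 12 * J + (2 * (J + 1) * (2 ^ J) ^ 3 + 2 ^ J) with hA0
  have hA0p : 0 < A0 := by positivity
  refine ⟨A0 * 2 ^ J / c ^ 6, by positivity, lball d J, lball_lev hd J, ?_⟩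
  intro β ℙ hM hP s hs h1 a x
  have := hM.prob
  have h0 : 0 ≤ s := by linarith
  obtain ⟨Y, M, hcl, HK⟩ := H β ℙ hM hP s hs h1 a x
  have bh := bd_G h0 h1 a x
  have hEh : 0 ≤ ∫ ω, G s ω a x ∂ℙ := integral_nonneg fun ω => G_nonneg h0 h1 _ _ _
  have H6 := sixth (bd_mon M) bh (mon_nonneg M) (fun ω => G_nonneg h0 h1 _ _ _) hc.le HK
  have hlevY : ∀ y ∈ Y, lev y = lev x := by
    intro y hy
    have := lball_lev hd J _ (hcl.ball y hy)
    have h2 : lev y = lev (y - x) + lev x := by rw [← lev_add]; simp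
    rw [h2, this, zero_add]
  set E : Finset (Edge d) := Y.image (fun y => (y, up)) with hE
  have hinj : Set.InjOn (fun y : V d => ((y, up) : Edge d)) Y := by
    intro y _ y' _ h; exact congrArg Prod.fst h
  have hEp : ∀ e ∈ E, e.1 ∈ Y ∧ e.1 + dir d e.2 ∉ Y := by
    intro e he
    rw [hE, Finset.mem_image] at he
    obtain ⟨y, hy, rfl⟩ := he
    refine ⟨hy, fun h => ?_⟩
    have h1 := hlevY _ h
    rw [lev_add, lev_dir hd, if_pos hup, hlevY y hy] at h1
    omega
  have ex := exit_est hM hP.pos hs h1 a x hcl E hEp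
  have hcard : E.card = J + 1 := by rw [hE, Finset.card_image_of_injOn hinj, hcl.card]
  have hsumβ : ∑ e ∈ E, β e.2 = (J + 1) * β up := by
    rw [hE, Finset.sum_image hinj]; simp [hcl.card]
  rw [hsumβ, hcard, hE, Finset.sum_image hinj] at ex
  have hup' := hP.min up (by omega)
  have hfac : 1 ≤ (J + 1) * β up - 1 := by
    rw [div_lt_iff₀ hβm] at hJ
    have : (J : ℝ) * βm ≤ J * β up := mul_le_mul_of_nonneg_left hup' (Nat.cast_nonneg _)
    nlinarith
  have hK6 : 0 ≤ ∫ ω, mon M ω ^ 6 * G s ω a x ∂ℙ :=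
    integral_nonneg fun ω => mul_nonneg (pow_nonneg (mon_nonneg _ _) _) (G_nonneg h0 h1 _ _ _)
  have hsum : ∑ y ∈ Y, ∫ ω, mon M ω ^ 3 * w ω y up * G s ω a x ∂ℙ ≤
      ∑ v ∈ lball d J, 2 ^ J * ∫ ω, G s ω a (x + v) * w ω (x + v) up ∂ℙ := by
    calc _ ≤ ∑ y ∈ Y, 2 ^ J * ∫ ω, G s ω a y * w ω y up ∂ℙ := by
          refine Finset.sum_le_sum fun y hy => ?_
          rw [← E_cmul]
          apply E_mono ((((bd_mon M).pow 3).mul (bd_w y up)).mul bh) (((bd_G h0 h1 a y).mul (bd_w y up)).cmul _)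
          intro ω
          have gd := hcl.good hs h1 ω a
          have t := mul_le_mul_of_nonneg_left (gd.A1 y hy) (w_nonneg ω y up)
          have k3 : mon M ω ^ 3 ≤ mon M ω := by
            have := pow_le_pow_of_le_one gd.K0 gd.K1 (show 1 ≤ 3 by norm_num)
            simpa using this
          have t2 := mul_le_mul_of_nonneg_right k3 (mul_nonneg (w_nonneg ω y up) (G_nonneg h0 h1 ω a x))
          linarith
      _ = ∑ v ∈ Y.image (fun y => y - x), 2 ^ J * ∫ ω, G s ω a (x + v) * w ω (x + v) up ∂ℙ := by
          rw [Finset.sum_image]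
          · refine Finset.sum_congr rfl fun y _ => ?_
            rw [add_sub_cancel]
          · intro y _ y' _ h; exact sub_left_injective h
      _ ≤ _ := by
          apply Finset.sum_le_sum_of_subset_of_nonneg
          · intro v hv
            rw [Finset.mem_image] at hv
            obtain ⟨y, hy, rfl⟩ := hv
            exact hcl.ball y hy
          · intro v _ _
            exact mul_nonneg (by positivity) (integral_nonneg fun ω => mul_nonneg (G_nonneg h0 h1 _ _ _) (w_nonneg _ _ _))
  have hA : (∑ i, β i + 12 * J + (2 * ((J + 1 : ℕ) : ℝ) * (2 ^ J) ^ 3 + 2 ^ J)) ≤ A0 := by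
    have := hP.sum
    rw [hA0]; push_cast; linarith
  have hsp : 0 ≤ ∑ y ∈ Y, ∫ ω, mon M ω ^ 3 * w ω y up * G s ω a x ∂ℙ := Finset.sum_nonneg fun e _ =>
      integral_nonneg fun ω => mul_nonneg (mul_nonneg (pow_nonneg (mon_nonneg _ _) _) (w_nonneg _ _ _)) (G_nonneg h0 h1 _ _ _)
  have f1 := mul_le_mul_of_nonneg_right hfac hK6
  have f2 := ex.trans (mul_le_mul_of_nonneg_right hA hsp)
  have f3 := mul_le_mul_of_nonneg_left hsum hA0p.le
  rw [← Finset.mul_sum] at f3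
  rw [div_mul_eq_mul_div, le_div_iff₀ (by positivity)]
  linarith

lemma Kminus {d : ℕ} {β : Fin (2 * d) → ℝ} {ℙ : Measure (Env d)} (hM : Mom d β ℙ)
    {s : ℝ} (h0 : 0 ≤ s) (h1 : s < 1) (a x : V d) (f : Fin (2 * d)) :
    (∑ i, β i - 1) * ∫ ω, G s ω a x * w ω x f ∂ℙ ≤ β f * ∫ ω, G s ω a x ∂ℙ := by
  have := hM.prob
  have I := ibp_G hM h0 h1 a x x f 0
  simp only [mon_zero, one_mul, Multiset.count_zero, Nat.cast_zero, add_zero, if_true] at I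
  have c0 : cntAt x (0 : Multiset (Edge d)) = 0 := by simp [cntAt]
  rw [c0] at I
  have bw := bd_w (d := d) x f
  have bh := bd_G h0 h1 a x
  have bd1 := bd_G h0 h1 x x
  have bd2 := bd_G h0 h1 (x + dir d f) x
  have i1 : ∫ ω, w ω x f * (G s ω a x * (s * G s ω (x + dir d f) x)) ∂ℙ ≤
      ∫ ω, w ω x f * (G s ω a x * (G s ω x x - 1)) + G s ω a x * w ω x f ∂ℙ := by
    apply E_mono (bw.mul (bh.mul (bd2.cmul s))) ((bw.mul (bh.mul (bd1.sub (Bd.const 1)))).add (bh.mul bw))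
    intro ω
    have g1 := G_le_diag h0 h1 ω (x + dir d f) x
    have g0 := G_nonneg h0 h1 ω (x + dir d f) x
    have g2 : s * G s ω (x + dir d f) x ≤ G s ω x x := by nlinarith
    have := mul_le_mul_of_nonneg_left g2 (mul_nonneg (w_nonneg ω x f) (G_nonneg h0 h1 ω a x))
    linarith
  rw [E_add (bw.mul (bh.mul (bd1.sub (Bd.const 1)))) (bh.mul bw)] at i1
  have e : ∫ ω, w ω x f * G s ω a x ∂ℙ = ∫ ω, G s ω a x * w ω x f ∂ℙ := by
    congr 1; ext ω; ring
  rw [e] at I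
  simp only [Nat.cast_zero, add_zero] at I
  linarith



/-- cylinders -/
def cyl {d : ℕ} (n : ℕ) (σ : Traj d) : Set (Traj d) := {f | ∀ k ≤ n, f k = σ k}

lemma mem_cyl {d : ℕ} {n : ℕ} {σ f : Traj d} : f ∈ cyl n σ ↔ ∀ k ≤ n, f k = σ k := Iff.rfl

/-- extension of a finite initial segment -/
def pext {d : ℕ} {n : ℕ} (g : Fin (n + 1) → V d) : Traj d := fun k => if h : k < n + 1 then g ⟨k, h⟩ else 0

lemma pext_apply {d : ℕ} {n : ℕ} (g : Fin (n + 1) → V d) (k : ℕ) (h : k ≤ n) :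
    pext g k = g ⟨k, Nat.lt_succ_of_le h⟩ := by
  unfold pext; rw [dif_pos (Nat.lt_succ_of_le h)]

lemma measurableSet_coord {d : ℕ} (n : ℕ) (A : Set (V d)) : MeasurableSet {f : Traj d | f n ∈ A} :=
  measurable_pi_apply n (MeasurableSet.of_discrete (s := A))

lemma measurableSet_cyl {d : ℕ} (n : ℕ) (σ : Traj d) : MeasurableSet (cyl n σ) := by
  have : cyl n σ = ⋂ k ∈ Finset.range (n + 1), {f : Traj d | f k ∈ ({σ k} : Set (V d))} := by
    ext f
    simp only [mem_cyl, Finset.mem_range, Set.mem_iInter, Set.mem_singleton_iff, Set.mem_ofPred_eq,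
      Nat.lt_succ_iff]
  rw [this]
  exact Finset.measurableSet_biInter _ fun k _ => measurableSet_coord k _

/-- depends on the first `n` steps only -/
def Dep {d : ℕ} (n : ℕ) (Γ : Set (Traj d)) : Prop := ∀ f g : Traj d, (∀ k ≤ n, f k = g k) → f ∈ Γ → g ∈ Γ

lemma dep_union {d : ℕ} {n : ℕ} {Γ : Set (Traj d)} (h : Dep n Γ) :
    Γ = ⋃ g : {g : Fin (n + 1) → V d // pext g ∈ Γ}, cyl n (pext g.1) := by
  ext f
  rw [Set.mem_iUnion]
  constructor
  · intro hf
    have : ∀ k ≤ n, f k = pext (fun i : Fin (n + 1) => f i) k := fun k hk => by rw [pext_apply _ _ hk]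
    exact ⟨⟨fun i => f i, h f _ this hf⟩, this⟩
  · rintro ⟨⟨g, hg⟩, hf⟩
    exact h _ f (fun k hk => (hf k hk).symm) hg

lemma Dep.measurable {d : ℕ} {n : ℕ} {Γ : Set (Traj d)} (h : Dep n Γ) : MeasurableSet Γ := by
  rw [dep_union h]
  exact MeasurableSet.iUnion fun g => measurableSet_cyl _ _

lemma cyl_disj {d : ℕ} {n : ℕ} (g g' : Fin (n + 1) → V d) (h : g ≠ g') :
    Disjoint (cyl n (pext g)) (cyl n (pext g')) := by
  rw [Set.disjoint_left]
  intro f h1 h2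
  apply h
  ext1 i
  have hi : (i : ℕ) ≤ n := Nat.lt_succ_iff.1 i.isLt
  have := (h1 i hi).symm.trans (h2 i hi)
  rwa [pext_apply _ _ hi, pext_apply _ _ hi] at this

lemma dep_measure {d : ℕ} (μ : Measure (Traj d)) {n : ℕ} {Γ : Set (Traj d)} (h : Dep n Γ)
    {A : Set (Traj d)} (hA : MeasurableSet A) :
    μ (Γ ∩ A) = ∑' g : {g : Fin (n + 1) → V d // pext g ∈ Γ}, μ (cyl n (pext g.1) ∩ A) := by
  conv_lhs => rw [dep_union h, Set.iUnion_inter]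
  rw [measure_iUnion]
  · intro g g' hgg
    exact ((cyl_disj g.1 g'.1 (fun hh => hgg (Subtype.ext hh))).mono Set.inter_subset_left Set.inter_subset_left)
  · intro g; exact (measurableSet_cyl _ _).inter hA

lemma dep_measure' {d : ℕ} (μ : Measure (Traj d)) {n : ℕ} {Γ : Set (Traj d)} (h : Dep n Γ) :
    μ Γ = ∑' g : {g : Fin (n + 1) → V d // pext g ∈ Γ}, μ (cyl n (pext g.1)) := by
  have := dep_measure μ h MeasurableSet.univ
  simpa using this

/-- The class of all cylinders -/
def cyls (d : ℕ) : Set (Set (Traj d)) := {A | ∃ n σ, A = cyl n σ}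

lemma cyls_pi (d : ℕ) : IsPiSystem (cyls d) := by
  rintro _ ⟨n, σ, rfl⟩ _ ⟨m, τ, rfl⟩ ⟨f, hf1, hf2⟩
  refine ⟨max n m, f, ?_⟩
  ext g
  constructor
  · rintro ⟨h1, h2⟩ k hk
    rcases le_max_iff.1 hk with hk | hk
    · rw [h1 k hk, hf1 k hk]
    · rw [h2 k hk, hf2 k hk]
  · intro h
    exact ⟨fun k hk => (h k (hk.trans (le_max_left _ _))).trans (hf1 k hk),
      fun k hk => (h k (hk.trans (le_max_right _ _))).trans (hf2 k hk)⟩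

lemma dep_coord {d : ℕ} (n m : ℕ) (h : m ≤ n) (A : Set (V d)) : Dep n {f : Traj d | f m ∈ A} := by
  intro f g hfg hf
  have hf' : f m ∈ A := hf
  rw [hfg m h] at hf'
  exact hf'

lemma cyls_gen (d : ℕ) : (inferInstance : MeasurableSpace (Traj d)) = MeasurableSpace.generateFrom (cyls d) := by
  apply le_antisymm
  · refine iSup_le fun n => ?_
    rintro _ ⟨A, -, rfl⟩
    have h : Dep n ((fun f : Traj d => f n) ⁻¹' A) := dep_coord n n le_rfl A
    rw [dep_union h]
    refine MeasurableSet.iUnion fun g => ?_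
    exact MeasurableSpace.measurableSet_generateFrom ⟨_, _, rfl⟩
  · apply MeasurableSpace.generateFrom_le
    rintro _ ⟨n, σ, rfl⟩
    exact measurableSet_cyl n σ

lemma dir_inj {d : ℕ} {i j : Fin (2 * d)} (h : dir d i = dir d j) : i = j := by
  have hi := i.isLt
  have hj := j.isLt
  have h1 := congrFun h ⟨if (i : ℕ) < d then i else i - d, by split <;> omega⟩
  apply Fin.ext
  simp only [dir] at h1
  split_ifs at h1 <;> omega

lemma trans_nonneg {d : ℕ} (ω : Env d) (y z : V d) : 0 ≤ trans d ω y z :=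
  Finset.sum_nonneg fun i _ => by
    split
    · exact w_nonneg ω y i
    · exact le_rfl

lemma trans_dir {d : ℕ} (ω : Env d) (y : V d) (i : Fin (2 * d)) : trans d ω y (y + dir d i) = w ω y i := by
  unfold trans
  rw [Finset.sum_eq_single i]
  · simp
  · intro j _ hj
    rw [if_neg]
    intro h
    exact hj (dir_inj (add_left_cancel h)).symm
  · simp

lemma trans_zero {d : ℕ} (ω : Env d) (y z : V d) (h : ∀ i, z ≠ y + dir d i) : trans d ω y z = 0 := by
  unfold trans
  exact Finset.sum_eq_zero fun i _ => if_neg (h i)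

lemma measurable_trans {d : ℕ} (y z : V d) : Measurable (fun ω : Env d => trans d ω y z) := by
  unfold trans
  refine Finset.measurable_sum _ fun i _ => ?_
  split
  · exact measurable_w y i
  · exact measurable_const

lemma trans_le_one {d : ℕ} (ω : Env d) (y z : V d) : trans d ω y z ≤ 1 := by
  by_cases h : ∃ i, z = y + dir d i
  · obtain ⟨i, rfl⟩ := h
    rw [trans_dir]; exact w_le_one _ _ _
  · push Not at h
    rw [trans_zero ω y z h]; exact zero_le_one

section quenched
variable {d : ℕ} {Pq : Env d → V d → Measure (Traj d)} (hq : IsQuenchedLaw d Pq)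
include hq

lemma q_cyl (ω : Env d) (x : V d) (n : ℕ) (σ : Traj d) :
    Pq ω x (cyl n σ) = ENNReal.ofReal ((if σ 0 = x then 1 else 0) *
      ∏ k ∈ Finset.range n, trans d ω (σ k) (σ (k + 1))) := by
  have := hq.1 ω x
  rw [← hq.2 ω x n σ]
  exact (ENNReal.ofReal_toReal (measure_ne_top _ _)).symm

lemma q_meas (x : V d) : Measurable (fun ω => Pq ω x) := by
  have := fun ω => hq.1 ω x
  refine Measurable.measure_of_isPiSystem_of_isProbabilityMeasure (cyls_gen d) (cyls_pi d) ?_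
  rintro _ ⟨n, σ, rfl⟩
  simp_rw [q_cyl hq]
  exact ((Finset.measurable_fun_prod _ fun k _ => measurable_trans _ _).const_mul _).ennreal_ofReal

lemma ann_apply (ℙ : Measure (Env d)) (x : V d) {A : Set (Traj d)} (hA : MeasurableSet A) :
    annealed d ℙ Pq x A = ∫⁻ ω, Pq ω x A ∂ℙ :=
  Measure.bind_apply hA (q_meas hq x).aemeasurable

lemma ann_prob (ℙ : Measure (Env d)) [IsProbabilityMeasure ℙ] (x : V d) : IsProbabilityMeasure (annealed d ℙ Pq x) := by
  have := fun ω => hq.1 ω x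
  refine ⟨?_⟩
  rw [ann_apply hq ℙ x MeasurableSet.univ]
  simp

lemma q_step (ω : Env d) (n : ℕ) (y z : V d) :
    Pq ω 0 {f | f n = y ∧ f (n + 1) = z} = Pq ω 0 {f | f n = y} * ENNReal.ofReal (trans d ω y z) := by
  have hd : Dep n {f : Traj d | f n = y} := dep_coord n n le_rfl {y}
  have e1 : {f : Traj d | f n = y ∧ f (n + 1) = z} = {f : Traj d | f n = y} ∩ {f | f (n + 1) ∈ ({z} : Set (V d))} := by
    ext f; simp
  rw [e1, dep_measure _ hd (measurableSet_coord _ _), dep_measure' _ hd, ← ENNReal.tsum_mul_right]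
  congr 1
  ext g
  obtain ⟨g, hg⟩ := g
  have hg' : pext g n = y := hg
  have e2 : cyl n (pext g) ∩ {f | f (n + 1) ∈ ({z} : Set (V d))} =
      cyl (n + 1) (fun k => if k ≤ n then pext g k else z) := by
    ext f
    simp only [Set.mem_inter_iff, mem_cyl, Set.mem_singleton_iff, Set.mem_ofPred_eq]
    constructor
    · rintro ⟨h1, h2⟩ k hk
      rcases Nat.lt_or_ge n k with h | h
      · have : k = n + 1 := by omega
        subst this
        rw [if_neg (by omega), h2]
      · rw [if_pos h, h1 k h]
    · intro h
      refine ⟨fun k hk => ?_, ?_⟩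
      · have := h k (by omega); rwa [if_pos hk] at this
      · have := h (n + 1) le_rfl; rwa [if_neg (by omega)] at this
  simp only
  rw [e2, q_cyl hq, q_cyl hq, ← ENNReal.ofReal_mul]
  · congr 1
    rw [Finset.prod_range_succ, ← mul_assoc]
    simp only [Nat.zero_le, if_true, le_refl, hg', show ¬ (n + 1 ≤ n) by omega, if_false]
    congr 2
    refine Finset.prod_congr rfl fun k hk => ?_
    rw [Finset.mem_range] at hk
    rw [if_pos hk.le, if_pos (by omega)]
  · exact mul_nonneg (by split <;> norm_num) (Finset.prod_nonneg fun k _ => trans_nonneg _ _ _)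

lemma q_zero (ω : Env d) (y : V d) : Pq ω 0 {f | f 0 = y} = ENNReal.ofReal (p ω 0 0 y) := by
  have : {f : Traj d | f 0 = y} = cyl 0 (fun _ => y) := by
    ext f; simp [mem_cyl]
  rw [this, q_cyl hq]
  simp [p_zero, eq_comm]

lemma q_nn (ω : Env d) : ∀ᵐ f ∂(Pq ω 0), f 0 = 0 ∧ ∀ n, ∃ i, f (n + 1) = f n + dir d i := by
  have := hq.1 ω 0
  refine Filter.Eventually.and ?_ (ae_all_iff.2 fun n => ?_)
  · rw [ae_iff]
    have : {f : Traj d | ¬ f 0 = 0} = {f : Traj d | f 0 = 0}ᶜ := rfl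
    rw [this, prob_compl_eq_zero_iff (show MeasurableSet {f : Traj d | f 0 = 0} from measurableSet_coord 0 {0}), q_zero hq, p_zero]
    simp
  · have key : ∀ y z : V d, (∀ i, z ≠ y + dir d i) → ∀ᵐ f ∂(Pq ω 0), ¬ (f n = y ∧ f (n + 1) = z) := by
      intro y z h
      rw [ae_iff]
      simp only [not_not]
      rw [q_step hq, trans_zero ω y z h]; simp
    have key2 : ∀ᵐ f ∂(Pq ω 0), ∀ y z : V d, (∀ i, z ≠ y + dir d i) → ¬ (f n = y ∧ f (n + 1) = z) := by
      rw [ae_all_iff]; intro y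
      rw [ae_all_iff]; intro z
      by_cases h : ∀ i, z ≠ y + dir d i
      · filter_upwards [key y z h] with f hf _ using hf
      · exact Eventually.of_forall fun f hf => absurd hf h
    filter_upwards [key2] with f hf
    by_contra! hc
    exact hf _ _ hc ⟨rfl, rfl⟩

lemma q_p (ω : Env d) (n : ℕ) (y : V d) : Pq ω 0 {f | f n = y} = ENNReal.ofReal (p ω n 0 y) := by
  induction n generalizing y with
  | zero => exact q_zero hq ω y
  | succ n ih =>
    have e : Pq ω 0 {f | f (n + 1) = y} = Pq ω 0 (⋃ i : Fin (2 * d), {f | f n = y - dir d i ∧ f (n + 1) = y}) := by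
      apply measure_congr
      filter_upwards [q_nn hq ω] with f hf
      apply propext
      constructor
      · intro (h : f (n + 1) = y)
        obtain ⟨i, hi⟩ := hf.2 n
        refine Set.mem_iUnion.2 ⟨i, ?_, h⟩
        rw [← h, hi]; simp
      · intro h
        obtain ⟨i, hi⟩ := Set.mem_iUnion.1 h
        exact hi.2
    rw [e, measure_iUnion]
    · rw [tsum_fintype, p_succ', ENNReal.ofReal_sum_of_nonneg]
      · refine Finset.sum_congr rfl fun i _ => ?_
        rw [q_step hq, ih]
        have : trans d ω (y - dir d i) y = w ω (y - dir d i) i := by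
          conv_lhs => rw [show y = (y - dir d i) + dir d i by simp]
          simp only [add_sub_cancel_right]
          rw [trans_dir]
        rw [this, ENNReal.ofReal_mul (p_nonneg _ _ _ _)]
      · intro i _; exact mul_nonneg (p_nonneg _ _ _ _) (w_nonneg _ _ _)
    · intro i j hij
      rw [Function.onFun, Set.disjoint_left]
      rintro f ⟨h1, -⟩ ⟨h2, -⟩
      apply hij
      apply dir_inj
      have := h1.symm.trans h2
      exact sub_right_injective this
    · intro i
      exact (measurableSet_coord n {y - dir d i}).inter (measurableSet_coord (n + 1) {y})

variable (ℙ : Measure (Env d)) [IsProbabilityMeasure ℙ]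

lemma ann_p (n : ℕ) (y : V d) : annealed d ℙ Pq 0 {f | f n = y} = ENNReal.ofReal (∫ ω, p ω n 0 y ∂ℙ) := by
  rw [ann_apply hq ℙ 0 (show MeasurableSet {f : Traj d | f n = y} from measurableSet_coord n {y})]
  simp_rw [q_p hq]
  rw [ofReal_integral_eq_lintegral_ofReal ((bd_p n 0 y).int ℙ) (ae_of_all _ fun ω => p_nonneg _ _ _ _)]

lemma ann_step (n : ℕ) (y : V d) (i : Fin (2 * d)) :
    annealed d ℙ Pq 0 {f | f n = y ∧ f (n + 1) = y + dir d i} = ENNReal.ofReal (∫ ω, p ω n 0 y * w ω y i ∂ℙ) := by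
  rw [ann_apply hq ℙ 0 (show MeasurableSet {f : Traj d | f n = y ∧ f (n + 1) = y + dir d i} from
    (measurableSet_coord n {y}).inter (measurableSet_coord (n + 1) {y + dir d i}))]
  simp_rw [q_step hq, q_p hq, trans_dir]
  rw [ofReal_integral_eq_lintegral_ofReal (((bd_p n 0 y).mul (bd_w y i)).int ℙ)
    (ae_of_all _ fun ω => mul_nonneg (p_nonneg _ _ _ _) (w_nonneg _ _ _))]
  congr 1; ext ω
  rw [ENNReal.ofReal_mul (p_nonneg _ _ _ _)]

lemma ann_nn : ∀ᵐ f ∂(annealed d ℙ Pq 0), f 0 = 0 ∧ ∀ n, ∃ i, f (n + 1) = f n + dir d i := by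
  have hm : MeasurableSet {f : Traj d | f 0 = 0 ∧ ∀ n, ∃ i, f (n + 1) = f n + dir d i} := by
    apply (measurableSet_coord 0 {0}).inter
    have : {f : Traj d | ∀ n, ∃ i, f (n + 1) = f n + dir d i} = ⋂ n, ⋃ i, {f | f (n + 1) = f n + dir d i} := by
      ext f; simp
    change MeasurableSet {f : Traj d | ∀ n, ∃ i, f (n + 1) = f n + dir d i}
    rw [this]
    refine MeasurableSet.iInter fun n => MeasurableSet.iUnion fun i => ?_
    exact measurableSet_eq_fun (measurable_pi_apply _) ((measurable_pi_apply n).add_const _)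
  rw [ae_iff, show {f : Traj d | ¬ (f 0 = 0 ∧ ∀ n, ∃ i, f (n + 1) = f n + dir d i)} =
    {f : Traj d | f 0 = 0 ∧ ∀ n, ∃ i, f (n + 1) = f n + dir d i}ᶜ from rfl, ann_apply hq ℙ 0 hm.compl]
  have : ∀ ω, Pq ω 0 {f : Traj d | f 0 = 0 ∧ ∀ n, ∃ i, f (n + 1) = f n + dir d i}ᶜ = 0 := fun ω => q_nn hq ω
  simp [this]

lemma ann_cyl (n : ℕ) (σ : Traj d) : annealed d ℙ Pq 0 (cyl n σ) =
    ENNReal.ofReal ((if σ 0 = 0 then 1 else 0) * ∫ ω, ∏ k ∈ Finset.range n, trans d ω (σ k) (σ (k + 1)) ∂ℙ) := by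
  rw [ann_apply hq ℙ 0 (measurableSet_cyl n σ)]
  simp_rw [q_cyl hq]
  have h0 : ∀ ω : Env d, 0 ≤ ∏ k ∈ Finset.range n, trans d ω (σ k) (σ (k + 1)) := fun ω =>
    Finset.prod_nonneg fun k _ => trans_nonneg _ _ _
  have bd : Bd (fun ω : Env d => ∏ k ∈ Finset.range n, trans d ω (σ k) (σ (k + 1))) :=
    Bd.of01 (Finset.measurable_fun_prod _ fun k _ => measurable_trans _ _) h0
      (fun ω => Finset.prod_le_one (fun k _ => trans_nonneg _ _ _) fun k _ => trans_le_one _ _ _)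
  rw [← E_cmul, ofReal_integral_eq_lintegral_ofReal ((bd.cmul _).int ℙ)]
  exact ae_of_all _ fun ω => mul_nonneg (by split <;> norm_num) (h0 ω)

end quenched



lemma meas2 {d : ℕ} (n m : ℕ) (R : V d → V d → Prop) : MeasurableSet {f : Traj d | R (f n) (f m)} := by
  have h : Measurable (fun f : Traj d => (f n, f m)) := (measurable_pi_apply n).prodMk (measurable_pi_apply m)
  exact h (MeasurableSet.of_discrete (s := {q : V d × V d | R q.1 q.2}))

/-- discounted expected number of visits to level `k` -/
noncomputable def Nv {d : ℕ} (P : Measure (Traj d)) (s : ℝ) (k : ℤ) : ℝ≥0∞ :=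
  ∑' n, ENNReal.ofReal (s ^ n) * P {f | lev (f n) = k}

/-- discounted flux from level `k` in direction `i` -/
noncomputable def Fl {d : ℕ} (P : Measure (Traj d)) (s : ℝ) (k : ℤ) (i : Fin (2 * d)) : ℝ≥0∞ :=
  ∑' n, ENNReal.ofReal (s ^ n) * P {f | lev (f n) = k ∧ f (n + 1) = f n + dir d i}

lemma geo_lt_top {s : ℝ} (h0 : 0 ≤ s) (h1 : s < 1) : ∑' n : ℕ, ENNReal.ofReal (s ^ n) ≠ ⊤ := by
  rw [← ENNReal.ofReal_tsum_of_nonneg (fun n => pow_nonneg h0 n) (summable_geometric_of_lt_one h0 h1)]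
  exact ENNReal.ofReal_ne_top

section flux
variable {d : ℕ} {Pq : Env d → V d → Measure (Traj d)} (hq : IsQuenchedLaw d Pq)
  {ℙ : Measure (Env d)} [IsProbabilityMeasure ℙ] {s : ℝ} (h0 : 0 ≤ s) (h1 : s < 1)
include hq h0 h1

lemma EG_eq (x : V d) : ENNReal.ofReal (∫ ω, G s ω 0 x ∂ℙ) =
    ∑' n, ENNReal.ofReal (s ^ n) * annealed d ℙ Pq 0 {f | f n = x} := by
  have hs := E_tsum (ℙ := ℙ) (F := fun n ω => s ^ n * p ω n 0 x) (c := fun n => s ^ n)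
    (fun n => (bd_p n 0 x).cmul _) (fun n ω => by
      rw [abs_of_nonneg (mul_nonneg (pow_nonneg h0 n) (p_nonneg _ _ _ _))]
      exact mul_le_of_le_one_right (pow_nonneg h0 n) (p_le_one _ _ _ _)) (summable_geometric_of_lt_one h0 h1)
  have e : ∫ ω, G s ω 0 x ∂ℙ = ∑' n, ∫ ω, s ^ n * p ω n 0 x ∂ℙ := hs.tsum_eq.symm
  rw [e, ENNReal.ofReal_tsum_of_nonneg _ hs.summable]
  · congr 1; ext n
    rw [E_cmul, ENNReal.ofReal_mul (pow_nonneg h0 n), ann_p hq ℙ]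
  · intro n; exact integral_nonneg fun ω => mul_nonneg (pow_nonneg h0 n) (p_nonneg _ _ _ _)

lemma EGw_eq (x : V d) (i : Fin (2 * d)) : ENNReal.ofReal (∫ ω, G s ω 0 x * w ω x i ∂ℙ) =
    ∑' n, ENNReal.ofReal (s ^ n) * annealed d ℙ Pq 0 {f | f n = x ∧ f (n + 1) = x + dir d i} := by
  have hs := E_tsum (ℙ := ℙ) (F := fun n ω => s ^ n * (p ω n 0 x * w ω x i)) (c := fun n => s ^ n)
    (fun n => ((bd_p n 0 x).mul (bd_w x i)).cmul _) (fun n ω => by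
      rw [abs_of_nonneg (mul_nonneg (pow_nonneg h0 n) (mul_nonneg (p_nonneg _ _ _ _) (w_nonneg _ _ _)))]
      exact mul_le_of_le_one_right (pow_nonneg h0 n) (mul_le_one₀ (p_le_one _ _ _ _) (w_nonneg _ _ _) (w_le_one _ _ _)))
    (summable_geometric_of_lt_one h0 h1)
  have e : ∫ ω, G s ω 0 x * w ω x i ∂ℙ = ∑' n, ∫ ω, s ^ n * (p ω n 0 x * w ω x i) ∂ℙ := by
    rw [hs.tsum_eq]
    congr 1; ext ω
    rw [G, ← tsum_mul_right]
    congr 1; ext n; ring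
  rw [e, ENNReal.ofReal_tsum_of_nonneg _ hs.summable]
  · congr 1; ext n
    rw [E_cmul, ENNReal.ofReal_mul (pow_nonneg h0 n), ann_step hq ℙ]
  · intro n; exact integral_nonneg fun ω => mul_nonneg (pow_nonneg h0 n) (mul_nonneg (p_nonneg _ _ _ _) (w_nonneg _ _ _))

lemma Nv_eq (k : ℤ) : Nv (annealed d ℙ Pq 0) s k =
    ∑' x : {x : V d // lev x = k}, ENNReal.ofReal (∫ ω, G s ω 0 x.1 ∂ℙ) := by
  simp_rw [EG_eq hq h0 h1]
  rw [ENNReal.tsum_comm]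
  unfold Nv
  congr 1; ext n
  rw [ENNReal.tsum_mul_left]
  congr 1
  have : {f : Traj d | lev (f n) = k} = ⋃ x : {x : V d // lev x = k}, {f | f n = x.1} := by
    ext f; simp
  rw [this, measure_iUnion]
  · intro x y hxy
    rw [Function.onFun, Set.disjoint_left]
    intro f (hf : f n = x.1) (hf' : f n = y.1)
    exact hxy (Subtype.ext (hf.symm.trans hf'))
  · intro x; exact measurableSet_coord n {x.1}

lemma Fl_eq (k : ℤ) (i : Fin (2 * d)) : Fl (annealed d ℙ Pq 0) s k i =
    ∑' x : {x : V d // lev x = k}, ENNReal.ofReal (∫ ω, G s ω 0 x.1 * w ω x.1 i ∂ℙ) := by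
  simp_rw [EGw_eq hq h0 h1]
  rw [ENNReal.tsum_comm]
  unfold Fl
  congr 1; ext n
  rw [ENNReal.tsum_mul_left]
  congr 1
  have : {f : Traj d | lev (f n) = k ∧ f (n + 1) = f n + dir d i} =
      ⋃ x : {x : V d // lev x = k}, {f | f n = x.1 ∧ f (n + 1) = x.1 + dir d i} := by
    ext f
    simp only [Set.mem_iUnion, Subtype.exists, Set.mem_ofPred_eq]
    constructor
    · rintro ⟨a, b⟩; exact ⟨f n, a, rfl, b⟩
    · rintro ⟨x, a, b, c⟩; subst b; exact ⟨a, c⟩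
  rw [this, measure_iUnion]
  · intro x y hxy
    rw [Function.onFun, Set.disjoint_left]
    intro f hf hf'
    exact hxy (Subtype.ext (hf.1.symm.trans hf'.1))
  · intro x; exact meas2 n (n + 1) (fun u v => u = x.1 ∧ v = x.1 + dir d i)

lemma Fl_ne_top (k : ℤ) (i : Fin (2 * d)) :
    Fl (annealed d ℙ Pq 0) s k i ≤ ∑' n : ℕ, ENNReal.ofReal (s ^ n) := by
  have := ann_prob hq ℙ 0
  exact ENNReal.tsum_le_tsum fun n => mul_le_of_le_one_right' prob_le_one

/-- The level sum of the core estimate. -/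
lemma Nv_le {C : ℝ} (hC : 0 ≤ C) (S : Finset (V d)) (hS : ∀ v ∈ S, lev v = 0) (up : Fin (2 * d))
    (hcore : ∀ x : V d, ∫ ω, G s ω 0 x ∂ℙ ≤ C * ∑ v ∈ S, ∫ ω, G s ω 0 (x + v) * w ω (x + v) up ∂ℙ) (k : ℤ) :
    Nv (annealed d ℙ Pq 0) s k ≤ ENNReal.ofReal C * S.card * Fl (annealed d ℙ Pq 0) s k up := by
  rw [Nv_eq hq h0 h1, Fl_eq hq h0 h1]
  set a : V d → ℝ≥0∞ := fun x => ENNReal.ofReal (∫ ω, G s ω 0 x * w ω x up ∂ℙ) with ha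
  have hintg : ∀ x, 0 ≤ ∫ ω, G s ω 0 x * w ω x up ∂ℙ := fun x =>
    integral_nonneg fun ω => mul_nonneg (G_nonneg h0 h1 _ _ _) (w_nonneg _ _ _)
  calc ∑' x : {x : V d // lev x = k}, ENNReal.ofReal (∫ ω, G s ω 0 x.1 ∂ℙ)
      ≤ ∑' x : {x : V d // lev x = k}, ENNReal.ofReal C * ∑ v ∈ S, a (x.1 + v) := by
        refine ENNReal.tsum_le_tsum fun x => ?_
        refine (ENNReal.ofReal_le_ofReal (hcore x.1)).trans ?_
        rw [ENNReal.ofReal_mul hC, ENNReal.ofReal_sum_of_nonneg fun v _ => hintg _]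
    _ = ENNReal.ofReal C * ∑ v ∈ S, ∑' x : {x : V d // lev x = k}, a (x.1 + v) := by
        rw [ENNReal.tsum_mul_left, Summable.tsum_finsetSum fun v _ => ENNReal.summable]
    _ ≤ ENNReal.ofReal C * ∑ v ∈ S, ∑' x : {x : V d // lev x = k}, a x.1 := by
        refine mul_le_mul' le_rfl (Finset.sum_le_sum fun v hv => ?_)
        have hv0 := hS v hv
        let e : {x : V d // lev x = k} → {x : V d // lev x = k} := fun x =>
          ⟨x.1 + v, by rw [lev_add, hv0, x.2, add_zero]⟩
        have he : Function.Injective e := by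
          intro x y h
          have := congrArg Subtype.val h
          exact Subtype.ext (add_right_cancel this)
        exact ENNReal.tsum_comp_le_tsum_of_injective he (fun x : {x : V d // lev x = k} => a x.1)
    _ = _ := by rw [Finset.sum_const, nsmul_eq_mul, mul_assoc]

lemma Fl_le {r : ℝ} (hr : 0 ≤ r) (i : Fin (2 * d))
    (h : ∀ x : V d, ∫ ω, G s ω 0 x * w ω x i ∂ℙ ≤ r * ∫ ω, G s ω 0 x ∂ℙ) (k : ℤ) :
    Fl (annealed d ℙ Pq 0) s k i ≤ ENNReal.ofReal r * Nv (annealed d ℙ Pq 0) s k := by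
  rw [Nv_eq hq h0 h1, Fl_eq hq h0 h1, ← ENNReal.tsum_mul_left]
  refine ENNReal.tsum_le_tsum fun x => ?_
  rw [← ENNReal.ofReal_mul hr]
  exact ENNReal.ofReal_le_ofReal (h x.1)

/-- flux balance -/
lemma Fl_bal (hd : 0 < d) (up dn : Fin (2 * d)) (hup : (up : ℕ) = 0) (hdn : (dn : ℕ) = d) (k : ℤ) :
    Fl (annealed d ℙ Pq 0) s k up ≤ (if 0 ≤ k then 1 else 0) + Fl (annealed d ℙ Pq 0) s (k + 1) dn := by
  have := ann_prob hq ℙ 0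
  set P := annealed d ℙ Pq 0 with hP
  have nn := ann_nn hq ℙ
  set b : ℕ → ℝ≥0∞ := fun n => P {f | lev (f n) ≤ k} with hb
  have hstep : ∀ n, P {f | lev (f n) = k ∧ f (n + 1) = f n + dir d up} + b (n + 1) ≤
      b n + P {f | lev (f n) = k + 1 ∧ f (n + 1) = f n + dir d dn} := by
    intro n
    have hm1 : MeasurableSet {f : Traj d | lev (f (n + 1)) ≤ k} := measurableSet_coord (n + 1) {x | lev x ≤ k}
    rw [hb]
    rw [← measure_union _ hm1]
    · refine le_trans (measure_mono_ae ?_) (measure_union_le _ _)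
      filter_upwards [nn] with f hf
      rintro (h | h)
      · left
        exact le_of_eq h.1
      · have h' : lev (f (n + 1)) ≤ k := h
        obtain ⟨i, hi⟩ := hf.2 n
        have hl : lev (f (n + 1)) = lev (f n) + lev (dir d i) := by rw [hi, lev_add]
        rw [lev_dir hd] at hl
        by_cases hlk : lev (f n) ≤ k
        · left; exact hlk
        · right
          have hid : (i : ℕ) = d := by
            by_contra hne
            rw [if_neg hne] at hl
            split_ifs at hl <;> omega
          have : i = dn := Fin.ext (hid.trans hdn.symm)
          rw [if_neg (by omega), if_pos hid] at hl
          subst this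
          refine ⟨by omega, hi⟩
    · rw [Set.disjoint_left]
      rintro f ⟨h1, h2⟩ (h3 : lev (f (n + 1)) ≤ k)
      rw [h2, lev_add, lev_dir hd, if_pos hup] at h3
      omega
  have hB : ∑' n, ENNReal.ofReal (s ^ n) * b (n + 1) ≠ ⊤ := by
    refine ne_top_of_le_ne_top (geo_lt_top h0 h1) (ENNReal.tsum_le_tsum fun n => mul_le_of_le_one_right' prob_le_one)
  have e1 : Fl P s k up + ∑' n, ENNReal.ofReal (s ^ n) * b (n + 1) ≤
      ∑' n, ENNReal.ofReal (s ^ n) * b n + Fl P s (k + 1) dn := by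
    unfold Fl
    rw [← ENNReal.tsum_add, ← ENNReal.tsum_add]
    refine ENNReal.tsum_le_tsum fun n => ?_
    rw [← mul_add, ← mul_add]
    exact mul_le_mul' le_rfl (hstep n)
  have e2 : ∑' n, ENNReal.ofReal (s ^ n) * b n ≤ b 0 + ∑' n, ENNReal.ofReal (s ^ n) * b (n + 1) := by
    rw [tsum_eq_zero_add' ENNReal.summable]
    simp only [pow_zero, ENNReal.ofReal_one, one_mul]
    exact add_le_add le_rfl (ENNReal.tsum_le_tsum fun n => mul_le_mul' (ENNReal.ofReal_le_ofReal (pow_le_pow_of_le_one h0 h1.le (Nat.le_succ n))) le_rfl)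
  have e3 : b 0 ≤ if 0 ≤ k then 1 else 0 := by
    split_ifs with hk
    · exact prob_le_one
    · apply le_of_eq
      have : P {f | lev (f 0) ≤ k} = P ∅ := by
        apply measure_congr
        filter_upwards [nn] with f hf
        apply propext
        refine ⟨fun (h : lev (f 0) ≤ k) => ?_, fun h => h.elim⟩
        rw [hf.1, lev_zero] at h
        exact (hk h).elim
      rw [hb]; simp only; rw [this, measure_empty]
  have e4 : Fl P s k up + ∑' n, ENNReal.ofReal (s ^ n) * b (n + 1) ≤
      (if 0 ≤ k then 1 else 0) + Fl P s (k + 1) dn + ∑' n, ENNReal.ofReal (s ^ n) * b (n + 1) := by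
    calc _ ≤ _ := e1
      _ ≤ (b 0 + ∑' n, ENNReal.ofReal (s ^ n) * b (n + 1)) + Fl P s (k + 1) dn := by gcongr
      _ ≤ ((if 0 ≤ k then 1 else 0) + ∑' n, ENNReal.ofReal (s ^ n) * b (n + 1)) + Fl P s (k + 1) dn := by gcongr
      _ = _ := by ring
  exact (ENNReal.add_le_add_iff_right hB).1 e4

end flux

/-- solving the flux recursion -/
lemma rec_bound (F : ℤ → ℝ≥0∞) (m : ℝ≥0∞) (hm : m ≠ ⊤) (hF : ∀ k, F k ≤ m)
    (h : ∀ k, F k ≤ (if 0 ≤ k then 1 else 0) + (1 / 3) * F (k + 1)) :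
    (∀ k, F k ≤ 3 / 2) ∧ ∀ j : ℕ, F (-(j : ℤ)) ≤ 3 / 2 * (1 / 3) ^ j := by
  have a : ∀ k, F k ≤ 3 / 2 := by
    set M := ⨆ k, F k with hM
    have hM1 : M ≤ m := iSup_le hF
    have hMt : M ≠ ⊤ := ne_top_of_le_ne_top hm hM1
    have hM2 : M ≤ 1 + (1 / 3) * M := by
      refine iSup_le fun k => (h k).trans ?_
      gcongr
      · split_ifs <;> simp
      · exact le_iSup F (k + 1)
    have hM3 : M ≤ 3 / 2 := by
      clear_value M
      clear hM hM1
      lift M to ℝ≥0 using hMt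
      have e : ((1 : ℝ≥0∞) + 1 / 3 * (M : ℝ≥0∞)) = ((1 + 1 / 3 * M : ℝ≥0) : ℝ≥0∞) := by
        push_cast; simp
      rw [e, ENNReal.coe_le_coe] at hM2
      have e2 : (3 / 2 : ℝ≥0∞) = ((3 / 2 : ℝ≥0) : ℝ≥0∞) := by push_cast; rfl
      rw [e2, ENNReal.coe_le_coe]
      rw [← NNReal.coe_le_coe] at hM2 ⊢
      push_cast at hM2 ⊢
      linarith
    exact fun k => (le_iSup F k).trans hM3
  refine ⟨a, fun j => ?_⟩
  induction j with
  | zero => simpa using a 0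
  | succ j ih =>
    refine (h _).trans ?_
    rw [if_neg (by push_cast; omega), zero_add, show -((j + 1 : ℕ) : ℤ) + 1 = -(j : ℤ) by push_cast; ring, pow_succ]
    calc (1 / 3 : ℝ≥0∞) * F (-(j : ℤ)) ≤ 1 / 3 * (3 / 2 * (1 / 3) ^ j) := by gcongr
      _ = _ := by ring

lemma lim_one (a : ℕ → ℝ≥0∞) (ha : ∀ n, a n ≤ 1) (c : ℝ≥0∞)
    (h : ∀ s : ℝ, 1 / 2 ≤ s → s < 1 → ∑' n, ENNReal.ofReal (s ^ n) * a n ≤ c) : ∑' n, a n ≤ c := by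
  refine ENNReal.tsum_le_of_sum_range_le fun N => ?_
  have ht : Tendsto (fun s : ℝ => ∑ n ∈ Finset.range N, ENNReal.ofReal (s ^ n) * a n) (𝓝[<] 1)
      (𝓝 (∑ n ∈ Finset.range N, a n)) := by
    refine tendsto_finsetSum _ fun n _ => ?_
    have : Tendsto (fun s : ℝ => ENNReal.ofReal (s ^ n)) (𝓝[<] 1) (𝓝 1) := by
      have h1 : Tendsto (fun s : ℝ => s ^ n) (𝓝[<] 1) (𝓝 (1 ^ n)) :=
        ((continuous_pow n).tendsto 1).mono_left nhdsWithin_le_nhds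
      rw [one_pow] at h1
      have := ENNReal.tendsto_ofReal h1
      simpa using this
    have h2 := ENNReal.Tendsto.mul_const (b := a n) this (Or.inl one_ne_zero)
    simpa using h2
  refine le_of_tendsto ht ?_
  have : Set.Ico (1 / 2 : ℝ) 1 ∈ 𝓝[<] (1 : ℝ) := Ico_mem_nhdsLT (by norm_num)
  filter_upwards [this] with s hs
  exact (ENNReal.sum_le_tsum _).trans (h s hs.1 hs.2)

/-- the three outputs of the flux argument -/
structure Out {d : ℕ} (P : Measure (Traj d)) : Prop where
  prob : IsProbabilityMeasure P
  nn : ∀ᵐ f ∂P, f 0 = 0 ∧ ∀ n, ∃ i, f (n + 1) = f n + dir d i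
  vis : ∃ K : ℝ≥0∞, K ≠ ⊤ ∧ ∀ k : ℤ, ∑' n, P {f | lev (f n) = k} ≤ K
  low : ∀ K : ℕ, ∑' n, P {f | lev (f n) ≤ K} ≠ ⊤
  neg : P {f | ∃ n, lev (f n) < 0} ≤ 1 / 2

lemma out_of {d : ℕ} (hd : 0 < d) {Pq : Env d → V d → Measure (Traj d)} (hq : IsQuenchedLaw d Pq)
    {ℙ : Measure (Env d)} {β : Fin (2 * d) → ℝ} (hM : Mom d β ℙ)
    (up dn : Fin (2 * d)) (hup : (up : ℕ) = 0) (hdn : (dn : ℕ) = d)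
    {C : ℝ} (hC : 0 ≤ C) (S : Finset (V d)) (hS : ∀ v ∈ S, lev v = 0)
    (hcore : ∀ s : ℝ, 1 / 2 ≤ s → s < 1 → ∀ x : V d,
      ∫ ω, G s ω 0 x ∂ℙ ≤ C * ∑ v ∈ S, ∫ ω, G s ω 0 (x + v) * w ω (x + v) up ∂ℙ)
    (hβ : 0 ≤ β dn) (h1 : 1 < ∑ i, β i) (hδ : β dn / (∑ i, β i - 1) * (C * S.card) ≤ 1 / 3) :
    Out (annealed d ℙ Pq 0) := by
  have := hM.prob
  have hprob := ann_prob hq ℙ 0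
  have nn := ann_nn hq ℙ
  set P := annealed d ℙ Pq 0 with hP
  set r := β dn / (∑ i, β i - 1) with hr
  have hr0 : 0 ≤ r := div_nonneg hβ (by linarith)
  -- bounds for s < 1
  have hA : ∀ s : ℝ, 1 / 2 ≤ s → s < 1 → ∀ k, Nv P s k ≤ ENNReal.ofReal C * S.card * Fl P s k up :=
    fun s hs h1 k => Nv_le hq (by linarith) h1 hC S hS up (hcore s hs h1) k
  have hB : ∀ s : ℝ, 1 / 2 ≤ s → s < 1 → ∀ k, Fl P s k dn ≤ ENNReal.ofReal r * Nv P s k := by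
    intro s hs hs1 k
    refine Fl_le hq (by linarith) hs1 hr0 dn (fun x => ?_) k
    have := Kminus hM (by linarith) hs1 0 x dn
    rw [hr, div_mul_eq_mul_div, le_div_iff₀ (by linarith)]
    linarith
  have hBC : ∀ s : ℝ, 1 / 2 ≤ s → s < 1 → ∀ k, Fl P s k dn ≤ (1 / 3) * Fl P s k up := by
    intro s hs hs1 k
    calc _ ≤ _ := hB s hs hs1 k
      _ ≤ ENNReal.ofReal r * (ENNReal.ofReal C * S.card * Fl P s k up) := by gcongr; exact hA s hs hs1 k
      _ = ENNReal.ofReal (r * (C * S.card)) * Fl P s k up := by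
        rw [ENNReal.ofReal_mul hr0, ENNReal.ofReal_mul hC, ENNReal.ofReal_natCast]; ring
      _ ≤ ENNReal.ofReal (1 / 3) * Fl P s k up := by gcongr
      _ = _ := by
        congr 1
        rw [ENNReal.ofReal_div_of_pos (by norm_num)]; norm_num
  have hF : ∀ s : ℝ, 1 / 2 ≤ s → s < 1 → (∀ k, Fl P s k up ≤ 3 / 2) ∧
      ∀ j : ℕ, Fl P s (-(j : ℤ)) up ≤ 3 / 2 * (1 / 3) ^ j := by
    intro s hs hs1
    have h0 : 0 ≤ s := by linarith
    apply rec_bound (fun k => Fl P s k up) _ (geo_lt_top h0 hs1) (fun k => Fl_ne_top hq h0 hs1 k up)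
    intro k
    refine (Fl_bal hq h0 hs1 hd up dn hup hdn k).trans ?_
    gcongr
    exact hBC s hs hs1 (k + 1)
  have hCS : ENNReal.ofReal C * S.card ≠ ⊤ := ENNReal.mul_ne_top ENNReal.ofReal_ne_top (ENNReal.natCast_ne_top _)
  have hvis : ∀ k : ℤ, ∑' n, P {f | lev (f n) = k} ≤ ENNReal.ofReal C * S.card * (3 / 2) := by
    intro k
    refine lim_one _ (fun n => prob_le_one) _ fun s hs hs1 => (hA s hs hs1 k).trans ?_
    gcongr; exact (hF s hs hs1).1 k
  have hvisneg : ∀ j : ℕ, ∑' n, P {f | lev (f n) = -(j : ℤ)} ≤ ENNReal.ofReal C * S.card * (3 / 2 * (1 / 3) ^ j) := by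
    intro j
    refine lim_one _ (fun n => prob_le_one) _ fun s hs hs1 => (hA s hs hs1 _).trans ?_
    gcongr; exact (hF s hs hs1).2 j
  have h32 : (3 / 2 : ℝ≥0∞) ≠ ⊤ := ENNReal.div_ne_top (by norm_num) (by norm_num)
  refine ⟨hprob, nn, ⟨_, ENNReal.mul_ne_top hCS h32, hvis⟩, fun K => ?_, ?_⟩
  · have hle : ∀ n, P {f | lev (f n) ≤ K} ≤ ∑ k ∈ Finset.range (K + 1), P {f | lev (f n) = k} +
        ∑' j : ℕ, P {f | lev (f n) = -(j : ℤ)} := by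
      intro n
      have hsub : {f : Traj d | lev (f n) ≤ K} ⊆ (⋃ k ∈ Finset.range (K + 1), {f | lev (f n) = k}) ∪
          ⋃ j : ℕ, {f | lev (f n) = -(j : ℤ)} := by
        intro f (hf : lev (f n) ≤ K)
        rcases le_total 0 (lev (f n)) with h | h
        · left
          refine Set.mem_biUnion (x := (lev (f n)).toNat) ?_ ?_
          · simp only [Finset.coe_range, Set.mem_Iio]; omega
          · change lev (f n) = ((lev (f n)).toNat : ℤ); omega
        · right
          refine Set.mem_iUnion.2 ⟨(lev (f n)).natAbs, ?_⟩
          change lev (f n) = -((lev (f n)).natAbs : ℤ); omega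
      refine (measure_mono hsub).trans ((measure_union_le _ _).trans ?_)
      gcongr
      · exact measure_biUnion_finset_le _ _
      · exact measure_iUnion_le _
    refine ne_top_of_le_ne_top ?_ (ENNReal.tsum_le_tsum hle)
    rw [ENNReal.tsum_add, Summable.tsum_finsetSum fun _ _ => ENNReal.summable, ENNReal.tsum_comm]
    apply ENNReal.add_ne_top.2 ⟨?_, ?_⟩
    · exact (ENNReal.sum_lt_top.2 fun (k : ℕ) _ => lt_of_le_of_lt (hvis (k : ℤ)) (ENNReal.mul_ne_top hCS h32).lt_top).ne
    · refine ne_top_of_le_ne_top ?_ (ENNReal.tsum_le_tsum hvisneg)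
      rw [ENNReal.tsum_mul_left, ENNReal.tsum_mul_left]
      refine ENNReal.mul_ne_top hCS (ENNReal.mul_ne_top h32 ?_)
      rw [ENNReal.tsum_geometric]
      refine ENNReal.inv_ne_top.2 ?_
      rw [Ne, tsub_eq_zero_iff_le, not_le]
      exact ENNReal.div_lt_of_lt_mul (by norm_num)
  · have hd0 : ∑' n, P {f | lev (f n) = 0 ∧ f (n + 1) = f n + dir d dn} ≤ 1 / 2 := by
      refine lim_one _ (fun n => prob_le_one) _ fun s hs hs1 => (hBC s hs hs1 0).trans ?_
      calc (1 / 3 : ℝ≥0∞) * Fl P s 0 up ≤ 1 / 3 * (3 / 2) := by gcongr; exact (hF s hs hs1).1 0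
        _ ≤ 1 / 2 := by
          apply le_of_eq
          rw [ENNReal.div_eq_inv_mul, ENNReal.div_eq_inv_mul, mul_one, ← mul_assoc, mul_comm (3⁻¹ : ℝ≥0∞), mul_assoc,
            ENNReal.inv_mul_cancel (by norm_num) (by norm_num), mul_one]; simp
    refine le_trans (measure_mono_ae ?_) ((measure_iUnion_le _).trans hd0)
    filter_upwards [nn] with f hf
    rintro ⟨n, hn⟩
    have hex : ∃ n, lev (f n) < 0 := ⟨n, hn⟩
    have hm := Nat.find_spec hex
    set m := Nat.find hex with hmdef
    have hm0 : m ≠ 0 := by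
      intro h; rw [h, hf.1, lev_zero] at hm; omega
    obtain ⟨m', hm'⟩ := Nat.exists_eq_succ_of_ne_zero hm0
    have hlt := Nat.find_min hex (m := m') (by omega)
    refine Set.mem_iUnion.2 ⟨m', ?_⟩
    obtain ⟨i, hi⟩ := hf.2 m'
    rw [hm', Nat.succ_eq_add_one, hi, lev_add, lev_dir hd] at hm
    have hid : (i : ℕ) = d := by
      by_contra hne
      rw [if_neg hne] at hm
      split_ifs at hm <;> omega
    have : i = dn := Fin.ext (hid.trans hdn.symm)
    rw [if_neg (by omega), if_pos hid] at hm
    subst this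
    refine ⟨by omega, hi⟩



/-- shift of trajectories -/
def sh {d : ℕ} (n : ℕ) (f : Traj d) : Traj d := fun k => f (n + k) - f n

lemma measurable_sh {d : ℕ} (n : ℕ) : Measurable (sh (d := d) n) := by
  refine measurable_pi_lambda _ fun k => ?_
  exact (measurable_pi_apply (n + k)).sub (measurable_pi_apply n)

def Dinf (d : ℕ) : Set (Traj d) := {f | ∀ k, 0 ≤ lev (f k)}

def Dm (d : ℕ) (m : ℕ) : Set (Traj d) := {f | ∀ k ≤ m, 0 ≤ lev (f k)}

lemma dep_Dm (d m : ℕ) : Dep m (Dm d m) := by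
  intro f g h hf k hk
  rw [← h k hk]; exact hf k hk

lemma Dinf_eq (d : ℕ) (m : ℕ) : Dinf d = ⋂ j, Dm d (m + j) := by
  ext f
  simp only [Set.mem_iInter]
  exact ⟨fun h j k _ => h k, fun h k => h k k (by omega)⟩

lemma meas_Dinf (d : ℕ) : MeasurableSet (Dinf d) := by
  rw [Dinf_eq d 0]
  exact MeasurableSet.iInter fun j => (dep_Dm d _).measurable

lemma prodT {d : ℕ} (σ : Traj d) (n : ℕ) :
    (∀ (ω : Env d) (v : V d), ∏ k ∈ Finset.range n, trans d ω (σ k + v) (σ (k + 1) + v) = 0) ∨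
    ∃ M : Multiset (Edge d), (∀ (ω : Env d) (v : V d),
      ∏ k ∈ Finset.range n, trans d ω (σ k + v) (σ (k + 1) + v) = mon (M.map (fun e => (e.1 + v, e.2))) ω) ∧
      ∀ e ∈ M, ∃ k < n, e.1 = σ k := by
  induction n with
  | zero => exact Or.inr ⟨0, by simp, by simp⟩
  | succ n ih =>
    rcases ih with h | ⟨M, hM, hM2⟩
    · left; intro ω v; rw [Finset.prod_range_succ, h, zero_mul]
    · by_cases hi : ∃ i, σ (n + 1) = σ n + dir d i
      · obtain ⟨i, hi⟩ := hi
        right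
        refine ⟨(σ n, i) ::ₘ M, fun ω v => ?_, fun e he => ?_⟩
        · rw [Finset.prod_range_succ, hM, Multiset.map_cons, mon_cons, hi,
            show σ n + dir d i + v = σ n + v + dir d i by abel, trans_dir, mul_comm]
        · rcases Multiset.mem_cons.1 he with rfl | he
          · exact ⟨n, by omega, rfl⟩
          · obtain ⟨k, hk, e⟩ := hM2 e he
            exact ⟨k, by omega, e⟩
      · left; intro ω v
        rw [Finset.prod_range_succ, trans_zero, mul_zero]
        intro i h
        apply hi
        refine ⟨i, ?_⟩
        have : σ (n + 1) + v = (σ n + dir d i) + v := by rw [h]; abel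
        exact add_right_cancel this

/-- The renewal property of the annealed law. -/
def Ren {d : ℕ} (P : Measure (Traj d)) : Prop :=
  ∀ (n : ℕ) (Γ : Set (Traj d)), Dep n Γ → (∀ f ∈ Γ, ∀ m < n, lev (f m) < lev (f n)) →
    ∀ A : Set (Traj d), MeasurableSet A → P (Γ ∩ sh n ⁻¹' (A ∩ Dinf d)) = P Γ * P (A ∩ Dinf d)

section
variable {d : ℕ} {Pq : Env d → V d → Measure (Traj d)} (hq : IsQuenchedLaw d Pq)
    {ℙ : Measure (Env d)} {β : Fin (2 * d) → ℝ} (hM : Mom d β ℙ)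
include hq hM

lemma ren_cyl (n m : ℕ) (g h : Traj d) (hg : ∀ k < n, lev (g k) < lev (g n)) (hh : ∀ k ≤ m, 0 ≤ lev (h k)) :
    annealed d ℙ Pq 0 (cyl n g ∩ sh n ⁻¹' (cyl m h)) = annealed d ℙ Pq 0 (cyl n g) * annealed d ℙ Pq 0 (cyl m h) := by
  have := hM.prob
  by_cases h0 : h 0 = 0
  · set ρ : Traj d := fun k => if k ≤ n then g k else h (k - n) + g n with hρ
    have e : cyl n g ∩ sh n ⁻¹' (cyl m h) = cyl (n + m) ρ := by
      ext f
      simp only [Set.mem_inter_iff, Set.mem_preimage, mem_cyl, sh]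
      constructor
      · rintro ⟨h1, h2⟩ k hk
        simp only [hρ]
        split_ifs with hkn
        · exact h1 k hkn
        · have := h2 (k - n) (by omega)
          rw [show n + (k - n) = k by omega] at this
          rw [← this, ← h1 n le_rfl]; abel
      · intro hf
        have h1 : ∀ k ≤ n, f k = g k := fun k hk => by
          have := hf k (by omega)
          simp only [hρ] at this
          rwa [if_pos hk] at this
        refine ⟨h1, fun k hk => ?_⟩
        rcases Nat.eq_zero_or_pos k with rfl | hk0
        · simp [h0]
        · have := hf (n + k) (by omega)
          simp only [hρ] at this
          rw [if_neg (by omega), show n + k - n = k by omega] at this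
          rw [this, h1 n le_rfl]; abel
    rw [e, ann_cyl hq, ann_cyl hq, ann_cyl hq, ← ENNReal.ofReal_mul]
    swap
    · exact mul_nonneg (by split <;> norm_num) (integral_nonneg fun ω => Finset.prod_nonneg fun k _ => trans_nonneg _ _ _)
    congr 1
    rw [if_pos h0, one_mul, mul_assoc]
    have hρ0 : ρ 0 = g 0 := by simp [hρ]
    rw [hρ0]
    congr 1
    have e1 : ∀ ω : Env d, ∏ k ∈ Finset.range (n + m), trans d ω (ρ k) (ρ (k + 1)) =
        (∏ k ∈ Finset.range n, trans d ω (g k + 0) (g (k + 1) + 0)) *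
          ∏ k ∈ Finset.range m, trans d ω (h k + g n) (h (k + 1) + g n) := by
      intro ω
      rw [Finset.prod_range_add]
      congr 1
      · refine Finset.prod_congr rfl fun k hk => ?_
        rw [Finset.mem_range] at hk
        simp only [hρ, add_zero]
        rw [if_pos (by omega), if_pos (by omega)]
      · refine Finset.prod_congr rfl fun k hk => ?_
        have e2 : ∀ j, ρ (n + j) = h j + g n := by
          intro j
          simp only [hρ]
          split_ifs with hj
          · have : j = 0 := by omega
            subst this; simp [h0]
          · rw [show n + j - n = j by omega]
        rw [e2, add_assoc, e2]
    simp_rw [e1]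
    have t1 := prodT g n
    have t2 := prodT h m
    have s1 : ∀ ω : Env d, ∏ k ∈ Finset.range n, trans d ω (g k) (g (k + 1)) =
      ∏ k ∈ Finset.range n, trans d ω (g k + 0) (g (k + 1) + 0) := by simp
    have s2 : ∀ ω : Env d, ∏ k ∈ Finset.range m, trans d ω (h k) (h (k + 1)) =
      ∏ k ∈ Finset.range m, trans d ω (h k + 0) (h (k + 1) + 0) := by simp
    simp_rw [s1, s2]
    rcases t1 with t1 | ⟨M, t1, t1'⟩
    · simp_rw [t1]; simp
    · rcases t2 with t2 | ⟨N, t2, t2'⟩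
      · simp_rw [t2]; simp
      · simp_rw [t1, t2]
        have m0 : ∀ M : Multiset (Edge d), M.map (fun e => (e.1 + 0, e.2)) = M := by simp
        rw [hM.mul, m0 N, hM.shift N]
        intro a ha b hb
        rw [m0] at ha
        obtain ⟨k, hk, ek⟩ := t1' a ha
        obtain ⟨c, hc, rfl⟩ := Multiset.mem_map.1 hb
        obtain ⟨j, hj, ej⟩ := t2' c hc
        intro heq
        have h1 := congrArg lev heq
        rw [ek, lev_add, ej] at h1
        have := hg k hk
        have := hh j hj.le
        omega
  · have e : cyl n g ∩ sh n ⁻¹' (cyl m h) = ∅ := by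
      ext f
      simp only [Set.mem_inter_iff, Set.mem_preimage, mem_cyl, sh, Set.mem_empty_iff_false, iff_false]
      rintro ⟨-, h2⟩
      have := h2 0 (by omega)
      simp at this
      exact h0 this.symm
    rw [e, measure_empty, ann_cyl hq ℙ m, if_neg h0]; simp

lemma ren_dep {n m : ℕ} {Γ B : Set (Traj d)} (hΓ : Dep n Γ) (hl : ∀ f ∈ Γ, ∀ k < n, lev (f k) < lev (f n))
    (hB : Dep m B) (hBD : B ⊆ Dm d m) :
    annealed d ℙ Pq 0 (Γ ∩ sh n ⁻¹' B) = annealed d ℙ Pq 0 Γ * annealed d ℙ Pq 0 B := by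
  have := hM.prob
  rw [dep_measure _ hΓ (measurable_sh n hB.measurable), dep_measure' _ hΓ, dep_measure' _ hB,
    ← ENNReal.tsum_mul_right]
  congr 1; ext g
  rw [← ENNReal.tsum_mul_left]
  have e : cyl n (pext g.1) ∩ sh n ⁻¹' B =
    ⋃ h : {h : Fin (m + 1) → V d // pext h ∈ B}, cyl n (pext g.1) ∩ sh n ⁻¹' (cyl m (pext h.1)) := by
    conv_lhs => rw [dep_union hB, Set.preimage_iUnion, Set.inter_iUnion]
  rw [e, measure_iUnion]
  · congr 1; ext h
    exact ren_cyl hq hM n m _ _ (hl _ g.2) (hBD h.2)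
  · intro h h' hne
    refine Disjoint.mono Set.inter_subset_right Set.inter_subset_right ?_
    exact (cyl_disj h.1 h'.1 (fun hh => hne (Subtype.ext hh))).preimage _
  · intro h
    exact (measurableSet_cyl _ _).inter (measurable_sh n (measurableSet_cyl _ _))

lemma ren_of : Ren (annealed d ℙ Pq 0) := by
  have := hM.prob
  have hp := ann_prob hq ℙ 0
  intro n Γ hΓ hl A hA
  set P := annealed d ℙ Pq 0 with hP
  have anti : ∀ B : Set (Traj d), ∀ m, Antitone fun j => B ∩ Dm d (m + j) := by
    intro B m i j hij f hf
    exact ⟨hf.1, fun k hk => hf.2 k (by omega)⟩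
  have hI : ∀ B : Set (Traj d), ∀ m, B ∩ Dinf d = ⋂ j, B ∩ Dm d (m + j) := by
    intro B m; rw [Dinf_eq d m, Set.inter_iInter]
  have step2 : ∀ (m : ℕ) (B : Set (Traj d)), Dep m B →
      P (Γ ∩ sh n ⁻¹' (B ∩ Dinf d)) = P Γ * P (B ∩ Dinf d) := by
    intro m B hB
    have t1 : Tendsto (fun j => P (B ∩ Dm d (m + j))) atTop (𝓝 (P (B ∩ Dinf d))) := by
      rw [hI B m]
      exact tendsto_measure_iInter_atTop
        (fun j => (hB.measurable.inter (dep_Dm d _).measurable).nullMeasurableSet) (anti B m) ⟨0, measure_ne_top _ _⟩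
    have t2 : Tendsto (fun j => P (Γ ∩ sh n ⁻¹' (B ∩ Dm d (m + j)))) atTop (𝓝 (P (Γ ∩ sh n ⁻¹' (B ∩ Dinf d)))) := by
      rw [hI B m, Set.preimage_iInter, Set.inter_iInter]
      refine tendsto_measure_iInter_atTop
        (fun j => (hΓ.measurable.inter (measurable_sh n (hB.measurable.inter (dep_Dm d _).measurable))).nullMeasurableSet)
        ?_ ⟨0, measure_ne_top _ _⟩
      intro i j hij f hf
      exact ⟨hf.1, anti B m hij hf.2⟩
    have t3 : Tendsto (fun j => P Γ * P (B ∩ Dm d (m + j))) atTop (𝓝 (P Γ * P (B ∩ Dinf d))) :=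
      ENNReal.Tendsto.const_mul t1 (Or.inr (measure_ne_top _ _))
    refine tendsto_nhds_unique t2 (t3.congr fun j => ?_)
    refine (ren_dep hq hM hΓ hl (m := m + j) ?_ Set.inter_subset_right).symm
    intro f g hfg hf
    exact ⟨hB f g (fun k hk => hfg k (by omega)) hf.1, dep_Dm d _ f g hfg hf.2⟩
  let μ1 : Measure (Traj d) := ((P.restrict Γ).map (sh n)).restrict (Dinf d)
  let μ2 : Measure (Traj d) := P Γ • P.restrict (Dinf d)
  have h1 : ∀ A, MeasurableSet A → μ1 A = P (Γ ∩ sh n ⁻¹' (A ∩ Dinf d)) := by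
    intro A hA
    simp only [μ1]
    rw [Measure.restrict_apply hA, Measure.map_apply (measurable_sh n) (hA.inter (meas_Dinf d)),
      Measure.restrict_apply (measurable_sh n (hA.inter (meas_Dinf d))), Set.inter_comm]
  have h2 : ∀ A, MeasurableSet A → μ2 A = P Γ * P (A ∩ Dinf d) := by
    intro A hA
    simp only [μ2]
    rw [Measure.smul_apply, Measure.restrict_apply hA, smul_eq_mul]
  have hfin : IsFiniteMeasure μ1 := by
    refine ⟨?_⟩
    rw [h1 _ MeasurableSet.univ]; exact measure_lt_top _ _
  have key : μ1 = μ2 := by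
    refine ext_of_generate_finite (cyls d) (cyls_gen d) (cyls_pi d) ?_ ?_
    · rintro _ ⟨m, σ, rfl⟩
      rw [h1 _ (measurableSet_cyl _ _), h2 _ (measurableSet_cyl _ _)]
      refine step2 m _ ?_
      intro f g hfg hf k hk
      rw [← hfg k hk]; exact hf k hk
    · rw [h1 _ MeasurableSet.univ, h2 _ MeasurableSet.univ]
      exact step2 0 _ (fun _ _ _ _ => trivial)
  rw [← h1 A hA, ← h2 A hA, key]

end



def Lad {d : ℕ} (t : ℕ) (f : Traj d) : Prop := ∀ m < t, lev (f m) < lev (f t)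

def Reg {d : ℕ} (t : ℕ) (f : Traj d) : Prop := Lad t f ∧ ∀ m, t ≤ m → lev (f t) ≤ lev (f m)

def Piv {d : ℕ} (t n : ℕ) (f : Traj d) : Prop := Lad t f ∧ ∀ m, t ≤ m → m ≤ n → lev (f t) ≤ lev (f m)

/-- candidates for the first regeneration time -/
def GG (d : ℕ) (n : ℕ) : Set (Traj d) := {f | Lad n f ∧ ∀ t, 1 ≤ t → t < n → ¬ Piv t n f}

noncomputable def th {d : ℕ} (f : Traj d) : ℕ := if h : ∃ n, 1 ≤ n ∧ Reg n f then Nat.find h else 0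

lemma lev_sub {d : ℕ} (x y : V d) : lev (x - y) = lev x - lev y := by
  have := lev_add (x - y) y
  rw [sub_add_cancel] at this
  omega

lemma lev_sh {d : ℕ} (n k : ℕ) (f : Traj d) : lev (sh n f k) = lev (f (n + k)) - lev (f n) := lev_sub _ _

lemma sh_zero {d : ℕ} (n : ℕ) (f : Traj d) : sh n f 0 = 0 := by simp [sh]

lemma sh_sh {d : ℕ} (a b : ℕ) (f : Traj d) : sh a (sh b f) = sh (b + a) f := by
  ext k
  simp [sh, add_assoc]

lemma Lad.congr {d : ℕ} {t : ℕ} {f g : Traj d} (h : ∀ k ≤ t, f k = g k) (hf : Lad t f) : Lad t g := by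
  intro m hm
  rw [← h m hm.le, ← h t le_rfl]; exact hf m hm

lemma Piv.congr {d : ℕ} {t n : ℕ} (htn : t ≤ n) {f g : Traj d} (h : ∀ k ≤ n, f k = g k) (hf : Piv t n f) : Piv t n g := by
  refine ⟨hf.1.congr fun k hk => h k (hk.trans htn), fun m h1 h2 => ?_⟩
  rw [← h m h2, ← h t htn]; exact hf.2 m h1 h2

lemma dep_GG (d n : ℕ) : Dep n (GG d n) := by
  intro f g h hf
  refine ⟨hf.1.congr h, fun t h1 h2 hp => hf.2 t h1 h2 ?_⟩
  exact hp.congr h2.le fun k hk => (h k hk).symm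

lemma Dinf_sh {d : ℕ} (n : ℕ) (f : Traj d) : sh n f ∈ Dinf d ↔ ∀ m, n ≤ m → lev (f n) ≤ lev (f m) := by
  constructor
  · intro h m hm
    have := h (m - n)
    rw [lev_sh, show n + (m - n) = m by omega] at this
    omega
  · intro h k
    rw [lev_sh]
    have := h (n + k) (by omega)
    omega

lemma Reg_sh {d : ℕ} {t s : ℕ} {f : Traj d} (h : Reg (t + s) f) : Reg s (sh t f) := by
  refine ⟨fun m hm => ?_, fun m hm => ?_⟩
  · rw [lev_sh, lev_sh]
    have := h.1 (t + m) (by omega)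
    omega
  · rw [lev_sh, lev_sh]
    have := h.2 (t + m) (by omega)
    omega

lemma th_le {d : ℕ} {s : ℕ} {f : Traj d} (h1 : 1 ≤ s) (h : Reg s f) : th f ≤ s := by
  have hex : ∃ n, 1 ≤ n ∧ Reg n f := ⟨s, h1, h⟩
  rw [th, dif_pos hex]
  exact Nat.find_min' hex ⟨h1, h⟩

lemma th_spec {d : ℕ} {f : Traj d} (h : 1 ≤ th f) : Reg (th f) f := by
  by_cases hex : ∃ n, 1 ≤ n ∧ Reg n f
  · rw [th, dif_pos hex]; exact (Nat.find_spec hex).2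
  · rw [th, dif_neg hex] at h; omega

lemma th_pos {d : ℕ} {s : ℕ} {f : Traj d} (h1 : 1 ≤ s) (h : Reg s f) : 1 ≤ th f := by
  have hex : ∃ n, 1 ≤ n ∧ Reg n f := ⟨s, h1, h⟩
  rw [th, dif_pos hex]
  exact (Nat.find_spec hex).1

lemma th_iff {d : ℕ} {n : ℕ} (hn : 1 ≤ n) (f : Traj d) : th f = n ↔ f ∈ GG d n ∧ sh n f ∈ Dinf d := by
  rw [Dinf_sh]
  constructor
  · rintro rfl
    have h := th_spec hn
    refine ⟨⟨h.1, fun t h1 h2 hp => ?_⟩, h.2⟩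
    have : Reg t f := by
      refine ⟨hp.1, fun m hm => ?_⟩
      rcases le_total m (th f) with hm' | hm'
      · exact hp.2 m hm hm'
      · exact (hp.2 _ h2.le le_rfl).trans (h.2 m hm')
    have := th_le h1 this
    omega
  · rintro ⟨h1, h2⟩
    have hr : Reg n f := ⟨h1.1, h2⟩
    have hle := th_le hn hr
    have hp := th_pos hn hr
    by_contra hne
    have hs := th_spec hp
    exact h1.2 (th f) hp (by omega) ⟨hs.1, fun m hm _ => hs.2 m hm⟩

lemma meas_th_eq {d : ℕ} (n : ℕ) : MeasurableSet {f : Traj d | th f = n} := by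
  have h1 : ∀ n, 1 ≤ n → MeasurableSet {f : Traj d | th f = n} := by
    intro n hn
    have : {f : Traj d | th f = n} = GG d n ∩ sh n ⁻¹' (Dinf d) := by
      ext f; exact th_iff hn f
    rw [this]
    exact (dep_GG d n).measurable.inter (measurable_sh n (meas_Dinf d))
  rcases Nat.eq_zero_or_pos n with rfl | hn
  · have : {f : Traj d | th f = 0} = (⋃ n : ℕ, {f : Traj d | th f = n + 1})ᶜ := by
      ext f
      simp only [Set.mem_compl_iff, Set.mem_iUnion, Set.mem_ofPred_eq, not_exists]
      constructor
      · intro h n; omega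
      · intro h
        by_contra hne
        exact h (th f - 1) (by omega)
    rw [this]
    exact (MeasurableSet.iUnion fun n => h1 (n + 1) (by omega)).compl
  · exact h1 n hn

lemma measurable_th {d : ℕ} : Measurable (th (d := d)) :=
  measurable_to_countable' fun n => meas_th_eq n

/-- the regeneration shift -/
noncomputable def Sf {d : ℕ} (f : Traj d) : Traj d := sh (th f) f

lemma measurable_Sf {d : ℕ} : Measurable (Sf (d := d)) := by
  intro A hA
  have : Sf ⁻¹' A = ⋃ n : ℕ, {f : Traj d | th f = n} ∩ sh n ⁻¹' A := by
    ext f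
    simp only [Set.mem_preimage, Set.mem_iUnion, Set.mem_inter_iff, Set.mem_ofPred_eq]
    constructor
    · intro h; exact ⟨th f, rfl, h⟩
    · rintro ⟨n, rfl, h⟩; exact h
  rw [this]
  exact MeasurableSet.iUnion fun n => (meas_th_eq n).inter (measurable_sh n hA)

lemma next_lad {d : ℕ} {f : Traj d} (hu : ∀ K : ℤ, ∃ n, K < lev (f n)) (D : ℕ) :
    ∃ n, D < n ∧ Lad n f ∧ ∀ t, D < t → t < n → ¬ Lad t f := by
  have hex0 : ∃ n, ∀ m ≤ D, lev (f m) < lev (f n) := by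
    obtain ⟨n, hn⟩ := hu ((Finset.range (D + 1)).sup' (by simp) fun m => lev (f m))
    refine ⟨n, fun m hm => lt_of_le_of_lt ?_ hn⟩
    exact Finset.le_sup' (fun m => lev (f m)) (by simp; omega)
  have hex : ∃ n, D < n ∧ Lad n f := by
    refine ⟨Nat.find hex0, ?_, ?_⟩
    · by_contra h
      exact lt_irrefl _ (Nat.find_spec hex0 _ (not_lt.1 h))
    · intro m hm
      have := Nat.find_min hex0 hm
      push Not at this
      obtain ⟨m', hm', hle⟩ := this
      exact lt_of_le_of_lt hle (Nat.find_spec hex0 m' hm')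
  refine ⟨Nat.find hex, (Nat.find_spec hex).1, (Nat.find_spec hex).2, fun t h1 h2 h3 => ?_⟩
  exact Nat.find_min hex h2 ⟨h1, h3⟩

lemma th_exists {d : ℕ} {f : Traj d} (hu : ∀ K : ℤ, ∃ n, K < lev (f n)) (hfin : {n | f ∈ GG d n}.Finite) :
    1 ≤ th f := by
  obtain ⟨t0, h1, h2, h3⟩ := next_lad hu 0
  have hmem : t0 ∈ {n | f ∈ GG d n} := ⟨h2, fun t ht ht' hp => h3 t (by omega) ht' hp.1⟩
  obtain ⟨n, hn, hmax⟩ := Set.exists_max_image _ (fun n : ℕ => n) hfin ⟨t0, hmem⟩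
  have hn1 : 1 ≤ n := le_trans h1 (hmax t0 hmem)
  refine th_pos hn1 ⟨hn.1, ?_⟩
  by_contra hc
  push Not at hc
  obtain ⟨D, hD, hlt⟩ := hc
  obtain ⟨n', g1, g2, g3⟩ := next_lad hu D
  have : f ∈ GG d n' := by
    refine ⟨g2, fun t ht ht' hp => ?_⟩
    have htD : t ≤ D := by
      by_contra h
      exact g3 t (by omega) ht' hp.1
    have hle := hp.2 D htD g1.le
    rcases lt_or_ge t n with h | h
    · exact hn.2 t ht h ⟨hp.1, fun m a b => hp.2 m a (by omega)⟩
    · have : lev (f n) ≤ lev (f t) := by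
        rcases h.eq_or_lt with h | h
        · rw [h]
        · exact (hp.1 n h).le
      omega
  have := hmax n' this
  omega



/-- law conditioned on never going below the starting level -/
noncomputable def Qt {d : ℕ} (P : Measure (Traj d)) : Measure (Traj d) := (P (Dinf d))⁻¹ • P.restrict (Dinf d)

lemma Qt_apply {d : ℕ} (P : Measure (Traj d)) {A : Set (Traj d)} (hA : MeasurableSet A) :
    Qt P A = (P (Dinf d))⁻¹ * P (A ∩ Dinf d) := by
  rw [Qt, Measure.smul_apply, Measure.restrict_apply hA, smul_eq_mul]

section regen
variable {d : ℕ} {P : Measure (Traj d)} (ho : Out P)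
include ho

lemma Dinf_ne : P (Dinf d) ≠ 0 := by
  have := ho.prob
  intro h
  have h1 : P (Dinf d)ᶜ = 1 := (prob_compl_eq_one_iff (meas_Dinf d)).2 h
  have h2 : (Dinf d)ᶜ = {f : Traj d | ∃ n, lev (f n) < 0} := by
    ext f; simp [Dinf]
  rw [h2] at h1
  have := ho.neg
  rw [h1] at this
  norm_num at this

lemma ae_lev : ∀ᵐ f ∂P, ∀ K : ℕ, ∀ᶠ n in atTop, (K : ℤ) < lev (f n) := by
  rw [ae_all_iff]
  intro K
  have := measure_setOfPred_frequently_eq_zero (ho.low K)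
  rw [ae_iff]
  convert this using 3
  ext f
  simp [Filter.Frequently]

lemma ae_unb : ∀ᵐ f ∂P, ∀ K : ℤ, ∃ n, K < lev (f n) := by
  filter_upwards [ae_lev ho] with f hf K
  obtain ⟨n, hn⟩ := (hf K.toNat).exists
  exact ⟨n, by omega⟩

variable (hr : Ren P)
include hr

lemma P_th {n : ℕ} (hn : 1 ≤ n) {A : Set (Traj d)} (hA : MeasurableSet A) :
    P ({f | th f = n} ∩ Sf ⁻¹' A) = P (GG d n) * P (A ∩ Dinf d) := by
  rw [← hr n (GG d n) (dep_GG d n) (fun f hf => hf.1) A hA]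
  congr 1
  ext f
  simp only [Set.mem_inter_iff, Set.mem_preimage, Set.mem_ofPred_eq]
  constructor
  · rintro ⟨h1, h2⟩
    have := (th_iff hn f).1 h1
    rw [Sf, h1] at h2
    exact ⟨this.1, h2, this.2⟩
  · rintro ⟨h1, h2, h3⟩
    have := (th_iff hn f).2 ⟨h1, h3⟩
    rw [Sf, this]
    exact ⟨rfl, h2⟩

lemma PD_th {n : ℕ} (hn : 1 ≤ n) {A : Set (Traj d)} (hA : MeasurableSet A) :
    P (({f | th f = n} ∩ Sf ⁻¹' A) ∩ Dinf d) = P (GG d n ∩ Dm d n) * P (A ∩ Dinf d) := by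
  have hdep : Dep n (GG d n ∩ Dm d n) := fun f g h hf => ⟨dep_GG d n f g h hf.1, dep_Dm d n f g h hf.2⟩
  rw [← hr n (GG d n ∩ Dm d n) hdep (fun f hf => hf.1.1) A hA]
  congr 1
  ext f
  simp only [Set.mem_inter_iff, Set.mem_preimage, Set.mem_ofPred_eq]
  constructor
  · rintro ⟨⟨h1, h2⟩, h3⟩
    have := (th_iff hn f).1 h1
    rw [Sf, h1] at h2
    exact ⟨⟨this.1, fun k _ => h3 k⟩, h2, this.2⟩
  · rintro ⟨⟨h1, h4⟩, h2, h3⟩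
    have := (th_iff hn f).2 ⟨h1, h3⟩
    rw [Sf, this]
    refine ⟨⟨rfl, h2⟩, fun k => ?_⟩
    rcases le_total k n with hk | hk
    · exact h4 k hk
    · exact (h4 n le_rfl).trans ((Dinf_sh n f).1 h3 k hk)

lemma sum_GG : ∑' n, P (GG d n) ≠ ⊤ := by
  have := ho.prob
  rw [tsum_eq_zero_add' ENNReal.summable]
  refine ENNReal.add_ne_top.2 ⟨measure_ne_top _ _, ?_⟩
  have h1 : ∑' n, P (GG d (n + 1)) * P (Dinf d) ≤ 1 := by
    have e : ∀ n, P (GG d (n + 1)) * P (Dinf d) = P {f | th f = n + 1} := by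
      intro n
      have := P_th ho hr (n := n + 1) (by omega) MeasurableSet.univ
      simpa using this.symm
    simp_rw [e]
    rw [← measure_iUnion]
    · exact prob_le_one
    · intro i j hij
      rw [Function.onFun, Set.disjoint_left]
      intro f (h1 : th f = i + 1) (h2 : th f = j + 1)
      omega
    · intro n; exact meas_th_eq (n + 1)
  rw [ENNReal.tsum_mul_right] at h1
  intro h
  rw [h, ENNReal.top_mul (Dinf_ne ho)] at h1
  simp at h1

lemma ae_th : ∀ᵐ f ∂P, 1 ≤ th f := by
  have hfr := measure_setOfPred_frequently_eq_zero (p := fun n f => f ∈ GG d n) (sum_GG ho hr)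
  have hfr' : ∀ᵐ f ∂P, ¬ ∃ᶠ n in atTop, f ∈ GG d n := by
    rw [ae_iff]; simp only [not_not]; exact hfr
  filter_upwards [ae_unb ho, hfr'] with f h1 h2
  refine th_exists h1 ?_
  rw [Filter.not_frequently, ← Nat.cofinite_eq_atTop] at h2
  simpa [Filter.eventually_cofinite] using h2

lemma Qt_prob : IsProbabilityMeasure (Qt P) := by
  have := ho.prob
  refine ⟨?_⟩
  rw [Qt_apply P MeasurableSet.univ, Set.univ_inter, ENNReal.inv_mul_cancel (Dinf_ne ho) (measure_ne_top _ _)]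

lemma Qt_ac : Qt P ≪ P := by
  intro s hs
  have : P.restrict (Dinf d) s = 0 := by
    refine le_antisymm ?_ (by simp)
    rw [← hs]
    exact Measure.restrict_apply_le _ s
  rw [Qt, Measure.smul_apply, smul_eq_mul, this, mul_zero]

lemma Qt_th {n : ℕ} {A : Set (Traj d)} (hA : MeasurableSet A) :
    Qt P ({f | th f = n} ∩ Sf ⁻¹' A) = Qt P {f | th f = n} * Qt P A := by
  have := ho.prob
  rcases Nat.eq_zero_or_pos n with rfl | hn
  · have h0 : Qt P {f | th f = 0} = 0 := by
      have : ∀ᵐ f ∂(Qt P), 1 ≤ th f := (Qt_ac ho hr).ae_le (ae_th ho hr)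
      rw [ae_iff] at this
      convert this using 3
      ext f; simp
    rw [h0, zero_mul]
    exact measure_mono_null Set.inter_subset_left h0
  · have h1 : ∀ A : Set (Traj d), MeasurableSet A → Qt P ({f | th f = n} ∩ Sf ⁻¹' A) = P (GG d n ∩ Dm d n) * Qt P A := by
      intro A hA
      rw [Qt_apply P ((meas_th_eq n).inter (measurable_Sf hA)), PD_th ho hr hn hA, Qt_apply P hA]; ring
    have h2 := h1 Set.univ MeasurableSet.univ
    have := Qt_prob ho hr
    rw [Set.preimage_univ, Set.inter_univ, measure_univ, mul_one] at h2
    rw [h1 A hA, h2]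

lemma Qt_th' (B : Set ℕ) {A : Set (Traj d)} (hA : MeasurableSet A) :
    Qt P (th ⁻¹' B ∩ Sf ⁻¹' A) = Qt P (th ⁻¹' B) * Qt P A := by
  have hB : th (d := d) ⁻¹' B = ⋃ n : B, {f : Traj d | th f = n} := by
    ext f; simp
  have hdisj : Pairwise (Function.onFun Disjoint fun n : B => {f : Traj d | th f = n}) := by
    intro i j hij
    rw [Function.onFun, Set.disjoint_left]
    intro f (h1 : th f = i) (h2 : th f = j)
    exact hij (Subtype.ext (h1.symm.trans h2))
  rw [hB, Set.iUnion_inter, measure_iUnion, measure_iUnion hdisj fun n => meas_th_eq _, ← ENNReal.tsum_mul_right]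
  · congr 1; ext n; exact Qt_th ho hr hA
  · intro i j hij
    exact (hdisj hij).mono Set.inter_subset_left Set.inter_subset_left
  · intro n; exact (meas_th_eq _).inter (measurable_Sf hA)

lemma mp_Sf : MeasurePreserving Sf (Qt P) (Qt P) := by
  refine ⟨measurable_Sf, ?_⟩
  ext A hA
  rw [Measure.map_apply measurable_Sf hA]
  have := Qt_th' ho hr Set.univ hA
  have hp := Qt_prob ho hr
  rwa [Set.preimage_univ, Set.univ_inter, measure_univ, one_mul] at this

/-- the regeneration increments -/
noncomputable def inc {d : ℕ} (j : ℕ) (f : Traj d) : ℕ := th (Sf^[j] f)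

omit ho hr in
lemma measurable_inc (j : ℕ) : Measurable (inc (d := d) j) := measurable_th.comp (measurable_Sf.iterate j)

lemma indep_inc {i j : ℕ} (hij : i < j) (A B : Set ℕ) :
    Qt P (inc i ⁻¹' A ∩ inc j ⁻¹' B) = Qt P (inc i ⁻¹' A) * Qt P (inc j ⁻¹' B) := by
  obtain ⟨k, rfl⟩ : ∃ k, j = (k + 1) + i := ⟨j - i - 1, by omega⟩
  have mp := (mp_Sf ho hr).iterate i
  have e1 : inc (d := d) i ⁻¹' A = Sf^[i] ⁻¹' (th ⁻¹' A) := rfl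
  have e2 : inc (d := d) (k + 1 + i) ⁻¹' B = Sf^[i] ⁻¹' (Sf ⁻¹' (inc k ⁻¹' B)) := by
    ext f
    simp only [Set.mem_preimage, inc]
    rw [Function.iterate_add_apply, Function.iterate_succ_apply]
  have mk := measurable_inc (d := d) k (MeasurableSet.of_discrete (s := B))
  have mA := measurable_th (d := d) (MeasurableSet.of_discrete (s := A))
  rw [e1, e2, ← Set.preimage_inter, mp.measure_preimage (mA.inter (measurable_Sf mk)).nullMeasurableSet,
    mp.measure_preimage mA.nullMeasurableSet, mp.measure_preimage (measurable_Sf mk).nullMeasurableSet,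
    Qt_th' ho hr A mk, (mp_Sf ho hr).measure_preimage mk.nullMeasurableSet]

lemma strong_law (hintg : Integrable (fun f => (th f : ℝ)) (Qt P)) :
    ∀ᵐ f ∂(Qt P), Tendsto (fun n : ℕ => (∑ j ∈ Finset.range n, (inc j f : ℝ)) / n) atTop
      (𝓝 (∫ f, (th f : ℝ) ∂(Qt P))) := by
  have hp := Qt_prob ho hr
  have hcast : Measurable (fun n : ℕ => (n : ℝ)) := measurable_from_top
  have := ProbabilityTheory.strong_law_ae_real (μ := Qt P) (fun j f => (inc j f : ℝ)) hintg ?_ ?_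
  · exact this
  · intro i j hij
    have : ProbabilityTheory.IndepFun (inc i) (inc j) (Qt P) := by
      rw [ProbabilityTheory.indepFun_iff_measure_inter_preimage_eq_mul]
      intro A B _ _
      rcases lt_or_gt_of_ne hij with h | h
      · exact indep_inc ho hr h A B
      · rw [Set.inter_comm, mul_comm]; exact indep_inc ho hr h B A
    exact this.comp hcast hcast
  · intro j
    have mp := (mp_Sf ho hr).iterate j
    refine ⟨(hcast.comp (measurable_inc j)).aemeasurable, (hcast.comp (measurable_inc 0)).aemeasurable, ?_⟩
    have e : (fun f : Traj d => (inc j f : ℝ)) = (fun f => (inc 0 f : ℝ)) ∘ Sf^[j] := rfl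
    have hm : Measurable (fun f : Traj d => (inc 0 f : ℝ)) := hcast.comp (measurable_inc 0)
    rw [e, ← Measure.map_map hm mp.measurable, mp.map_eq]

end regen



/-- ladder at level `k` and time `t` -/
def Hk (d : ℕ) (k t : ℕ) : Set (Traj d) := {f | Lad t f ∧ lev (f t) = k}

lemma dep_Hk (d k t : ℕ) : Dep t (Hk d k t) := by
  intro f g h hf
  refine ⟨hf.1.congr h, ?_⟩
  rw [← h t le_rfl]; exact hf.2

def Ek (d : ℕ) (k j t : ℕ) : Set (Traj d) := Hk d k t ∩ sh t ⁻¹' ({f | j < th f} ∩ Dinf d)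

lemma meas_lt (d j : ℕ) : MeasurableSet {f : Traj d | j < th f} :=
  measurable_th (MeasurableSet.of_discrete (s := Set.Ioi j))

lemma meas_Ek (d k j t : ℕ) : MeasurableSet (Ek d k j t) :=
  (dep_Hk d k t).measurable.inter (measurable_sh t ((meas_lt d j).inter (meas_Dinf d)))

def Rk (d : ℕ) (n : ℕ) (q : ℕ × ℕ) : Set (Traj d) := ⋃ t : ℕ, {f | t + q.2 = n ∧ f ∈ Ek d q.1 q.2 t}

lemma meas_Rk (d n : ℕ) (q : ℕ × ℕ) : MeasurableSet (Rk d n q) := by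
  refine MeasurableSet.iUnion fun t => ?_
  by_cases h : t + q.2 = n
  · simp only [h, true_and]; exact meas_Ek d _ _ _
  · simp [h]

lemma Rk_disj {d n : ℕ} {q q' : ℕ × ℕ} (h : q ≠ q') : Disjoint (Rk d n q) (Rk d n q') := by
  rw [Set.disjoint_left]
  intro f h1 h2
  obtain ⟨t, h1, ⟨a1, a2⟩, a3, a4⟩ := Set.mem_iUnion.1 h1
  obtain ⟨t', h2, ⟨b1, b2⟩, b3, b4⟩ := Set.mem_iUnion.1 h2
  have key : ∀ (t t' j : ℕ), t < t' → t' ≤ t + j → Lad t' f → sh t' f ∈ Dinf d → j < th (sh t f) → False := by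
    intro t t' j h1 h2 h3 h4 h5
    have hr : Reg (t + (t' - t)) f := by
      rw [show t + (t' - t) = t' by omega]
      exact ⟨h3, (Dinf_sh t' f).1 h4⟩
    have := th_le (by omega) (Reg_sh hr)
    omega
  rcases lt_trichotomy t t' with hlt | rfl | hlt
  · exact key t t' q.2 hlt (by omega) b1 b4 a3
  · apply h
    have : (q.1 : ℤ) = q'.1 := a2.symm.trans b2
    exact Prod.ext (by exact_mod_cast this) (by omega)
  · exact key t' t q'.2 hlt (by omega) a1 a4 b3

lemma lev_up {d : ℕ} (hd : 0 < d) {f : Traj d} (hf : ∀ n, ∃ i, f (n + 1) = f n + dir d i) (t j : ℕ) :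
    lev (f (t + j)) ≤ lev (f t) + j ∧ lev (f t) - j ≤ lev (f (t + j)) := by
  induction j with
  | zero => simp
  | succ j ih =>
    obtain ⟨i, hi⟩ := hf (t + j)
    rw [← add_assoc, hi, lev_add, lev_dir hd]
    push_cast
    split_ifs <;> omega

lemma hit {d : ℕ} (hd : 0 < d) {f : Traj d} (hf0 : f 0 = 0) (hf : ∀ n, ∃ i, f (n + 1) = f n + dir d i)
    (hu : ∀ K : ℤ, ∃ n, K < lev (f n)) (k : ℕ) : ∃ t, f ∈ Hk d k t := by
  have hex : ∃ n, (k : ℤ) ≤ lev (f n) := by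
    obtain ⟨n, hn⟩ := hu k
    exact ⟨n, hn.le⟩
  have h1 := Nat.find_spec hex
  have h2 : ∀ m < Nat.find hex, lev (f m) < k := fun m hm => by
    have := Nat.find_min hex hm; omega
  have h3 : lev (f (Nat.find hex)) ≤ k := by
    rcases Nat.eq_zero_or_pos (Nat.find hex) with h | h
    · rw [h, hf0, lev_zero]; omega
    · have a := h2 (Nat.find hex - 1) (by omega)
      have b := (lev_up hd hf (Nat.find hex - 1) 1).1
      rw [show Nat.find hex - 1 + 1 = Nat.find hex by omega] at b
      push_cast at b
      omega
  have h4 : lev (f (Nat.find hex)) = k := le_antisymm h3 h1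
  exact ⟨Nat.find hex, fun m hm => by rw [h4]; exact h2 m hm, h4⟩

section integ
variable {d : ℕ} (hd : 0 < d) {P : Measure (Traj d)} (ho : Out P) (hr : Ren P)
include hd ho hr

lemma sum_Ek (k j : ℕ) : P ({f | j < th f} ∩ Dinf d) ≤ ∑' t, P (Ek d k j t) := by
  have := ho.prob
  have e : ∀ t, P (Ek d k j t) = P (Hk d k t) * P ({f | j < th f} ∩ Dinf d) := fun t =>
    hr t (Hk d k t) (dep_Hk d k t) (fun f hf => hf.1) _ (meas_lt d j)
  simp_rw [e]
  rw [ENNReal.tsum_mul_right]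
  refine le_mul_of_one_le_left' ?_
  have h1 : P (⋃ t, Hk d k t) = 1 := by
    rw [← prob_compl_eq_zero_iff (MeasurableSet.iUnion fun t => (dep_Hk d k t).measurable)]
    have : ∀ᵐ f ∂P, f ∈ ⋃ t, Hk d k t := by
      filter_upwards [ho.nn, ae_unb ho] with f h1 h2
      exact Set.mem_iUnion.2 (hit hd h1.1 h1.2 h2 k)
    exact this
  rw [← h1]
  exact measure_iUnion_le _

lemma lev_bd (K n : ℕ) : P (⋃ q ∈ Finset.range K ×ˢ Finset.range K, Rk d n q) ≤
    ∑ i ∈ Finset.range (2 * K), P {f | lev (f n) = ((i : ℕ) : ℤ)} := by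
  have hb : P (⋃ q ∈ Finset.range K ×ˢ Finset.range K, Rk d n q) ≤
      P (⋃ i ∈ Finset.range (2 * K), {f | lev (f n) = ((i : ℕ) : ℤ)}) := by
    apply measure_mono_ae
    filter_upwards [ho.nn] with f hf hmem
    obtain ⟨q, hq, hm⟩ := Set.mem_iUnion₂.1 hmem
    obtain ⟨t, h1, ⟨a1, a2⟩, a3, a4⟩ := Set.mem_iUnion.1 hm
    have b1 := (lev_up hd hf.2 t q.2).1
    have b2 := (Dinf_sh t f).1 a4 (t + q.2) (by omega)
    rw [Finset.mem_product, Finset.mem_range, Finset.mem_range] at hq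
    rw [h1] at b1 b2
    refine Set.mem_iUnion₂.2 ⟨(lev (f n)).toNat, ?_, ?_⟩
    · rw [Finset.mem_range]; omega
    · change lev (f n) = ((lev (f n)).toNat : ℤ); omega
  exact hb.trans (measure_biUnion_finset_le _ _)

lemma tail_bound {C : ℝ≥0∞} (hC : ∀ k : ℤ, ∑' n, P {f | lev (f n) = k} ≤ C) (K : ℕ) :
    (K : ℝ≥0∞) * ∑ j ∈ Finset.range K, P ({f | j < th f} ∩ Dinf d) ≤ (2 * K : ℕ) * C := by
  set I := Finset.range K ×ˢ Finset.range K with hI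
  calc (K : ℝ≥0∞) * ∑ j ∈ Finset.range K, P ({f | j < th f} ∩ Dinf d)
      = ∑ q ∈ I, P ({f | q.2 < th f} ∩ Dinf d) := by
        rw [hI, Finset.sum_product]; simp
    _ ≤ ∑ q ∈ I, ∑' t, P (Ek d q.1 q.2 t) := Finset.sum_le_sum fun q _ => sum_Ek hd ho hr q.1 q.2
    _ ≤ ∑ q ∈ I, ∑' n, P (Rk d n q) := by
        refine Finset.sum_le_sum fun q _ => ?_
        refine le_trans (ENNReal.tsum_le_tsum fun t => ?_)
          (ENNReal.tsum_comp_le_tsum_of_injective (add_left_injective q.2) (fun n => P (Rk d n q)))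
        exact measure_mono fun f hf => Set.mem_iUnion.2 ⟨t, rfl, hf⟩
    _ = ∑' n, ∑ q ∈ I, P (Rk d n q) := (Summable.tsum_finsetSum fun q _ => ENNReal.summable).symm
    _ = ∑' n, P (⋃ q ∈ I, Rk d n q) := by
        congr 1; ext n
        rw [measure_biUnion_finset]
        · intro q _ q' _ hne; exact Rk_disj hne
        · intro q _; exact meas_Rk d n q
    _ ≤ ∑' n, ∑ i ∈ Finset.range (2 * K), P {f | lev (f n) = (i : ℤ)} := by
        refine ENNReal.tsum_le_tsum fun n => ?_
        exact lev_bd hd ho hr K n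
    _ = ∑ i ∈ Finset.range (2 * K), ∑' n, P {f | lev (f n) = (i : ℤ)} :=
        Summable.tsum_finsetSum fun q _ => ENNReal.summable
    _ ≤ ∑ i ∈ Finset.range (2 * K), C := by
        refine Finset.sum_le_sum fun i _ => ?_
        exact hC _
    _ = _ := by rw [Finset.sum_const, Finset.card_range, nsmul_eq_mul]

lemma int_th : Integrable (fun f => (th f : ℝ)) (Qt P) := by
  have := ho.prob
  have hp := Qt_prob ho hr
  obtain ⟨C, hCt, hC⟩ := ho.vis
  have h1 : ∑' j, P ({f | j < th f} ∩ Dinf d) ≤ 2 * C := by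
    refine ENNReal.tsum_le_of_sum_range_le fun K => ?_
    rcases Nat.eq_zero_or_pos K with rfl | hK
    · simp
    · have := tail_bound hd ho hr hC K
      rw [Nat.cast_mul, mul_comm ((2 : ℕ) : ℝ≥0∞), mul_assoc] at this
      exact (ENNReal.mul_le_mul_iff_right (by simp; omega) (ENNReal.natCast_ne_top K)).1 this
  have h2 : ∑' j, Qt P {f | j < th f} ≠ ⊤ := by
    simp_rw [Qt_apply P (meas_lt d _)]
    rw [ENNReal.tsum_mul_left]
    exact ENNReal.mul_ne_top (ENNReal.inv_ne_top.2 (Dinf_ne ho))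
      (ne_top_of_le_ne_top (ENNReal.mul_ne_top (by simp) hCt) h1)
  have hcast : Measurable (fun n : ℕ => (n : ℝ)) := measurable_from_top
  refine ⟨(hcast.comp measurable_th).aestronglyMeasurable, ?_⟩
  rw [hasFiniteIntegral_iff_enorm]
  have e : ∀ f : Traj d, ‖(th f : ℝ)‖ₑ = ∑' j : ℕ, ({f : Traj d | j < th f}).indicator 1 f := by
    intro f
    rw [Real.enorm_natCast, tsum_eq_sum (s := Finset.range (th f))]
    · rw [Finset.sum_congr rfl (g := fun _ => (1 : ℝ≥0∞))]
      · simp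
      · intro j hj
        rw [Finset.mem_range] at hj
        exact Set.indicator_of_mem (show f ∈ {f : Traj d | j < th f} from hj) _
    · intro j hj
      rw [Finset.mem_range] at hj
      exact Set.indicator_of_notMem (show f ∉ {f : Traj d | j < th f} from hj) _
  simp_rw [e]
  rw [lintegral_tsum fun j => (measurable_one.indicator (meas_lt d j)).aemeasurable]
  simp_rw [lintegral_indicator_one (meas_lt d _)]
  exact h2.lt_top

end integ



/-- eventually linear growth of the level -/
def Gd (d : ℕ) : Set (Traj d) := {f | ∃ c : ℕ, 1 ≤ c ∧ ∀ᶠ N : ℕ in atTop, (N : ℤ) ≤ c * lev (f N)}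

lemma meas_Gd (d : ℕ) : MeasurableSet (Gd d) := by
  have : Gd d = ⋃ c : ℕ, ⋃ N0 : ℕ, ⋂ N : ℕ, {f : Traj d | 1 ≤ c ∧ (N0 ≤ N → (N : ℤ) ≤ c * lev (f N))} := by
    ext f
    simp only [Gd, Set.mem_iUnion, Set.mem_iInter, Set.mem_ofPred_eq, eventually_atTop]
    constructor
    · rintro ⟨c, h1, N0, h⟩; exact ⟨c, N0, fun N => ⟨h1, h N⟩⟩
    · rintro ⟨c, N0, h⟩; exact ⟨c, (h 0).1, N0, fun N hN => (h N).2 hN⟩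
  rw [this]
  refine MeasurableSet.iUnion fun c => MeasurableSet.iUnion fun N0 => MeasurableSet.iInter fun N => ?_
  exact measurableSet_coord N {x | 1 ≤ c ∧ (N0 ≤ N → (N : ℤ) ≤ c * lev x)}

lemma Gd_sh {d : ℕ} {n : ℕ} {f : Traj d} (h : sh n f ∈ Gd d) : f ∈ Gd d := by
  obtain ⟨c, hc, h⟩ := h
  obtain ⟨N0, h⟩ := eventually_atTop.1 h
  refine ⟨c + 1, by omega, eventually_atTop.2
    ⟨n + N0 + ((c : ℤ) * (n - c * lev (f n) - lev (f n))).toNat, fun M hM => ?_⟩⟩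
  have h1 := h (M - n) (by omega)
  rw [lev_sh, show n + (M - n) = M by omega, Nat.cast_sub (by omega)] at h1
  have h2 : (c : ℤ) * (n - c * lev (f n) - lev (f n)) ≤ c * (lev (f M) - lev (f n)) := by
    refine le_trans ?_ h1
    omega
  have h3 := le_of_mul_le_mul_left h2 (by omega)
  push_cast
  rw [mul_sub] at h1
  rw [add_mul, one_mul]
  linarith

lemma Gd_of {d : ℕ} {f : Traj d} (h0 : f 0 = 0) (h1 : ∀ j, Sf^[j] f ∈ Dinf d) (h2 : ∀ j, 1 ≤ inc j f)
    {m : ℝ} (h3 : Tendsto (fun n : ℕ => (∑ j ∈ Finset.range n, (inc j f : ℝ)) / n) atTop (𝓝 m)) : f ∈ Gd d := by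
  set t : ℕ → ℕ := fun n => ∑ j ∈ Finset.range n, inc j f with ht
  have hS : ∀ n, Sf^[n] f = sh (t n) f := by
    intro n
    induction n with
    | zero => simp [ht]; ext k; simp [sh, h0]
    | succ n ih =>
      have e : t (n + 1) = t n + inc n f := Finset.sum_range_succ _ _
      rw [e, Function.iterate_succ_apply', Sf, ← sh_sh, ← ih]; rfl
  have hl : ∀ n : ℕ, (n : ℤ) ≤ lev (f (t n)) := by
    intro n
    induction n with
    | zero => simp [ht, h0, lev_zero]
    | succ n ih =>
      have e : t (n + 1) = t n + inc n f := Finset.sum_range_succ _ _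
      have hp := h2 n
      have hL := (th_spec (f := Sf^[n] f) hp).1 0 hp
      change lev (Sf^[n] f 0) < lev (Sf^[n] f (inc n f)) at hL
      rw [hS n, sh_zero, lev_zero, lev_sh, ← e] at hL
      push_cast; omega
  have hN : ∀ n N : ℕ, t n ≤ N → (n : ℤ) ≤ lev (f N) := by
    intro n N hN
    have := h1 n
    rw [hS n, Dinf_sh] at this
    exact (hl n).trans (this N hN)
  obtain ⟨c, hc⟩ := exists_nat_gt (max m 0)
  have hc0 : (0 : ℝ) < c := lt_of_le_of_lt (le_max_right _ _) hc
  have hc1 : 1 ≤ c := by exact_mod_cast hc0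
  have hev : ∀ᶠ n : ℕ in atTop, t n ≤ c * n := by
    filter_upwards [h3.eventually (gt_mem_nhds (lt_of_le_of_lt (le_max_left _ _) hc)), eventually_gt_atTop 0] with n hn hn0
    have hn0' : (0 : ℝ) < n := by exact_mod_cast hn0
    rw [div_lt_iff₀ hn0'] at hn
    have : ((t n : ℕ) : ℝ) ≤ ((c * n : ℕ) : ℝ) := by
      simp only [ht]; push_cast; exact hn.le
    exact_mod_cast this
  have hdiv : Tendsto (fun N : ℕ => N / c) atTop atTop := Nat.tendsto_div_const_atTop (by omega)
  refine ⟨2 * c, by omega, ?_⟩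
  filter_upwards [hdiv.eventually hev, eventually_ge_atTop c] with N h4 h5
  have h6 := hN (N / c) N (h4.trans (Nat.mul_div_le N c))
  have h7 : 1 ≤ N / c := (Nat.one_le_div_iff (by omega)).2 h5
  have h8 : N < c * (N / c + 1) := Nat.lt_mul_div_succ N (by omega)
  have h9 : N ≤ 2 * c * (N / c) := by nlinarith
  have h10 : (N : ℤ) ≤ ((2 * c : ℕ) : ℤ) * ((N / c : ℕ) : ℤ) := by exact_mod_cast h9
  refine h10.trans ?_
  exact mul_le_mul_of_nonneg_left h6 (by omega)

section concl
variable {d : ℕ} (hd : 0 < d) {P : Measure (Traj d)} (ho : Out P) (hr : Ren P)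
include hd ho hr

lemma Qt_Gd : ∀ᵐ f ∂(Qt P), f ∈ Gd d := by
  have hD : ∀ᵐ f ∂(Qt P), f ∈ Dinf d := by
    have h : (Qt P) (Dinf d)ᶜ = 0 := by
      rw [Qt_apply P (meas_Dinf d).compl]; simp
    exact h
  have h1 : ∀ᵐ f ∂(Qt P), ∀ j, Sf^[j] f ∈ Dinf d := ae_all_iff.2 fun j =>
    ((mp_Sf ho hr).iterate j).quasiMeasurePreserving.ae hD
  have ht : ∀ᵐ f ∂(Qt P), 1 ≤ th f := (Qt_ac ho hr).ae_le (ae_th ho hr)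
  have h2 : ∀ᵐ f ∂(Qt P), ∀ j, 1 ≤ inc j f := ae_all_iff.2 fun j =>
    ((mp_Sf ho hr).iterate j).quasiMeasurePreserving.ae ht
  have h0 : ∀ᵐ f ∂(Qt P), f 0 = 0 ∧ ∀ n, ∃ i, f (n + 1) = f n + dir d i := (Qt_ac ho hr).ae_le ho.nn
  filter_upwards [h0, h1, h2, strong_law ho hr (int_th hd ho hr)] with f a b c e
  exact Gd_of a.1 b c e

lemma P_Gd : ∀ᵐ f ∂P, f ∈ Gd d := by
  have := ho.prob
  have hQ : P ((Gd d)ᶜ ∩ Dinf d) = 0 := by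
    have h : Qt P (Gd d)ᶜ = 0 := Qt_Gd hd ho hr
    rw [Qt_apply P (meas_Gd d).compl, mul_eq_zero] at h
    rcases h with h | h
    · exact absurd h (ENNReal.inv_ne_zero.2 (measure_ne_top _ _))
    · exact h
  have hn : ∀ᵐ f ∂P, ∀ n : ℕ, ¬ (th f = n + 1 ∧ Sf f ∈ (Gd d)ᶜ) := by
    rw [ae_all_iff]; intro n
    rw [ae_iff]
    simp only [not_not]
    have := P_th ho hr (n := n + 1) (by omega) (meas_Gd d).compl
    rw [hQ, mul_zero] at this
    exact this
  filter_upwards [hn, ae_th ho hr] with f h1 h2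
  by_contra hc
  refine h1 (th f - 1) ⟨by omega, fun h => hc (Gd_sh h)⟩

lemma P_ball : ∀ᵐ f ∂P, 0 < Filter.liminf (fun n : ℕ => dotl d (e1 d) (f n) / n) Filter.atTop := by
  filter_upwards [P_Gd hd ho hr, ho.nn] with f h1 h2
  have hdot : ∀ x : V d, dotl d (e1 d) x = (lev x : ℝ) := by
    intro x
    rw [lev_eq hd, dotl, Finset.sum_eq_single (⟨0, hd⟩ : Fin d)]
    · simp [e1]
    · intro j _ hj
      have : (j : ℕ) ≠ 0 := fun h => hj (Fin.ext h)
      simp [e1, this]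
    · simp
  obtain ⟨c, hc, h⟩ := h1
  have hc0 : (0 : ℝ) < c := by exact_mod_cast hc
  have lower : ∀ᶠ n : ℕ in atTop, 1 / (c : ℝ) ≤ dotl d (e1 d) (f n) / n := by
    filter_upwards [h, eventually_gt_atTop 0] with n hn hn0
    have hn0' : (0 : ℝ) < n := by exact_mod_cast hn0
    rw [hdot, div_le_div_iff₀ hc0 hn0', one_mul, mul_comm]
    exact_mod_cast hn
  have upper : ∀ n : ℕ, dotl d (e1 d) (f n) / n ≤ 1 := by
    intro n
    rw [hdot]
    have := (lev_up hd h2.2 0 n).1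
    rw [h2.1, lev_zero, zero_add, zero_add] at this
    refine div_le_one_of_le₀ ?_ (Nat.cast_nonneg n)
    exact_mod_cast this
  have hcob : IsCoboundedUnder (· ≥ ·) atTop (fun n : ℕ => dotl d (e1 d) (f n) / n) :=
    (isBoundedUnder_of ⟨1, upper⟩ : IsBoundedUnder (· ≤ ·) atTop _).isCoboundedUnder_ge
  exact lt_of_lt_of_le (by positivity) (le_liminf_of_le hcob lower)

end concl

/-- The sum of all parameters splits into the vertical ones and the lateral ones. -/
lemma sum_split {d : ℕ} (hd : 0 < d) (β : Fin (2 * d) → ℝ) (up dn : Fin (2 * d))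
    (hup : (up : ℕ) = 0) (hdn : (dn : ℕ) = d) :
    ∑ i, β i = β up + β dn + ∑ i with Lat i, β i := by
  rw [← Finset.sum_filter_add_sum_filter_not Finset.univ (fun i => Lat i) β]
  have : (Finset.univ.filter fun i : Fin (2 * d) => ¬ Lat i) = {up, dn} := by
    ext i
    rw [Finset.mem_filter, Finset.mem_insert, Finset.mem_singleton, Fin.ext_iff, Fin.ext_iff,
      hup, hdn]
    unfold Lat
    simp only [Finset.mem_univ, true_and]
    tauto
  rw [this, Finset.sum_pair (by rw [Ne, Fin.ext_iff]; omega)]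
  ring

lemma final (d : ℕ) (hd : 2 ≤ d) (βo : Fin (2 * d) → ℝ) (up dn : Fin (2 * d))
    (hup : (up : ℕ) = 0) (hdn : (dn : ℕ) = d)
    (hβo : ∀ i : Fin (2 * d), i ≠ dn → 0 < βo i) :
    ∃ ε : ℝ, 0 < ε ∧ ε < 1 ∧
      ∀ b : ℝ, 0 < b → b ≤ ε →
        (∀ i : Fin (2 * d),
          (∑ j, Function.update βo dn b j) -
            (Function.update βo dn b i + Function.update βo dn b (opp i)) > 1) →
        ∀ (ℙ : Measure (Env d)) (μ : Measure (Simplex d))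
          (Pq : Env d → V d → Measure (Traj d)),
          IsQuenchedLaw d Pq → IsIIDWith d ℙ μ →
          IsDirichlet d μ (Function.update βo dn b) →
          ∀ᵐ f ∂(annealed d ℙ Pq 0),
            0 < Filter.liminf (fun n : ℕ => dotl d (e1 d) (f n) / n) Filter.atTop := by
  have hd0 : 0 < d := by omega
  have hne : up ≠ dn := by rw [Ne, Fin.ext_iff]; omega
  have hopp : opp up = dn := by
    apply Fin.ext
    simp only [opp, hup, hdn]
    simp [hd0]
  set Λ : ℝ := ∑ i with Lat i, βo i with hΛ
  have hlat : ∀ b : ℝ, ∑ i with Lat i, Function.update βo dn b i = Λ := by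
    intro b
    refine Finset.sum_congr rfl fun i hi => ?_
    have hi2 := (Finset.mem_filter.1 hi).2.2
    rw [Function.update_of_ne (fun h => hi2 (by rw [h, hdn]))]
  have hsum : ∀ b : ℝ, ∑ i, Function.update βo dn b i = βo up + b + Λ := by
    intro b
    rw [sum_split hd0 _ up dn hup hdn, hlat, Function.update_self, Function.update_of_ne hne]
  have hu := hβo up hne
  by_cases h1 : Λ ≤ 1
  · refine ⟨1 / 2, by norm_num, by norm_num, ?_⟩
    intro b hb hbe H
    exfalso
    have := H up
    rw [hsum, hopp, Function.update_self, Function.update_of_ne hne] at this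
    linarith
  push Not at h1
  obtain ⟨i0, hi0, hmin⟩ := Finset.exists_min_image (Finset.univ.erase dn) βo
    ⟨up, Finset.mem_erase.2 ⟨hne, Finset.mem_univ _⟩⟩
  have hm0 : 0 < βo i0 := hβo i0 (Finset.ne_of_mem_erase hi0)
  obtain ⟨C, hC, S, hS, hcore⟩ := core d hd0 (B := βo up + 1 + Λ) (βm := βo i0) (lam := Λ - 1)
    (by linarith) hm0 (by linarith) up hup
  have hK : 0 ≤ C * (S.card : ℝ) := by positivity
  set K : ℝ := C * (S.card : ℝ) with hKd
  refine ⟨min (1 / 2) ((Λ - 1) / (3 * (K + 1))), lt_min (by norm_num) ?_,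
    lt_of_le_of_lt (min_le_left _ _) (by norm_num), ?_⟩
  · exact div_pos (by linarith) (by linarith)
  intro b hb hbe H ℙ μ Pq hq hI hD
  have hb1 : b ≤ 1 / 2 := hbe.trans (min_le_left _ _)
  have hb2 : b ≤ (Λ - 1) / (3 * (K + 1)) := hbe.trans (min_le_right _ _)
  have hpos : ∀ i, 0 < Function.update βo dn b i := by
    intro i
    by_cases h : i = dn
    · rw [h, Function.update_self]; exact hb
    · rw [Function.update_of_ne h]; exact hβo i h
  have hM := mom_of hI hD hpos
  have hPar : Par (Function.update βo dn b) (βo up + 1 + Λ) (βo i0) (Λ - 1) := by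
    refine ⟨hpos, by rw [hsum]; linarith, ?_, by rw [hlat]; linarith⟩
    intro i hi
    have h : i ≠ dn := fun h => hi (by rw [h, hdn])
    rw [Function.update_of_ne h]
    exact hmin i (Finset.mem_erase.2 ⟨h, Finset.mem_univ _⟩)
  have hOut := out_of hd0 hq hM up dn hup hdn hC.le S hS
    (fun s hs hs1 x => hcore _ ℙ hM hPar s hs hs1 0 x) (hpos dn).le
    (by rw [hsum]; linarith) (by
      rw [hsum, Function.update_self, ← hKd]
      rw [le_div_iff₀ (by linarith)] at hb2
      rw [div_mul_eq_mul_div, div_le_iff₀ (by linarith)]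
      nlinarith)
  exact P_ball hd0 hOut (ren_of hq hM)
/-- **Theorem (new ballistic Dirichlet walks).**
Let `d ≥ 2` and `β₁,…,β_d, β_{d+2},…,β_{2d}` be fixed positive numbers. There exists
`ε ∈ (0,1)` such that if `0 < β_{1+d} ≤ ε` and the parameters satisfy
`Σᵢ βᵢ − sup_{1≤i≤d}(βᵢ + β_{i+d}) > 1`, then the walk in the i.i.d. Dirichlet
environment with parameters `(β₁,…,β_{2d})` is ballistic in direction `e₁`. -/
theorem dirichlet_ballistic
    (d : ℕ) (hd : 2 ≤ d)
    (βo : Fin (2 * d) → ℝ)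
    (hβo : ∀ i : Fin (2 * d), i ≠ ⟨d, by omega⟩ → 0 < βo i) :
    ∃ ε : ℝ, 0 < ε ∧ ε < 1 ∧
      ∀ b : ℝ, 0 < b → b ≤ ε →
        (∀ i : Fin (2 * d),
          (∑ j, Function.update βo ⟨d, by omega⟩ b j) -
            (Function.update βo ⟨d, by omega⟩ b i +
              Function.update βo ⟨d, by omega⟩ b (opp i)) > 1) →
        ∀ (ℙ : Measure (Env d)) (μ : Measure (Simplex d))
          (Pq : Env d → V d → Measure (Traj d)),
          IsQuenchedLaw d Pq → IsIIDWith d ℙ μ →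
          IsDirichlet d μ (Function.update βo ⟨d, by omega⟩ b) →
          ∀ᵐ f ∂(annealed d ℙ Pq 0),
            0 < Filter.liminf (fun n : ℕ => dotl d (e1 d) (f n) / n) Filter.atTop := by
  exact final d hd βo ⟨0, by omega⟩ ⟨d, by omega⟩ rfl rfl hβo
end RWRE
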